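/- arXiv:2312.02687 — 3 statements merged into one kernel-verified Lean document; each statement's English description precedes it below -/
import Mathlib

section
/- Let G be a connected simple graph on the vertex set {1,…,n} such that the binomial edge ideal J_G of G has exactly two associated primes (|Ass(S/J_G)| = 2). Then the ordinary and symbolic powers of J_G coincide: J_G^t = J_G^(t) for every integer t ≥ 1. -/
open MvPolynomial

/-- The binomial edge ideal of a simple graph `G`, in the polynomial ring
`k[x_i, y_i : i ∈ V]` (variables indexed by `V ⊕ V`: `Sum.inl i ↦ x_i`, `Sum.inr i ↦ y_i`),
generated by the binomials `x_i y_j - x_j y_i` for edges `{i, j}` of `G`. -/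
noncomputable def binomialEdgeIdeal (k : Type) [Field k] {V : Type} (G : SimpleGraph V) :
    Ideal (MvPolynomial (V ⊕ V) k) :=
  Ideal.span {f | ∃ i j, G.Adj i j ∧
    f = X (Sum.inl i) * X (Sum.inr j) - X (Sum.inl j) * X (Sum.inr i)}

/-- The `t`-th symbolic power of an ideal `I`: the intersection, over all minimal primes `p`
of `I`, of the contraction to `S` of the extension of `I ^ t` to the localization `S_p`. -/
noncomputable def symbolicPower {S : Type*} [CommRing S] (I : Ideal S) (t : ℕ) : Ideal S :=
  ⨅ (p : Ideal S) (hp : p ∈ I.minimalPrimes),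
    haveI : p.IsPrime := hp.1.1
    (Ideal.map (algebraMap S (Localization.AtPrime p)) (I ^ t)).comap
      (algebraMap S (Localization.AtPrime p))


namespace BinomialEdge

section LeadingMonomial

variable {k σ τ : Type*} [Field k]

/-- The polynomials all of whose monomials have `w`-weight less than `d`. -/
noncomputable def lowerTerms (k : Type*) [Field k] {σ : Type*} (w : σ → ℤ) (d : ℤ) :
    Submodule k (MvPolynomial σ k) :=
  restrictSupport k {m | Finsupp.weight w m < d}

lemma mem_lowerTerms {w : σ → ℤ} {d : ℤ} {f : MvPolynomial σ k} :
    f ∈ lowerTerms k w d ↔ ∀ m ∈ f.support, Finsupp.weight w m < d := by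
  simp only [lowerTerms, mem_restrictSupport_iff, Set.subset_def, Finset.mem_coe,
    Set.mem_ofPred_eq]

lemma monomial_mem_lowerTerms {w : σ → ℤ} {d : ℤ} {m : σ →₀ ℕ} (h : Finsupp.weight w m < d)
    (c : k) : monomial m c ∈ lowerTerms k w d := by
  rw [mem_lowerTerms]
  intro a ha
  rw [Finset.mem_singleton.mp (support_monomial_subset ha)]
  exact h

lemma mul_mem_lowerTerms {w : σ → ℤ} {c d : ℤ} {f g : MvPolynomial σ k}
    (hf : f ∈ lowerTerms k w c) (hg : ∀ m ∈ g.support, Finsupp.weight w m ≤ d) :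
    f * g ∈ lowerTerms k w (c + d) := by
  classical
  rw [mem_lowerTerms] at *
  intro m hm
  obtain ⟨a, ha, b, hb, rfl⟩ := Finset.mem_add.mp (support_mul f g hm)
  rw [map_add]
  linarith [hf a ha, hg b hb]

/-- The top `w`-weight part of `f` is the monomial with exponent `m` and coefficient one. -/
def HasLeadingMonomial (w : σ → ℤ) (f : MvPolynomial σ k) (m : σ →₀ ℕ) : Prop :=
  f - monomial m 1 ∈ lowerTerms k w (Finsupp.weight w m)

lemma hasLeadingMonomial_monomial (w : σ → ℤ) (m : σ →₀ ℕ) :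
    HasLeadingMonomial w (monomial m 1 : MvPolynomial σ k) m := by
  simp [HasLeadingMonomial]

lemma HasLeadingMonomial.weight_le {w : σ → ℤ} {f : MvPolynomial σ k} {m : σ →₀ ℕ}
    (h : HasLeadingMonomial w f m) :
    ∀ a ∈ f.support, Finsupp.weight w a ≤ Finsupp.weight w m := by
  classical
  intro a ha
  have hf : f = (f - monomial m 1) + monomial m 1 := by ring
  rw [hf] at ha
  rcases Finset.mem_union.mp (support_add ha) with h1 | h1
  · exact (mem_lowerTerms.mp h a h1).le
  · rw [Finset.mem_singleton.mp (support_monomial_subset h1)]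

lemma HasLeadingMonomial.mul {w : σ → ℤ} {f g : MvPolynomial σ k} {m n : σ →₀ ℕ}
    (hf : HasLeadingMonomial w f m) (hg : HasLeadingMonomial w g n) :
    HasLeadingMonomial w (f * g) (m + n) := by
  have key : f * g - monomial (m + n) 1
      = (f - monomial m 1) * g + (g - monomial n 1) * monomial m 1 := by
    have : (monomial (m + n) (1 : k)) = monomial m 1 * monomial n 1 := by
      rw [monomial_mul, one_mul]
    rw [this]
    ring
  rw [HasLeadingMonomial, key, map_add]
  refine Submodule.add_mem _ (mul_mem_lowerTerms hf hg.weight_le) ?_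
  rw [add_comm]
  exact mul_mem_lowerTerms hg (hasLeadingMonomial_monomial w m).weight_le

lemma HasLeadingMonomial.pow {w : σ → ℤ} {f : MvPolynomial σ k} {m : σ →₀ ℕ}
    (hf : HasLeadingMonomial w f m) (a : ℕ) : HasLeadingMonomial w (f ^ a) (a • m) := by
  induction a with
  | zero => simpa using hasLeadingMonomial_monomial (k := k) w 0
  | succ a ih =>
    rw [pow_succ, succ_nsmul]
    exact ih.mul hf

/-- Subtracting polynomials with the correct leading monomials removes the top-weight part. -/
lemma sub_sum_mem_lowerTerms {w : σ → ℤ} {d : ℤ} {f : MvPolynomial σ k}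
    {g : (σ →₀ ℕ) → MvPolynomial σ k} (hf : ∀ m ∈ f.support, Finsupp.weight w m ≤ d)
    (hg : ∀ m ∈ f.support, Finsupp.weight w m = d → HasLeadingMonomial w (g m) m) :
    f - ∑ m ∈ f.support with Finsupp.weight w m = d, C (coeff m f) * g m ∈ lowerTerms k w d := by
  classical
  have hsub : f - ∑ m ∈ f.support with Finsupp.weight w m = d, C (coeff m f) * g m
      = ∑ m ∈ f.support, (monomial m (coeff m f)
        - if Finsupp.weight w m = d then C (coeff m f) * g m else 0) := by
    rw [Finset.sum_sub_distrib, ← f.as_sum, Finset.sum_filter]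
  rw [hsub]
  refine Submodule.sum_mem _ fun m hm => ?_
  split_ifs with h
  · have hneg : monomial m (coeff m f) - C (coeff m f) * g m
        = -(coeff m f • (g m - monomial m 1)) := by
      rw [smul_sub, ← C_mul', ← C_mul', C_mul_monomial, mul_one]
      ring
    rw [hneg, ← h]
    exact Submodule.neg_mem _ (Submodule.smul_mem _ _ (hg m hm h))
  · rw [sub_zero]
    exact monomial_mem_lowerTerms (lt_of_le_of_ne (hf m hm) h) _

/-- A substitution whose values on the variables have leading monomials `e v` sends the monomial
`m` to a polynomial with leading monomial `∑ m v • e v`. -/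
lemma hasLeadingMonomial_aeval {w : τ → ℤ} {φ : σ → MvPolynomial τ k} {e : σ → τ →₀ ℕ}
    (h : ∀ v, HasLeadingMonomial w (φ v) (e v)) (m : σ →₀ ℕ) :
    HasLeadingMonomial w (aeval φ (monomial m (1 : k))) (Finsupp.linearCombination ℕ e m) := by
  induction m using Finsupp.induction_linear with
  | zero => simpa using hasLeadingMonomial_monomial (k := k) w 0
  | add a b ha hb =>
    rw [← one_mul (1 : k), ← monomial_mul, map_mul, map_add]
    exact ha.mul hb
  | single v a =>
    rw [Finsupp.linearCombination_single, ← X_pow_eq_monomial, map_pow, aeval_X]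
    exact (h v).pow a

/-- A weight-triangular substitution that is injective on exponents keeps the top-weight monomials
of a polynomial. -/
lemma coeff_aeval_of_leading {w : τ → ℤ} {v : σ → ℤ} {φ : σ → MvPolynomial τ k} {e : σ → τ →₀ ℕ}
    (h : ∀ i, HasLeadingMonomial w (φ i) (e i)) (hw : ∀ i, Finsupp.weight w (e i) = v i)
    (he : Function.Injective (Finsupp.linearCombination ℕ e)) {f : MvPolynomial σ k}
    {m : σ →₀ ℕ} (hf : ∀ a ∈ f.support, Finsupp.weight v a ≤ Finsupp.weight v m) :
    coeff (Finsupp.linearCombination ℕ e m) (aeval φ f) = coeff m f := by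
  classical
  have hwt : ∀ a, Finsupp.weight w (Finsupp.linearCombination ℕ e a) = Finsupp.weight v a := by
    intro a
    induction a using Finsupp.induction_linear with
    | zero => simp
    | add a b ha hb => simp only [map_add, ha, hb]
    | single i c =>
      rw [Finsupp.linearCombination_single, map_nsmul, hw, Finsupp.weight_single]
  have hterm : ∀ a ∈ f.support, coeff (Finsupp.linearCombination ℕ e m)
      (aeval φ (monomial a (coeff a f))) = coeff m (monomial a (coeff a f)) := by
    intro a ha
    have h1 : monomial a (coeff a f) = C (coeff a f) * monomial a (1 : k) := by
      rw [C_mul_monomial, mul_one]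
    have h2 : coeff (Finsupp.linearCombination ℕ e m) (aeval φ (monomial a (1 : k)))
        = coeff (Finsupp.linearCombination ℕ e m)
          (monomial (Finsupp.linearCombination ℕ e a) (1 : k)) := by
      rw [← sub_eq_zero, ← coeff_sub]
      by_contra hne
      have := mem_lowerTerms.mp (hasLeadingMonomial_aeval h a) _ (mem_support_iff.mpr hne)
      rw [hwt, hwt] at this
      exact absurd (hf a ha) (not_le.mpr this)
    rw [h1, map_mul, ← algebraMap_eq, AlgHom.commutes, algebraMap_eq, algebraMap_eq, coeff_C_mul,
      coeff_C_mul, h2, coeff_monomial, coeff_monomial]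
    simp only [he.eq_iff]
  conv_lhs => rw [f.as_sum, map_sum, coeff_sum]
  conv_rhs => rw [f.as_sum, coeff_sum]
  exact Finset.sum_congr rfl hterm

/-- Injectivity on exponents of a substitution which multiplies every variable outside a set of
fixed ones by fixed variables and the extra variable `none`. -/
lemma linearCombination_injective {extra : σ → Option σ →₀ ℕ}
    (h : ∀ u v, extra u (some v) ≠ 0 → extra v = 0) :
    Function.Injective
      (Finsupp.linearCombination ℕ fun v => Finsupp.single (some v) 1 + extra v) := by
  classical
  have key : ∀ (m : σ →₀ ℕ) (v : σ), (Finsupp.linearCombination ℕ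
      (fun v => Finsupp.single (some v) 1 + extra v) m : Option σ →₀ ℕ) (some v)
        = m v + m.sum fun u a => a * extra u (some v) := by
    intro m v
    rw [Finsupp.linearCombination_apply, Finsupp.sum_apply]
    simp only [Finsupp.smul_apply, Finsupp.add_apply, smul_eq_mul, mul_add, Finsupp.sum_add]
    congr 1
    rw [Finsupp.sum, Finset.sum_eq_single v]
    · simp
    · intro b _ hb
      simp [hb]
    · intro hv
      simp [Finsupp.notMem_support_iff.mp hv]
  intro m n hmn
  have hfree : ∀ v, extra v ≠ 0 → m v = n v := by
    intro v hv
    have hz : ∀ u, extra u (some v) = 0 := fun u => by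
      by_contra hu
      exact hv (h u v hu)
    have := DFunLike.congr_fun hmn (some v)
    rw [key, key] at this
    simpa [hz] using this
  have hsum : ∀ v, (m.sum fun u a => a * extra u (some v))
      = n.sum fun u a => a * extra u (some v) := by
    intro v
    rw [Finsupp.sum_of_support_subset m Finset.subset_union_left _ (by simp) (s := _ ∪ n.support),
      Finsupp.sum_of_support_subset n Finset.subset_union_right _ (by simp) (s := m.support ∪ _)]
    refine Finset.sum_congr rfl fun u _ => ?_
    by_cases hu : extra u = 0
    · simp [hu]
    · rw [hfree u hu]
  ext v
  have := DFunLike.congr_fun hmn (some v)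
  rw [key, key, hsum] at this
  omega

end LeadingMonomial

section Deformation

variable {k V : Type}

/-- The `2`-minor of the generic `2 × V` matrix on the columns `i` and `j`. -/
noncomputable def minor (k : Type) [Field k] {V : Type} (i j : V) : MvPolynomial (V ⊕ V) k :=
  X (Sum.inl i) * X (Sum.inr j) - X (Sum.inl j) * X (Sum.inr i)

variable [Field k] [LinearOrder V]

open Classical in
/-- The scalar by which the column `i` is a multiple of the column `ρ i` in the generic matrix
whose columns in `T` vanish and whose columns outside `T` are proportional along `ρ`. -/
noncomputable def columnScale (k : Type) [Field k] {V : Type} [LinearOrder V]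
    (T : Set V) (ρ : V → V) (i : V) : MvPolynomial (V ⊕ V) k :=
  if i ∈ T then 0 else if i < ρ i then X (Sum.inr i) else if ρ i < i then X (Sum.inl i) else 1

/-- The parametrization of the matrices whose columns in `T` vanish and whose columns outside `T`
are proportional along `ρ`. -/
noncomputable def rankOneMap (k : Type) [Field k] {V : Type} [LinearOrder V]
    (T : Set V) (ρ : V → V) : MvPolynomial (V ⊕ V) k →ₐ[k] MvPolynomial (V ⊕ V) k :=
  aeval (Sum.elim (fun i => columnScale k T ρ i * X (Sum.inl (ρ i)))
    (fun i => columnScale k T ρ i * X (Sum.inr (ρ i))))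

open Classical in
/-- The values on the variables of a first order thickening of `rankOneMap`, whose parameter is
the variable `none`. -/
noncomputable def deformationVar (k : Type) [Field k] {V : Type} [LinearOrder V]
    (T : Set V) (ρ : V → V) : V ⊕ V → MvPolynomial (Option (V ⊕ V)) k :=
  Sum.elim
    (fun i => rename some (columnScale k T ρ i * X (Sum.inl (ρ i))) +
      X none * if i ∈ T ∨ i < ρ i then X (some (Sum.inl i)) else 0)
    (fun i => rename some (columnScale k T ρ i * X (Sum.inr (ρ i))) +
      X none * if i ∈ T ∨ ρ i < i then X (some (Sum.inr i)) else 0)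

/-- A deformation of `rankOneMap` with parameter the variable `none`. -/
noncomputable def deformation (k : Type) [Field k] {V : Type} [LinearOrder V]
    (T : Set V) (ρ : V → V) : MvPolynomial (V ⊕ V) k →ₐ[k] MvPolynomial (Option (V ⊕ V)) k :=
  aeval (deformationVar k T ρ)

variable {T : Set V} {ρ : V → V}

lemma columnScale_of_mem {i : V} (hi : i ∈ T) : columnScale k T ρ i = 0 := by
  simp [columnScale, hi]

lemma columnScale_ne_zero {i : V} (hi : i ∉ T) : columnScale k T ρ i ≠ 0 := by
  unfold columnScale
  split_ifs <;> simp [X_ne_zero]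

lemma rankOneMap_inl (i : V) : rankOneMap k T ρ (X (Sum.inl i))
    = columnScale k T ρ i * X (Sum.inl (ρ i)) := by
  simp [rankOneMap]

lemma rankOneMap_inr (i : V) : rankOneMap k T ρ (X (Sum.inr i))
    = columnScale k T ρ i * X (Sum.inr (ρ i)) := by
  simp [rankOneMap]

lemma rankOneMap_inl_ne_zero {i : V} (hi : i ∉ T) : rankOneMap k T ρ (X (Sum.inl i)) ≠ 0 := by
  rw [rankOneMap_inl]
  exact mul_ne_zero (columnScale_ne_zero hi) (X_ne_zero _)

lemma rankOneMap_inr_ne_zero {i : V} (hi : i ∉ T) : rankOneMap k T ρ (X (Sum.inr i)) ≠ 0 := by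
  rw [rankOneMap_inr]
  exact mul_ne_zero (columnScale_ne_zero hi) (X_ne_zero _)

lemma minor_ne_zero {i j : V} (h : i ≠ j) : minor k i j ≠ 0 := by
  intro h0
  have := congrArg (eval (Sum.elim (fun a => if a = i then (1 : k) else 0)
    (fun a => if a = j then (1 : k) else 0))) h0
  simp [minor, h, h.symm] at this

lemma rankOneMap_minor_ne_zero {i j : V} (hi : i ∉ T) (hj : j ∉ T) (h : ρ i ≠ ρ j) :
    rankOneMap k T ρ (minor k i j) ≠ 0 := by
  have : rankOneMap k T ρ (minor k i j)
      = columnScale k T ρ i * columnScale k T ρ j * minor k (ρ i) (ρ j) := by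
    simp only [minor, map_sub, map_mul, rankOneMap_inl, rankOneMap_inr]
    ring
  rw [this]
  exact mul_ne_zero (mul_ne_zero (columnScale_ne_zero hi) (columnScale_ne_zero hj))
    (minor_ne_zero h)

lemma deformation_dvd_minor {i j : V} (h : i ∈ T ∨ j ∈ T ∨ ρ i = ρ j) :
    X none ∣ deformation k T ρ (minor k i j) := by
  simp only [minor, deformation, map_sub, map_mul, aeval_X, deformationVar, Sum.elim_inl,
    Sum.elim_inr, rename_X]
  have key : ∀ (s a b c d a' b' c' d' x y x' y' : MvPolynomial (Option (V ⊕ V)) k),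
      s ∣ a * x * (b * y') - b * x' * (a * y) →
      s ∣ (a * x + s * a') * (b * y' + s * b') - (b * x' + s * c') * (a * y + s * d') := by
    rintro s a b c d a' b' c' d' x y x' y' ⟨q, hq⟩
    exact ⟨q + (a * x * b' + a' * (b * y' + s * b') - b * x' * d' - c' * (a * y + s * d')), by
      linear_combination hq⟩
  refine key _ _ _ 0 0 _ _ _ _ _ _ _ _ ?_
  rcases h with h | h | h
  · simp [columnScale_of_mem h]
  · simp [columnScale_of_mem h]
  · rw [h]
    exact ⟨0, by ring⟩

lemma aeval_none_zero_deformation (f : MvPolynomial (V ⊕ V) k) :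
    aeval (fun o : Option (V ⊕ V) => o.elim (0 : MvPolynomial (V ⊕ V) k) X)
      (deformation k T ρ f) = rankOneMap k T ρ f := by
  have : ((aeval (fun o : Option (V ⊕ V) => o.elim (0 : MvPolynomial (V ⊕ V) k) X)).comp
      (deformation k T ρ)) = rankOneMap k T ρ := by
    have hs : ∀ p : MvPolynomial (V ⊕ V) k,
        aeval (fun o : Option (V ⊕ V) => o.elim (0 : MvPolynomial (V ⊕ V) k) X)
          (rename some p) = p := by
      intro p
      rw [aeval_rename]
      exact aeval_X_left_apply p
    ext v : 1
    rcases v with i | i <;>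
      · simp only [AlgHom.comp_apply, deformation, deformationVar, rankOneMap, aeval_X,
          Sum.elim_inl, Sum.elim_inr, map_add, hs]
        rw [map_mul, aeval_X]
        simp
  exact DFunLike.congr_fun this f

lemma rankOneMap_minor_eq_zero {i j : V} (h : i ∈ T ∨ j ∈ T ∨ ρ i = ρ j) :
    rankOneMap k T ρ (minor k i j) = 0 := by
  obtain ⟨q, hq⟩ := deformation_dvd_minor (k := k) h
  rw [← aeval_none_zero_deformation, hq]
  simp

lemma not_dvd_deformation {f : MvPolynomial (V ⊕ V) k} (hf : rankOneMap k T ρ f ≠ 0) :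
    ¬ X none ∣ deformation k T ρ f := by
  rintro ⟨q, hq⟩
  apply hf
  rw [← aeval_none_zero_deformation, hq]
  simp

open Classical in
/-- The contribution of the vertex `i` to `coverWeight`. -/
noncomputable def coverTerm (T : Set V) (ρ : V → V) (m : V ⊕ V →₀ ℕ) (i : V) : ℕ :=
  if i ∈ T then m (Sum.inl i) + m (Sum.inr i) else
    if i < ρ i then m (Sum.inl i) else if ρ i < i then m (Sum.inr i) else 0

/-- The degree of the monomial `m` in the vertex cover consisting of both variables of each
`i ∈ T`, of `x_i` for `i < ρ i` and of `y_i` for `ρ i < i`. -/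
noncomputable def coverWeight [Fintype V] (T : Set V) (ρ : V → V) (m : V ⊕ V →₀ ℕ) : ℕ :=
  ∑ i, coverTerm T ρ m i

open Classical in
/-- The monomial by which the leading monomial of `deformation` at a variable exceeds it. -/
noncomputable def extraExponent (T : Set V) (ρ : V → V) : V ⊕ V → Option (V ⊕ V) →₀ ℕ :=
  Sum.elim
    (fun i => if i ∈ T ∨ i < ρ i then Finsupp.single none 1 else
      if ρ i < i then Finsupp.single (some (Sum.inl (ρ i))) 1 else 0)
    (fun i => if i ∈ T ∨ ρ i < i then Finsupp.single none 1 else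
      if i < ρ i then Finsupp.single (some (Sum.inr (ρ i))) 1 else 0)

/-- The weight on the variables which makes diagonal terms of minors leading. -/
def diagonalWeight (r : V → ℕ) : V ⊕ V → ℤ := Sum.elim 0 fun i => (r i : ℤ)

open Classical in
/-- The weight on the target of `deformation` that is compatible with `diagonalWeight`. -/
noncomputable def targetWeight (T : Set V) (ρ : V → V) (r : V → ℕ) : Option (V ⊕ V) → ℤ :=
  fun o => o.elim 0 (Sum.elim 0
    fun i => if i ∉ T ∧ i < ρ i then (r i : ℤ) - r (ρ i) else r i)

/-- The function `ρ` chooses fixed points outside `T` for the elements outside `T`. -/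
def IsRetraction (T : Set V) (ρ : V → V) : Prop := ∀ i ∉ T, ρ i ∉ T ∧ ρ (ρ i) = ρ i

lemma weight_extraExponent (hρ : IsRetraction T ρ) (r : V → ℕ) (v : V ⊕ V) :
    Finsupp.weight (targetWeight T ρ r) (Finsupp.single (some v) 1 + extraExponent T ρ v)
      = diagonalWeight r v := by
  classical
  rcases v with i | i
  · simp only [map_add, Finsupp.weight_single, extraExponent, Sum.elim_inl, diagonalWeight]
    split_ifs <;> simp [targetWeight, Finsupp.weight_single]
  · simp only [map_add, Finsupp.weight_single, extraExponent, Sum.elim_inr, diagonalWeight]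
    split_ifs with h1 h2
    · have : ¬ (i ∉ T ∧ i < ρ i) := by
        rintro ⟨h3, h4⟩
        exact h1.elim h3 (lt_asymm h4)
      simp [targetWeight, Finsupp.weight_single, this]
    · push Not at h1
      simp [targetWeight, Finsupp.weight_single, h1.1, h2, hρ i h1.1]
    · have : ¬ (i ∉ T ∧ i < ρ i) := fun h => h2 h.2
      simp [targetWeight, this]

lemma hasLeadingMonomial_deformationVar (hρ : IsRetraction T ρ) {r : V → ℕ} (hr : StrictMono r)
    (v : V ⊕ V) : HasLeadingMonomial (targetWeight T ρ r) (deformationVar k T ρ v)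
      (Finsupp.single (some v) 1 + extraExponent T ρ v) := by
  classical
  have hmon : ∀ a b : Option (V ⊕ V),
      (X a * X b : MvPolynomial (Option (V ⊕ V)) k)
        = monomial (Finsupp.single a 1 + Finsupp.single b 1) 1 := by
    intro a b
    rw [X, X, monomial_mul, one_mul]
  have hX : ∀ a : Option (V ⊕ V), monomial (Finsupp.single a 1) (1 : k) = X a := fun _ => rfl
  rw [HasLeadingMonomial, weight_extraExponent hρ]
  rcases v with i | i
  · simp only [deformationVar, extraExponent, columnScale, Sum.elim_inl]
    by_cases hT : i ∈ T
    · simp [hT, hmon, add_comm]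
    rcases lt_trichotomy i (ρ i) with h | h | h
    · simp only [hT, h, if_true, if_false, or_true, map_mul, rename_X, hmon]
      rw [add_comm (Finsupp.single none 1), add_sub_cancel_right]
      refine monomial_mem_lowerTerms ?_ _
      have := hr h
      simp [Finsupp.weight_single, targetWeight, hT, h, diagonalWeight, this]
    · simp [hT, ← h, hX]
    · simp [hT, h, h.not_gt, hmon]
  · simp only [deformationVar, extraExponent, columnScale, Sum.elim_inr]
    by_cases hT : i ∈ T
    · simp [hT, hmon, add_comm]
    rcases lt_trichotomy i (ρ i) with h | h | h
    · simp [hT, h, h.not_gt, hmon]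
    · simp [hT, ← h, hX]
    · simp only [hT, h, h.not_gt, if_true, if_false, or_true, map_mul, rename_X, hmon]
      rw [add_comm (Finsupp.single none 1), add_sub_cancel_right]
      refine monomial_mem_lowerTerms ?_ _
      have := hr h
      simp [Finsupp.weight_single, targetWeight, hρ i hT, diagonalWeight, this]

lemma linearCombination_extraExponent_none [Fintype V] (m : V ⊕ V →₀ ℕ) :
    (Finsupp.linearCombination ℕ (fun v => Finsupp.single (some v) 1 + extraExponent T ρ v) m :
      Option (V ⊕ V) →₀ ℕ) none = coverWeight T ρ m := by
  classical
  rw [Finsupp.linearCombination_apply, Finsupp.sum_apply, Finsupp.sum_fintype _ _ (by simp),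
    Fintype.sum_sum_type, ← Finset.sum_add_distrib, coverWeight]
  refine Finset.sum_congr rfl fun i _ => ?_
  simp only [extraExponent, coverTerm, Sum.elim_inl, Sum.elim_inr]
  by_cases hT : i ∈ T
  · simp [hT]
  rcases lt_trichotomy i (ρ i) with h | h | h
  · simp [hT, h, h.not_gt]
  · simp [hT, ← h]
  · simp [hT, h, h.not_gt]

lemma extraExponent_injective (hρ : IsRetraction T ρ) :
    Function.Injective (Finsupp.linearCombination ℕ
      fun v => Finsupp.single (some v) 1 + extraExponent T ρ v) := by
  classical
  refine linearCombination_injective fun u v huv => ?_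
  have hv : ∃ i, i ∉ T ∧ (v = Sum.inl (ρ i) ∨ v = Sum.inr (ρ i)) := by
    rcases u with i | i <;> refine ⟨i, ?_⟩ <;>
      simp only [extraExponent, Sum.elim_inl, Sum.elim_inr] at huv <;>
      split_ifs at huv with h1 h2 <;>
      simp [Finsupp.single_apply] at huv <;>
      · push Not at h1
        exact ⟨h1.1, by simp [← huv]⟩
  obtain ⟨i, hi, hv⟩ := hv
  rcases hv with rfl | rfl <;> simp [extraExponent, hρ i hi]

/-- Divisibility of the deformation of `f` by powers of the parameter bounds the cover weight of
the top-weight monomials of `f`. -/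
lemma le_coverWeight_of_dvd [Fintype V] (hρ : IsRetraction T ρ) {r : V → ℕ} (hr : StrictMono r)
    {f : MvPolynomial (V ⊕ V) k} {t : ℕ} (hf : X none ^ t ∣ deformation k T ρ f)
    {m : V ⊕ V →₀ ℕ} (hm : m ∈ f.support) (hmax : ∀ a ∈ f.support,
      Finsupp.weight (diagonalWeight r) a ≤ Finsupp.weight (diagonalWeight r) m) :
    t ≤ coverWeight T ρ m := by
  classical
  have h := coeff_aeval_of_leading (hasLeadingMonomial_deformationVar (k := k) hρ hr)
    (weight_extraExponent hρ r) (extraExponent_injective hρ) hmax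
  rw [← linearCombination_extraExponent_none]
  obtain ⟨q, hq⟩ := hf
  rw [deformation] at hq
  rw [hq, X_pow_eq_monomial, coeff_monomial_mul'] at h
  by_contra hlt
  rw [if_neg] at h
  · exact mem_support_iff.mp hm h.symm
  · intro hle
    exact hlt (by simpa using hle none)

end Deformation

section SymbolicPower

lemma exists_mul_mem_of_mem_symbolicPower {S : Type*} [CommRing S] {I p : Ideal S} {t : ℕ} {f : S}
    (hf : f ∈ symbolicPower I t) (hp : p ∈ I.minimalPrimes) : ∃ g ∉ p, g * f ∈ I ^ t := by
  have : p.IsPrime := hp.1.1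
  have h : f ∈ (Ideal.map (algebraMap S (Localization.AtPrime p)) (I ^ t)).comap
      (algebraMap S (Localization.AtPrime p)) := by
    rw [symbolicPower, Ideal.mem_iInf] at hf
    have := hf p
    rw [Ideal.mem_iInf] at this
    exact this hp
  rw [Ideal.mem_comap, IsLocalization.mem_map_algebraMap_iff p.primeCompl] at h
  obtain ⟨⟨a, s⟩, h⟩ := h
  rw [← map_mul, IsLocalization.eq_iff_exists p.primeCompl] at h
  obtain ⟨c, hc⟩ := h
  refine ⟨c * s, (c * s).2, ?_⟩
  have : (c : S) * s * f = c * a := by rw [← hc]; ring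
  rw [this]
  exact Ideal.mul_mem_left _ _ a.2

lemma pow_le_symbolicPower {S : Type*} [CommRing S] (I : Ideal S) (t : ℕ) :
    I ^ t ≤ symbolicPower I t :=
  le_iInf fun _ => le_iInf fun _ => Ideal.le_comap_map

variable {k V : Type} [Field k] [LinearOrder V] {T : Set V} {ρ : V → V}

/-- The kernel of `rankOneMap` is contained in every smaller prime over the equations defining
its image. -/
lemma ker_rankOneMap_le (hρ : IsRetraction T ρ) {q : Ideal (MvPolynomial (V ⊕ V) k)} [q.IsPrime]
    (hT : ∀ a ∈ T, X (Sum.inl a) ∈ q ∧ X (Sum.inr a) ∈ q)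
    (hminor : ∀ i j, i ∉ T → j ∉ T → ρ i = ρ j → minor k i j ∈ q)
    (hq : q ≤ RingHom.ker (rankOneMap k T ρ)) : RingHom.ker (rankOneMap k T ρ) ≤ q := by
  classical
  let F := FractionRing (MvPolynomial (V ⊕ V) k ⧸ q)
  let ι : MvPolynomial (V ⊕ V) k →+* F := (algebraMap _ F).comp (Ideal.Quotient.mk q)
  have hι : ∀ f, ι f = 0 ↔ f ∈ q := by
    intro f
    rw [RingHom.comp_apply, IsFractionRing.to_map_eq_zero_iff, Ideal.Quotient.eq_zero_iff_mem]
  let θ : MvPolynomial (V ⊕ V) k →+* F := eval₂Hom (ι.comp C) (Sum.elim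
    (fun i => if i = ρ i then ι (X (Sum.inl i)) else ι (X (Sum.inl i)) / ι (X (Sum.inl (ρ i))))
    (fun i => if i = ρ i then ι (X (Sum.inr i)) else ι (X (Sum.inr i)) / ι (X (Sum.inr (ρ i)))))
  have hx : ∀ i ∉ T, ι (X (Sum.inl i)) ≠ 0 := fun i hi h =>
    rankOneMap_inl_ne_zero hi (hq ((hι _).mp h))
  have hy : ∀ i ∉ T, ι (X (Sum.inr i)) ≠ 0 := fun i hi h =>
    rankOneMap_inr_ne_zero hi (hq ((hι _).mp h))
  have hdet : ∀ i ∉ T, ι (X (Sum.inl i)) * ι (X (Sum.inr (ρ i)))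
      = ι (X (Sum.inl (ρ i))) * ι (X (Sum.inr i)) := by
    intro i hi
    rw [← sub_eq_zero, ← map_mul, ← map_mul, ← map_sub, hι]
    exact hminor i (ρ i) hi (hρ i hi).1 (hρ i hi).2.symm
  have hθ : θ.comp (rankOneMap k T ρ : MvPolynomial (V ⊕ V) k →+* MvPolynomial (V ⊕ V) k) = ι := by
    refine ringHom_ext (fun c => ?_) fun v => ?_
    · simp [θ]
    · rcases v with i | i
      · rw [RingHom.comp_apply, RingHom.coe_coe, rankOneMap_inl]
        by_cases hi : i ∈ T
        · rw [columnScale_of_mem hi, zero_mul, map_zero, ((hι _).mpr (hT i hi).1)]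
        obtain ⟨hc, hcc⟩ := hρ i hi
        rcases lt_trichotomy i (ρ i) with h | h | h
        · simp only [columnScale, hi, h, if_true, if_false, map_mul, θ, eval₂Hom_X', Sum.elim_inr,
            Sum.elim_inl, hcc, h.ne]
          rw [div_mul_eq_mul_div, div_eq_iff (hy _ hc)]
          linear_combination -hdet i hi
        · simp [columnScale, hi, ← h, θ]
        · simp only [columnScale, hi, h, h.not_gt, if_true, if_false, map_mul, θ, eval₂Hom_X',
            Sum.elim_inl, hcc, h.ne']
          rw [div_mul_cancel₀ _ (hx _ hc)]
      · rw [RingHom.comp_apply, RingHom.coe_coe, rankOneMap_inr]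
        by_cases hi : i ∈ T
        · rw [columnScale_of_mem hi, zero_mul, map_zero, ((hι _).mpr (hT i hi).2)]
        obtain ⟨hc, hcc⟩ := hρ i hi
        rcases lt_trichotomy i (ρ i) with h | h | h
        · simp only [columnScale, hi, h, if_true, if_false, map_mul, θ, eval₂Hom_X', Sum.elim_inr,
            hcc, h.ne]
          rw [div_mul_cancel₀ _ (hy _ hc)]
        · simp [columnScale, hi, ← h, θ]
        · simp only [columnScale, hi, h, h.not_gt, if_true, if_false, map_mul, θ, eval₂Hom_X',
            Sum.elim_inl, Sum.elim_inr, hcc, h.ne']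
          rw [div_mul_eq_mul_div, div_eq_iff (hx _ hc)]
          linear_combination hdet i hi
  intro f hf
  rw [← hι, ← hθ, RingHom.comp_apply, RingHom.coe_coe, (RingHom.mem_ker).mp hf, map_zero]

lemma minor_mem_binomialEdgeIdeal {k V : Type} [Field k] {G : SimpleGraph V} {i j : V}
    (h : G.Adj i j) : minor k i j ∈ binomialEdgeIdeal k G :=
  Ideal.subset_span ⟨i, j, h, rfl⟩

variable {G : SimpleGraph V}

lemma binomialEdgeIdeal_le_ker (h : ∀ i j, G.Adj i j → i ∈ T ∨ j ∈ T ∨ ρ i = ρ j) :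
    binomialEdgeIdeal k G ≤ RingHom.ker (rankOneMap k T ρ) := by
  refine Ideal.span_le.mpr ?_
  rintro _ ⟨i, j, hij, rfl⟩
  exact rankOneMap_minor_eq_zero (h i j hij)

instance ker_rankOneMap_isPrime : (RingHom.ker (rankOneMap k T ρ)).IsPrime :=
  RingHom.ker_isPrime _

lemma pow_dvd_deformation (h : ∀ i j, G.Adj i j → i ∈ T ∨ j ∈ T ∨ ρ i = ρ j)
    (hmin : RingHom.ker (rankOneMap k T ρ) ∈ (binomialEdgeIdeal k G).minimalPrimes) {t : ℕ}
    {f : MvPolynomial (V ⊕ V) k} (hf : f ∈ symbolicPower (binomialEdgeIdeal k G) t) :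
    X none ^ t ∣ deformation k T ρ f := by
  obtain ⟨g, hg, hgf⟩ := exists_mul_mem_of_mem_symbolicPower hf hmin
  have hle : (binomialEdgeIdeal k G).map (deformation k T ρ) ≤ Ideal.span {X none} := by
    rw [binomialEdgeIdeal, Ideal.map_span, Ideal.span_le]
    rintro _ ⟨_, ⟨i, j, hij, rfl⟩, rfl⟩
    exact Ideal.mem_span_singleton.mpr (deformation_dvd_minor (h i j hij))
  have hmem : deformation k T ρ (g * f) ∈ Ideal.span {X none ^ t} := by
    rw [← Ideal.span_singleton_pow]
    refine Ideal.pow_right_mono hle t ?_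
    rw [← Ideal.map_pow]
    exact Ideal.mem_map_of_mem _ hgf
  rw [Ideal.mem_span_singleton, map_mul] at hmem
  exact X_prime.pow_dvd_of_dvd_mul_left t (not_dvd_deformation hg) hmem

end SymbolicPower

section Covers

variable {V : Type}

/-- The function `κ` chooses, for each label `ℓ i` with `i ∉ T`, an element outside `T` with the
same label. -/
def IsLabelSection (T : Set V) (ℓ : V → ℕ) (κ : ℕ → V) : Prop :=
  ∀ i ∉ T, κ (ℓ i) ∉ T ∧ ℓ (κ (ℓ i)) = ℓ i

lemma IsLabelSection.isRetraction {T : Set V} {ℓ : V → ℕ} {κ : ℕ → V}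
    (h : IsLabelSection T ℓ κ) : IsRetraction T (κ ∘ ℓ) := fun i hi =>
  ⟨(h i hi).1, by simp only [Function.comp, (h i hi).2]⟩

open Classical in
/-- The order of vanishing of the minor on the columns `i < j` along the locus where the columns
in `T` vanish and columns with equal labels are proportional. -/
noncomputable def minorOrder (T : Set V) (ℓ : V → ℕ) (i j : V) : ℕ :=
  if j ∈ T then if i ∈ T then 2 else 1 else if ℓ i = ℓ j then 1 else 0

variable [LinearOrder V] [Fintype V]

open Classical in
/-- The degree of the monomial `m` in the variables of the columns in `T`. -/
noncomputable def columnDegree (T : Set V) (m : V ⊕ V →₀ ℕ) : ℕ :=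
  ∑ i, if i ∈ T then m (Sum.inl i) + m (Sum.inr i) else 0

/-- Adding an innermost diagonal pair to a monomial increases the minimal cover weight by at most
the order of vanishing of the corresponding minor. -/
lemma exists_section_add_pair {T : Set V} {ℓ : V → ℕ} (hT : IsUpperSet T) (hℓ : Monotone ℓ)
    {m : V ⊕ V →₀ ℕ} {i j : V} (hij : i < j)
    (hbetween : ∀ v, i < v → v < j → m (Sum.inl v) = 0 ∧ m (Sum.inr v) = 0)
    {κ : ℕ → V} (hκ : IsLabelSection T ℓ κ) :
    ∃ κ', IsLabelSection T ℓ κ' ∧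
      coverWeight T (κ' ∘ ℓ) (m + (Finsupp.single (Sum.inl i) 1 + Finsupp.single (Sum.inr j) 1))
        ≤ coverWeight T (κ ∘ ℓ) m + minorOrder T ℓ i j := by
  classical
  have hjT : i ∈ T → j ∈ T := hT hij.le
  refine ⟨fun l => if l = ℓ i ∧ i ∉ T ∧ i < κ l ∧ κ l < j then i else
    if l = ℓ j ∧ j ∉ T ∧ i < κ l ∧ κ l < j then j else κ l, ?_, ?_⟩
  · intro v hv
    have := hκ v hv
    dsimp only
    split_ifs with h1 h2
    · exact ⟨h1.2.1, h1.1.symm⟩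
    · exact ⟨h2.2.1, h2.1.symm⟩
    · exact this
  let d : V → ℕ := fun v => if j ∈ T then
      (if v = j then 1 else 0) + (if i ∈ T ∧ v = i then 1 else 0)
    else if ℓ i = ℓ j then (if v = (if j ≤ κ (ℓ i) then i else j) then 1 else 0) else 0
  have hd : ∑ v, d v = minorOrder T ℓ i j := by
    simp only [d, minorOrder]
    split_ifs <;> simp_all [Finset.sum_add_distrib]
  rw [← hd, coverWeight, coverWeight, ← Finset.sum_add_distrib]
  refine Finset.sum_le_sum fun v _ => ?_
  have hx : (m + (Finsupp.single (Sum.inl i) 1 + Finsupp.single (Sum.inr j) 1) : V ⊕ V →₀ ℕ)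
      (Sum.inl v)
      = m (Sum.inl v) + if v = i then 1 else 0 := by
    simp [Finsupp.single_apply, eq_comm]
  have hy : (m + (Finsupp.single (Sum.inl i) 1 + Finsupp.single (Sum.inr j) 1) : V ⊕ V →₀ ℕ)
      (Sum.inr v)
      = m (Sum.inr v) + if v = j then 1 else 0 := by
    simp [Finsupp.single_apply, eq_comm]
  simp only [coverTerm, hx, hy, Function.comp, d]
  have hb := hbetween v
  by_cases hv : v ∈ T
  · have hi : v = i → i ∈ T := fun h => h ▸ hv
    have hj : v = j → j ∈ T := fun h => h ▸ hv
    grind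
  have hκv := hκ v hv
  have hTv : ∀ u, u ≤ κ (ℓ v) → u ∉ T := fun u hu h => hκv.1 (hT hu h)
  have h1 : ℓ i ≤ ℓ j := hℓ hij.le
  have h2 : v ≤ i → ℓ v ≤ ℓ i := fun h => hℓ h
  have h3 : j ≤ v → ℓ j ≤ ℓ v := fun h => hℓ h
  have h4 : j ≤ κ (ℓ v) → ℓ j ≤ ℓ v := fun h => (hℓ h).trans hκv.2.le
  have h5 : κ (ℓ v) ≤ i → ℓ v ≤ ℓ i := fun h => hκv.2.ge.trans (hℓ h)
  have hTj := hTv j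
  grind

/-- A monomial without diagonal pairs has a cover of weight its degree in the columns in `T`. -/
lemma exists_section_of_no_pair [Nonempty V] {T : Set V} {ℓ : V → ℕ} {m : V ⊕ V →₀ ℕ}
    (hm : ∀ i j, i < j → m (Sum.inl i) = 0 ∨ m (Sum.inr j) = 0) :
    ∃ κ, IsLabelSection T ℓ κ ∧ coverWeight T (κ ∘ ℓ) m ≤ columnDegree T m := by
  classical
  have hex : ∀ l, ∃ c, (∃ v ∉ T, ℓ v = l) → c ∉ T ∧ ℓ c = l ∧ ∀ v ∉ T, ℓ v = l →
      (v < c → m (Sum.inl v) = 0) ∧ (c < v → m (Sum.inr v) = 0) := by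
    intro l
    by_cases hl : ∃ v ∉ T, ℓ v = l
    swap
    · exact ⟨Classical.arbitrary V, fun h => absurd h hl⟩
    by_cases hx : ∃ v, v ∉ T ∧ ℓ v = l ∧ m (Sum.inl v) ≠ 0
    · obtain ⟨c, ⟨hc1, hc2, hc3⟩, hmin⟩ := exists_minimal_of_wellFoundedLT _ hx
      refine ⟨c, fun _ => ⟨hc1, hc2, fun v hv hvl => ⟨fun hlt => ?_, fun hlt => ?_⟩⟩⟩
      · by_contra hne
        exact absurd (hmin ⟨hv, hvl, hne⟩ hlt.le) (not_le.mpr hlt)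
      · exact (hm c v hlt).resolve_left hc3
    · obtain ⟨w, hw1, hw2⟩ := hl
      obtain ⟨c, ⟨hc1, hc2⟩, hmax⟩ :=
        exists_maximal_of_wellFoundedGT (fun v => v ∉ T ∧ ℓ v = l) ⟨w, hw1, hw2⟩
      refine ⟨c, fun _ => ⟨hc1, hc2, fun v hv hvl => ⟨fun _ => ?_, fun hlt => ?_⟩⟩⟩
      · by_contra hne
        exact hx ⟨v, hv, hvl, hne⟩
      · exact absurd (hmax ⟨hv, hvl⟩ hlt.le) (not_le.mpr hlt)
  choose κ hκ using hex
  refine ⟨κ, fun i hi => ⟨(hκ _ ⟨i, hi, rfl⟩).1, (hκ _ ⟨i, hi, rfl⟩).2.1⟩, ?_⟩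
  refine Finset.sum_le_sum fun v _ => ?_
  simp only [coverTerm, Function.comp]
  by_cases hv : v ∈ T
  · simp [hv]
  have := (hκ _ ⟨v, hv, rfl⟩).2.2 v hv rfl
  simp only [hv, if_false]
  split_ifs with h1 h2
  · exact (this.1 h1).le
  · exact (this.2 h2).le
  · exact le_rfl

end Covers

section OrdinaryPower

/-- Products of powers of ideals `K ≤ J`, `J`, `I`, `M` with `K * I ≤ J ^ 2` and `M * I ≤ J` lie in
the expected power of `J`. -/
lemma mul_pow_le_pow {S : Type*} [CommRing S] {K J I M : Ideal S} (hK : K ≤ J)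
    (hKI : K * I ≤ J ^ 2) (hMI : M * I ≤ J) {t : ℕ} (b : ℕ) : ∀ a e d : ℕ,
      t ≤ a + e + b → t ≤ 2 * a + e + d → K ^ a * J ^ e * I ^ b * M ^ d ≤ J ^ t := by
  induction b with
  | zero =>
    intro a e d h _
    calc K ^ a * J ^ e * I ^ 0 * M ^ d ≤ K ^ a * J ^ e := by
          rw [pow_zero, mul_one]
          exact Ideal.mul_le_left
      _ ≤ J ^ a * J ^ e := Ideal.mul_mono_left (Ideal.pow_right_mono hK a)
      _ = J ^ (a + e) := (pow_add _ _ _).symm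
      _ ≤ J ^ t := Ideal.pow_le_pow_right h
  | succ b ih =>
    intro a e d h1 h2
    rcases a with _ | a
    · rcases d with _ | d
      · calc K ^ 0 * J ^ e * I ^ (b + 1) * M ^ 0 ≤ J ^ e := by
              rw [pow_zero, pow_zero, mul_one, one_mul]
              exact Ideal.mul_le_left
          _ ≤ J ^ t := Ideal.pow_le_pow_right (by omega)
      · calc K ^ 0 * J ^ e * I ^ (b + 1) * M ^ (d + 1)
            = M * I * (K ^ 0 * J ^ e * I ^ b * M ^ d) := by ring
          _ ≤ J * (K ^ 0 * J ^ e * I ^ b * M ^ d) := Ideal.mul_mono_left hMI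
          _ = K ^ 0 * J ^ (e + 1) * I ^ b * M ^ d := by ring
          _ ≤ J ^ t := ih 0 (e + 1) d (by omega) (by omega)
    · calc K ^ (a + 1) * J ^ e * I ^ (b + 1) * M ^ d
          = K * I * (K ^ a * J ^ e * I ^ b * M ^ d) := by ring
        _ ≤ J ^ 2 * (K ^ a * J ^ e * I ^ b * M ^ d) := Ideal.mul_mono_left hKI
        _ = K ^ a * J ^ (e + 2) * I ^ b * M ^ d := by ring
        _ ≤ J ^ t := ih a (e + 2) d (by omega) (by omega)

variable {k V : Type} [Field k]

/-- The ideal generated by the variables of the columns in `T`. -/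
noncomputable def columnIdeal (k : Type) [Field k] {V : Type} (T : Set V) :
    Ideal (MvPolynomial (V ⊕ V) k) :=
  Ideal.span {f | ∃ a ∈ T, f = X (Sum.inl a) ∨ f = X (Sum.inr a)}

/-- The ideal generated by the `2`-minors of the columns in `T`. -/
noncomputable def minorIdeal (k : Type) [Field k] {V : Type} (T : Set V) :
    Ideal (MvPolynomial (V ⊕ V) k) :=
  Ideal.span {f | ∃ i ∈ T, ∃ j ∈ T, f = minor k i j}

lemma minor_mem_minorIdeal {T : Set V} {i j : V} (hi : i ∈ T) (hj : j ∈ T) :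
    minor k i j ∈ minorIdeal k T :=
  Ideal.subset_span ⟨i, hi, j, hj, rfl⟩

lemma columnIdeal_mul_minorIdeal_le {T : Set V} {J : Ideal (MvPolynomial (V ⊕ V) k)}
    (hJ : ∀ i j, i ∈ T → minor k i j ∈ J) : columnIdeal k T * minorIdeal k Set.univ ≤ J := by
  rw [columnIdeal, minorIdeal, Ideal.span_mul_span', Ideal.span_le]
  rintro _ ⟨_, ⟨a, ha, hf⟩, _, ⟨i, -, j, -, rfl⟩, rfl⟩
  rcases hf with rfl | rfl
  · have : X (Sum.inl a) * minor k i j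
        = X (Sum.inl i) * minor k a j - X (Sum.inl j) * minor k a i := by
      simp only [minor]
      ring
    simp only [SetLike.mem_coe, this]
    exact J.sub_mem (J.mul_mem_left _ (hJ a j ha)) (J.mul_mem_left _ (hJ a i ha))
  · have : X (Sum.inr a) * minor k i j
        = X (Sum.inr i) * minor k a j - X (Sum.inr j) * minor k a i := by
      simp only [minor]
      ring
    simp only [SetLike.mem_coe, this]
    exact J.sub_mem (J.mul_mem_left _ (hJ a j ha)) (J.mul_mem_left _ (hJ a i ha))

lemma minorIdeal_mul_minorIdeal_le {T : Set V} {J : Ideal (MvPolynomial (V ⊕ V) k)}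
    (hJ : ∀ i j, i ∈ T → minor k i j ∈ J) :
    minorIdeal k T * minorIdeal k Set.univ ≤ J ^ 2 := by
  rw [minorIdeal, minorIdeal, Ideal.span_mul_span', Ideal.span_le]
  rintro _ ⟨_, ⟨a, ha, b, hb, rfl⟩, _, ⟨i, -, j, -, rfl⟩, rfl⟩
  have : minor k a b * minor k i j
      = minor k a i * minor k b j - minor k a j * minor k b i := by
    simp only [minor]
    ring
  simp only [SetLike.mem_coe, this, pow_two]
  exact (J * J).sub_mem (Ideal.mul_mem_mul (hJ a i ha) (hJ b j hb))
    (Ideal.mul_mem_mul (hJ a j ha) (hJ b i hb))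

lemma monomial_mem_columnIdeal_pow [Fintype V] (T : Set V) (m : V ⊕ V →₀ ℕ) :
    monomial m (1 : k) ∈ columnIdeal k T ^ columnDegree T m := by
  classical
  have hprod : monomial m (1 : k)
      = ∏ i, (X (Sum.inl i) ^ m (Sum.inl i) * X (Sum.inr i) ^ m (Sum.inr i)) := by
    rw [monomial_eq, C_1, one_mul, Finsupp.prod_fintype _ _ (by simp), Fintype.prod_sum_type,
      ← Finset.prod_mul_distrib]
  rw [hprod, columnDegree, ← Finset.prod_pow_eq_pow_sum]
  refine Ideal.prod_mem_prod fun i _ => ?_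
  split_ifs with hi
  · have hx : X (Sum.inl i) ∈ columnIdeal k T := Ideal.subset_span ⟨i, hi, Or.inl rfl⟩
    have hy : X (Sum.inr i) ∈ columnIdeal k T := Ideal.subset_span ⟨i, hi, Or.inr rfl⟩
    rw [pow_add]
    exact Ideal.mul_mem_mul (Ideal.pow_mem_pow hx _) (Ideal.pow_mem_pow hy _)
  · simp

lemma weight_diagonalWeight_nonneg (r : V → ℕ) (m : V ⊕ V →₀ ℕ) :
    0 ≤ Finsupp.weight (diagonalWeight r) m := by
  rw [Finsupp.weight_apply]
  refine Finset.sum_nonneg fun v _ => nsmul_nonneg ?_ _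
  rcases v with v | v <;> simp [diagonalWeight]

variable [LinearOrder V]

lemma hasLeadingMonomial_minor {r : V → ℕ} (hr : StrictMono r) {i j : V} (h : i < j) :
    HasLeadingMonomial (diagonalWeight r) (minor k i j)
      (Finsupp.single (Sum.inl i) 1 + Finsupp.single (Sum.inr j) 1) := by
  have h1 : minor k i j - monomial (Finsupp.single (Sum.inl i) 1 + Finsupp.single (Sum.inr j) 1) 1
      = -monomial (Finsupp.single (Sum.inl j) 1 + Finsupp.single (Sum.inr i) 1) 1 := by
    rw [minor, X, X, X, X, monomial_mul, monomial_mul, one_mul]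
    ring
  rw [HasLeadingMonomial, h1]
  refine Submodule.neg_mem _ (monomial_mem_lowerTerms ?_ _)
  simpa [Finsupp.weight_single, diagonalWeight] using hr h

variable [Fintype V] [Nonempty V]

/-- Every monomial is the leading monomial of a product of minors and variables which is controlled
by the cover weights of the monomial. -/
lemma exists_product_hasLeadingMonomial {T : Set V} {ℓ : V → ℕ} (hT : IsUpperSet T)
    (hℓ : Monotone ℓ) {J : Ideal (MvPolynomial (V ⊕ V) k)}
    (hJ : ∀ i j, i ∈ T ∨ j ∈ T ∨ ℓ i = ℓ j → minor k i j ∈ J) {r : V → ℕ} (hr : StrictMono r)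
    (m : V ⊕ V →₀ ℕ) : ∃ (a e b d : ℕ) (g : MvPolynomial (V ⊕ V) k) (κ₀ κ : ℕ → V),
      g ∈ minorIdeal k T ^ a * J ^ e * minorIdeal k Set.univ ^ b * columnIdeal k T ^ d ∧
      HasLeadingMonomial (diagonalWeight r) g m ∧
      coverWeight ∅ (κ₀ ∘ fun _ => 0) m ≤ a + e + b ∧
      IsLabelSection T ℓ κ ∧ coverWeight T (κ ∘ ℓ) m ≤ 2 * a + e + d := by
  classical
  induction hdeg : m.degree using Nat.strong_induction_on generalizing m with
  | _ N ih =>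
  by_cases hpair : ∃ i j, i < j ∧ m (Sum.inl i) ≠ 0 ∧ m (Sum.inr j) ≠ 0
  swap
  · push Not at hpair
    have hno : ∀ i j, i < j → m (Sum.inl i) = 0 ∨ m (Sum.inr j) = 0 := fun i j hij => by
      by_contra! h
      exact h.2 (hpair i j hij h.1)
    obtain ⟨κ, hκ, hκw⟩ := exists_section_of_no_pair (T := T) (ℓ := ℓ) hno
    obtain ⟨κ₀, -, hκ₀w⟩ := exists_section_of_no_pair (T := ∅) (ℓ := fun _ => 0) hno
    refine ⟨0, 0, 0, columnDegree T m, monomial m 1, κ₀, κ, ?_,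
      hasLeadingMonomial_monomial _ _, ?_, hκ, by simpa using hκw⟩
    · simpa using monomial_mem_columnIdeal_pow T m
    · simpa [columnDegree] using hκ₀w
  obtain ⟨⟨i, j⟩, ⟨hij, hi, hj⟩, hmin⟩ : ∃ p : V × V,
      (p.1 < p.2 ∧ m (Sum.inl p.1) ≠ 0 ∧ m (Sum.inr p.2) ≠ 0) ∧
      ∀ q : V × V, (q.1 < q.2 ∧ m (Sum.inl q.1) ≠ 0 ∧ m (Sum.inr q.2) ≠ 0) →
        r p.2 - r p.1 ≤ r q.2 - r q.1 := by
    obtain ⟨i, j, h⟩ := hpair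
    obtain ⟨p, hp, hmin⟩ := exists_minimalFor_of_wellFoundedLT
      (fun p : V × V => p.1 < p.2 ∧ m (Sum.inl p.1) ≠ 0 ∧ m (Sum.inr p.2) ≠ 0)
      (fun p => r p.2 - r p.1) ⟨(i, j), h⟩
    refine ⟨p, hp, fun q hq => ?_⟩
    rcases le_total (r p.2 - r p.1) (r q.2 - r q.1) with h | h
    · exact h
    · exact hmin hq h
  dsimp only at hij hi hj hmin
  have hbetween : ∀ v, i < v → v < j → m (Sum.inl v) = 0 ∧ m (Sum.inr v) = 0 := by
    intro v h1 h2
    have hr1 := hr h1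
    have hr2 := hr h2
    constructor
    · by_contra hv
      have := hmin (v, j) ⟨h2, hv, hj⟩
      dsimp only at this
      omega
    · by_contra hv
      have := hmin (i, v) ⟨h1, hi, hv⟩
      dsimp only at this
      omega
  obtain ⟨m', rfl⟩ : ∃ m',
      m = m' + (Finsupp.single (Sum.inl i) 1 + Finsupp.single (Sum.inr j) 1) := by
    refine ⟨m - (Finsupp.single (Sum.inl i) 1 + Finsupp.single (Sum.inr j) 1), ?_⟩
    rw [tsub_add_cancel_of_le]
    intro v
    rcases v with v | v
    · by_cases hv : v = i
      · subst hv
        simpa using Nat.one_le_iff_ne_zero.mpr hi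
      · simp [Ne.symm hv]
    · by_cases hv : v = j
      · subst hv
        simpa using Nat.one_le_iff_ne_zero.mpr hj
      · simp [Ne.symm hv]
  have hbetween' : ∀ v, i < v → v < j → m' (Sum.inl v) = 0 ∧ m' (Sum.inr v) = 0 := by
    intro v h1 h2
    have := hbetween v h1 h2
    simp only [Finsupp.add_apply] at this
    omega
  have hlt : m'.degree < N := by
    rw [← hdeg, map_add, map_add]
    simp
  obtain ⟨a, e, b, d, g, κ₀, κ, hg, hlead, hκ₀, hκ, hκw⟩ := ih _ hlt m' rfl
  obtain ⟨κ₀', -, hκ₀w'⟩ := exists_section_add_pair (T := ∅) (ℓ := fun _ => 0) isUpperSet_empty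
    monotone_const hij hbetween' (κ := κ₀) (by simp [IsLabelSection])
  obtain ⟨κ', hκ', hκw'⟩ := exists_section_add_pair hT hℓ hij hbetween' hκ
  have hcov : coverWeight ∅ (κ₀' ∘ fun _ => 0)
      (m' + (Finsupp.single (Sum.inl i) 1 + Finsupp.single (Sum.inr j) 1)) ≤ a + e + b + 1 := by
    refine hκ₀w'.trans ?_
    simpa [minorOrder] using hκ₀
  have hlead' := hlead.mul (hasLeadingMonomial_minor (k := k) hr hij)
  by_cases hjT : j ∈ T
  · by_cases hiT : i ∈ T
    · refine ⟨a + 1, e, b, d, g * minor k i j, κ₀', κ', ?_, hlead', by omega, hκ', ?_⟩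
      · have := Ideal.mul_mem_mul hg (minor_mem_minorIdeal (k := k) hiT hjT)
        convert this using 1
        ring
      · simp only [minorOrder, hjT, hiT, if_true] at hκw'
        omega
    · refine ⟨a, e + 1, b, d, g * minor k i j, κ₀', κ', ?_, hlead', by omega, hκ', ?_⟩
      · have := Ideal.mul_mem_mul hg (hJ i j (Or.inr (Or.inl hjT)))
        convert this using 1
        ring
      · simp only [minorOrder, hjT, hiT, if_true, if_false] at hκw'
        omega
  · by_cases hlab : ℓ i = ℓ j
    · refine ⟨a, e + 1, b, d, g * minor k i j, κ₀', κ', ?_, hlead', by omega, hκ', ?_⟩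
      · have := Ideal.mul_mem_mul hg (hJ i j (Or.inr (Or.inr hlab)))
        convert this using 1
        ring
      · simp only [minorOrder, hjT, hlab, if_true, if_false] at hκw'
        omega
    · refine ⟨a, e, b + 1, d, g * minor k i j, κ₀', κ', ?_, hlead', by omega, hκ', ?_⟩
      · have := Ideal.mul_mem_mul hg (minor_mem_minorIdeal (k := k) (Set.mem_univ i)
          (Set.mem_univ j))
        convert this using 1
        ring
      · simp only [minorOrder, hjT, hlab, if_false] at hκw'
        omega

/-- A top-weight monomial of a polynomial vanishing to order `t` along the deformations attached to
the two families of covers is the leading monomial of an element of `J ^ t`. -/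
lemma exists_mem_pow_hasLeadingMonomial {T : Set V} {ℓ : V → ℕ} (hT : IsUpperSet T)
    (hℓ : Monotone ℓ) {J : Ideal (MvPolynomial (V ⊕ V) k)} {t : ℕ}
    (hJ : ∀ i j, i ∈ T ∨ j ∈ T ∨ ℓ i = ℓ j → minor k i j ∈ J) {r : V → ℕ} (hr : StrictMono r)
    {f : MvPolynomial (V ⊕ V) k} (h₀ : ∀ c : V, X none ^ t ∣ deformation k ∅ (fun _ => c) f)
    (h₁ : ∀ κ, IsLabelSection T ℓ κ → X none ^ t ∣ deformation k T (κ ∘ ℓ) f)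
    {m : V ⊕ V →₀ ℕ} (hm : m ∈ f.support) (hmax : ∀ a ∈ f.support,
      Finsupp.weight (diagonalWeight r) a ≤ Finsupp.weight (diagonalWeight r) m) :
    ∃ g ∈ J ^ t, HasLeadingMonomial (diagonalWeight r) g m := by
  have hJT : ∀ i j, i ∈ T → minor k i j ∈ J := fun i j hi => hJ i j (Or.inl hi)
  have hK : minorIdeal k T ≤ J := by
    refine Ideal.span_le.mpr ?_
    rintro _ ⟨i, hi, j, -, rfl⟩
    exact hJT i j hi
  obtain ⟨a, e, b, d, g, κ₀, κ, hg, hlead, hκ₀, hκ, hκw⟩ :=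
    exists_product_hasLeadingMonomial hT hℓ hJ hr m
  refine ⟨g, mul_pow_le_pow hK (minorIdeal_mul_minorIdeal_le hJT)
    (columnIdeal_mul_minorIdeal_le hJT) b a e d ?_ ?_ hg, hlead⟩
  · have hρ : IsRetraction ∅ fun _ : V => κ₀ 0 := fun _ _ => ⟨Set.notMem_empty _, rfl⟩
    exact le_trans (le_coverWeight_of_dvd hρ hr (h₀ (κ₀ 0)) hm hmax) hκ₀
  · exact le_trans (le_coverWeight_of_dvd hκ.isRetraction hr (h₁ κ hκ) hm hmax) hκw

/-- Membership in `J ^ t` is detected by the order of vanishing along all deformations attached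
to the two families of covers. -/
lemma mem_pow_of_deformation_dvd {T : Set V} {ℓ : V → ℕ} (hT : IsUpperSet T) (hℓ : Monotone ℓ)
    {J J' : Ideal (MvPolynomial (V ⊕ V) k)} {t : ℕ} (hJJ' : J ^ t ≤ J')
    (hJ : ∀ i j, i ∈ T ∨ j ∈ T ∨ ℓ i = ℓ j → minor k i j ∈ J) {r : V → ℕ} (hr : StrictMono r)
    (h₀ : ∀ c : V, ∀ f ∈ J', X none ^ t ∣ deformation k ∅ (fun _ => c) f)
    (h₁ : ∀ κ, IsLabelSection T ℓ κ → ∀ f ∈ J', X none ^ t ∣ deformation k T (κ ∘ ℓ) f) :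
    J' ≤ J ^ t := by
  have key : ∀ N : ℕ, ∀ f ∈ J', f ∈ lowerTerms k (diagonalWeight r) N → f ∈ J ^ t := by
    intro N
    induction N with
    | zero =>
      intro f _ hf
      have : f = 0 := by
        by_contra hne
        obtain ⟨m, hm⟩ := Finset.nonempty_of_ne_empty (mt support_eq_empty.mp hne)
        exact absurd (mem_lowerTerms.mp hf m hm) (weight_diagonalWeight_nonneg r m).not_gt
      rw [this]
      exact zero_mem _
    | succ N ih =>
      intro f hfJ hf
      have hlow : ∀ m ∈ f.support, Finsupp.weight (diagonalWeight r) m ≤ N := fun m hm =>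
        Int.lt_add_one_iff.mp (mem_lowerTerms.mp hf m hm)
      have hex : ∀ m ∈ f.support, Finsupp.weight (diagonalWeight r) m = N →
          ∃ g ∈ J ^ t, HasLeadingMonomial (diagonalWeight r) g m := fun m hm hmN =>
        exists_mem_pow_hasLeadingMonomial hT hℓ hJ hr (fun c => h₀ c f hfJ)
          (fun κ hκ => h₁ κ hκ f hfJ) hm (fun a ha => (hlow a ha).trans_eq hmN.symm)
      choose! g hgJ hglead using hex
      have hsum : ∑ m ∈ f.support with Finsupp.weight (diagonalWeight r) m = N,
          C (coeff m f) * g m ∈ J ^ t := by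
        refine Ideal.sum_mem _ fun m hm => Ideal.mul_mem_left _ _ ?_
        exact hgJ m (Finset.mem_filter.mp hm).1 (Finset.mem_filter.mp hm).2
      have := Ideal.add_mem _ (ih _ (J'.sub_mem hfJ (hJJ' hsum))
        (sub_sum_mem_lowerTerms hlow hglead)) hsum
      rwa [sub_add_cancel] at this
  intro f hf
  obtain ⟨N, hN⟩ : ∃ N : ℕ, ∀ m ∈ f.support, Finsupp.weight (diagonalWeight r) m < N := by
    refine ⟨∑ m ∈ f.support, ((Finsupp.weight (diagonalWeight r) m).toNat + 1), fun m hm => ?_⟩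
    have := Finset.single_le_sum (f := fun m => (Finsupp.weight (diagonalWeight r) m).toNat + 1)
      (fun _ _ => Nat.zero_le _) hm
    omega
  exact key N f hf (mem_lowerTerms.mpr hN)

end OrdinaryPower

section MinimalPrimes

lemma minor_self {k V : Type} [Field k] (i : V) : minor k i i = 0 := by
  simp [minor]

variable {k V : Type} [Field k] [LinearOrder V] {G : SimpleGraph V} {T : Set V} {ρ : V → V}

lemma ker_rankOneMap_mem_minimalPrimes (hρ : IsRetraction T ρ)
    (h : ∀ i j, G.Adj i j → i ∈ T ∨ j ∈ T ∨ ρ i = ρ j)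
    (hq : ∀ q : Ideal (MvPolynomial (V ⊕ V) k), q.IsPrime → binomialEdgeIdeal k G ≤ q →
      q ≤ RingHom.ker (rankOneMap k T ρ) → (∀ a ∈ T, X (Sum.inl a) ∈ q ∧ X (Sum.inr a) ∈ q) ∧
        ∀ i j, i ∉ T → j ∉ T → ρ i = ρ j → minor k i j ∈ q) :
    RingHom.ker (rankOneMap k T ρ) ∈ (binomialEdgeIdeal k G).minimalPrimes := by
  refine ⟨⟨inferInstance, binomialEdgeIdeal_le_ker h⟩, fun q hJq hle => ?_⟩
  have : q.IsPrime := hJq.1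
  obtain ⟨h1, h2⟩ := hq q hJq.1 hJq.2 hle
  exact ker_rankOneMap_le hρ h1 h2 hle

/-- The symbolic powers of the binomial edge ideal of a complete graph, or of a disjoint union of
complete graphs joined with a complete graph, are contained in the ordinary powers. -/
lemma symbolicPower_le_pow_of_monotone [Fintype V] [Nonempty V] {ℓ : V → ℕ} (hT : IsUpperSet T)
    (hℓ : Monotone ℓ) {r : V → ℕ} (hr : StrictMono r)
    (hG : ∀ i j, i ≠ j → (G.Adj i j ↔ i ∈ T ∨ j ∈ T ∨ ℓ i = ℓ j))
    (hcut : (T.Nonempty ∧ ∃ u ∉ T, ∃ v ∉ T, ℓ u ≠ ℓ v) ∨ (T = ∅ ∧ ∀ i j, ℓ i = ℓ j)) (t : ℕ) :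
    symbolicPower (binomialEdgeIdeal k G) t ≤ binomialEdgeIdeal k G ^ t := by
  have hJ : ∀ i j, i ∈ T ∨ j ∈ T ∨ ℓ i = ℓ j → minor k i j ∈ binomialEdgeIdeal k G := by
    intro i j h
    by_cases hij : i = j
    · rw [hij, minor_self]
      exact zero_mem _
    · exact minor_mem_binomialEdgeIdeal ((hG i j hij).mpr h)
  have hprod := columnIdeal_mul_minorIdeal_le (fun i j hi => hJ i j (Or.inl hi))
  refine mem_pow_of_deformation_dvd hT hℓ (pow_le_symbolicPower _ _) hJ hr
    (fun c f hf => ?_) fun κ hκ f hf => ?_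
  · have hρ : IsRetraction ∅ fun _ : V => c := fun _ _ => ⟨Set.notMem_empty _, rfl⟩
    have hadj : ∀ i j, G.Adj i j → i ∈ (∅ : Set V) ∨ j ∈ (∅ : Set V) ∨ c = c :=
      fun _ _ _ => Or.inr (Or.inr rfl)
    refine pow_dvd_deformation hadj (ker_rankOneMap_mem_minimalPrimes hρ hadj
      fun q hq hJq hle => ⟨fun _ h => h.elim, fun i j _ _ _ => ?_⟩) hf
    rcases hcut with ⟨⟨a, ha⟩, -⟩ | ⟨-, hlab⟩
    · have hmem : X (Sum.inl a) * minor k i j ∈ q :=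
        hJq (hprod (Ideal.mul_mem_mul (Ideal.subset_span ⟨a, ha, Or.inl rfl⟩)
          (minor_mem_minorIdeal (Set.mem_univ i) (Set.mem_univ j))))
      exact (hq.mem_or_mem hmem).resolve_left fun h =>
        rankOneMap_inl_ne_zero (Set.notMem_empty a) (hle h)
    · exact hJq (hJ i j (Or.inr (Or.inr (hlab i j))))
  · have hadj : ∀ i j, G.Adj i j → i ∈ T ∨ j ∈ T ∨ (κ ∘ ℓ) i = (κ ∘ ℓ) j := by
      intro i j h
      rcases (hG i j h.ne).mp h with h | h | h
      · exact Or.inl h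
      · exact Or.inr (Or.inl h)
      · exact Or.inr (Or.inr (congrArg κ h))
    have hlabel : ∀ i j, i ∉ T → j ∉ T → (κ ∘ ℓ) i = (κ ∘ ℓ) j → ℓ i = ℓ j := by
      intro i j hi hj h
      rw [← (hκ i hi).2, ← (hκ j hj).2]
      exact congrArg ℓ h
    refine pow_dvd_deformation hadj (ker_rankOneMap_mem_minimalPrimes hκ.isRetraction hadj
      fun q hq hJq hle => ⟨fun a ha => ?_, fun i j hi hj h => ?_⟩) hf
    · rcases hcut with ⟨-, u, hu, v, hv, huv⟩ | ⟨hemp, -⟩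
      · have hnot : minor k u v ∉ q := fun h =>
          rankOneMap_minor_ne_zero hu hv (fun h' => huv (hlabel u v hu hv h')) (hle h)
        have hmem : ∀ f ∈ columnIdeal k T, f ∈ q := fun f hf =>
          (hq.mem_or_mem (hJq (hprod (Ideal.mul_mem_mul hf
            (minor_mem_minorIdeal (Set.mem_univ u) (Set.mem_univ v)))))).resolve_right hnot
        exact ⟨hmem _ (Ideal.subset_span ⟨a, ha, Or.inl rfl⟩),
          hmem _ (Ideal.subset_span ⟨a, ha, Or.inr rfl⟩)⟩
      · simp [hemp] at ha
    · exact hJq (hJ i j (Or.inr (Or.inr (hlabel i j hi hj h))))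

end MinimalPrimes

lemma symbolicPower_le_pow_of_labels {k V : Type} [Field k] [Finite V] [Nonempty V]
    {G : SimpleGraph V} {T : Set V} {ℓ : V → ℕ}
    (hG : ∀ i j, i ≠ j → (G.Adj i j ↔ i ∈ T ∨ j ∈ T ∨ ℓ i = ℓ j))
    (hcut : (T.Nonempty ∧ ∃ u ∉ T, ∃ v ∉ T, ℓ u ≠ ℓ v) ∨ (T = ∅ ∧ ∀ i j, ℓ i = ℓ j)) (t : ℕ) :
    symbolicPower (binomialEdgeIdeal k G) t ≤ binomialEdgeIdeal k G ^ t := by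
  classical
  have := Fintype.ofFinite V
  obtain ⟨n, ⟨e⟩⟩ := Finite.exists_equiv_fin V
  obtain ⟨M, hM⟩ : ∃ M, ∀ i, ℓ i < M := by
    obtain ⟨M, hM⟩ := (Set.finite_range ℓ).bddAbove
    exact ⟨M + 1, fun i => Nat.lt_succ_of_le (hM ⟨i, rfl⟩)⟩
  let L : V → ℕ := fun i => if i ∈ T then M else ℓ i
  have hLT : ∀ i ∉ T, L i = ℓ i := fun i hi => if_neg hi
  let r : V → ℕ := fun i => L i * n + e i
  have hdiv : ∀ i, r i / n = L i := fun i => by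
    have hn : 0 < n := (Nat.zero_le _).trans_lt (e i).2
    simp only [r]
    rw [mul_comm, Nat.mul_add_div hn, Nat.div_eq_of_lt (e i).2, add_zero]
  have hr : Function.Injective r := by
    intro i j h
    have hL : L i = L j := by rw [← hdiv, ← hdiv, h]
    simp only [r, hL, Nat.add_left_cancel_iff] at h
    exact e.injective (Fin.ext h)
  let _ : LinearOrder V := LinearOrder.lift' r hr
  have hL : Monotone L := by
    intro i j h
    rw [← hdiv, ← hdiv]
    exact Nat.div_le_div_right h
  refine symbolicPower_le_pow_of_monotone (T := T) (ℓ := L) ?_ hL (r := r) (fun i j h => h) ?_ ?_ t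
  · intro i j hij hi
    by_contra hj
    have := hL hij
    rw [hLT j hj] at this
    simp only [L, hi, if_true] at this
    exact absurd (hM j) this.not_gt
  · intro i j hij
    rw [hG i j hij]
    by_cases hi : i ∈ T
    · simp [hi]
    by_cases hj : j ∈ T
    · simp [hj]
    simp [hi, hj, hLT]
  · refine hcut.imp (fun ⟨h, u, hu, v, hv, huv⟩ => ⟨h, u, hu, v, hv, ?_⟩) fun ⟨h, h'⟩ => ⟨h, ?_⟩
    · rwa [hLT u hu, hLT v hv]
    · intro i j
      rw [hLT i (by simp [h]), hLT j (by simp [h]), h' i j]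

section Separators

variable {k V : Type} [Field k]

/-- The graph obtained by deleting all edges that meet `S`. -/
def isolate (G : SimpleGraph V) (S : Set V) : SimpleGraph V where
  Adj a b := G.Adj a b ∧ a ∉ S ∧ b ∉ S
  symm := ⟨fun _ _ h => ⟨h.1.symm, h.2.2, h.2.1⟩⟩
  loopless := ⟨fun _ h => h.1.ne rfl⟩

/-- The set `S` separates the vertices `u` and `v` of `G`. -/
def Separates (G : SimpleGraph V) (u v : V) (S : Set V) : Prop :=
  u ∉ S ∧ v ∉ S ∧ ¬ (isolate G S).Reachable u v

variable {G : SimpleGraph V}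

lemma exists_minimal_separates [Finite V] {u v : V} (huv : u ≠ v) (h : ¬ G.Adj u v) :
    ∃ S, Minimal (Separates G u v) S := by
  refine exists_minimal_of_wellFoundedLT _ ⟨{u, v}ᶜ, by simp, by simp, fun ⟨p⟩ => ?_⟩
  cases p with
  | nil => exact huv rfl
  | cons hadj _ =>
    have hw := hadj.2.2
    simp only [Set.mem_compl_iff, Set.mem_insert_iff, Set.mem_singleton_iff, not_not] at hw
    rcases hw with rfl | rfl
    · exact hadj.1.ne rfl
    · exact h hadj.1

lemma Separates.nonempty (hconn : G.Connected) {u v : V} {S : Set V} (h : Separates G u v S) :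
    S.Nonempty := by
  by_contra hS
  rw [Set.not_nonempty_iff_eq_empty] at hS
  refine h.2.2 ((hconn.preconnected u v).mono fun a b hab => ?_)
  simp [isolate, hS, hab]

/-- The columns all of whose variables lie in the ideal `q`. -/
def zeroColumns (q : Ideal (MvPolynomial (V ⊕ V) k)) : Set V :=
  {i | X (Sum.inl i) ∈ q ∧ X (Sum.inr i) ∈ q}

lemma minor_mem_trans {q : Ideal (MvPolynomial (V ⊕ V) k)} (hq : q.IsPrime) {i j l : V}
    (hj : j ∉ zeroColumns q) (h1 : minor k i j ∈ q) (h2 : minor k j l ∈ q) :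
    minor k i l ∈ q := by
  have hx : X (Sum.inl j) * minor k i l ∈ q := by
    have : X (Sum.inl j) * minor k i l
        = X (Sum.inl i) * minor k j l + X (Sum.inl l) * minor k i j := by
      simp only [minor]
      ring
    rw [this]
    exact q.add_mem (q.mul_mem_left _ h2) (q.mul_mem_left _ h1)
  have hy : X (Sum.inr j) * minor k i l ∈ q := by
    have : X (Sum.inr j) * minor k i l
        = X (Sum.inr i) * minor k j l + X (Sum.inr l) * minor k i j := by
      simp only [minor]
      ring
    rw [this]
    exact q.add_mem (q.mul_mem_left _ h2) (q.mul_mem_left _ h1)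
  by_contra h
  exact hj ⟨(hq.mem_or_mem hx).resolve_right h, (hq.mem_or_mem hy).resolve_right h⟩

lemma minor_mem_of_reachable {q : Ideal (MvPolynomial (V ⊕ V) k)} (hq : q.IsPrime)
    (hJ : binomialEdgeIdeal k G ≤ q) {i j : V}
    (h : (isolate G (zeroColumns q)).Reachable i j) : minor k i j ∈ q := by
  obtain ⟨p⟩ := h
  induction p with
  | nil =>
    rw [minor_self]
    exact zero_mem _
  | cons hadj _ ih =>
    exact minor_mem_trans hq hadj.2.2 (hJ (minor_mem_binomialEdgeIdeal hadj.1)) ih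

variable (k) in
/-- A minimal separator is the set of zero columns of a minimal prime. -/
lemma exists_minimalPrime_of_minimal_separates [LinearOrder V] {u v : V} {S : Set V}
    (hS : Minimal (Separates G u v) S) :
    ∃ q ∈ (binomialEdgeIdeal k G).minimalPrimes, zeroColumns q = S := by
  let ρ : V → V := fun i => ((isolate G S).connectedComponentMk i).out
  have hρ : ∀ i, (isolate G S).connectedComponentMk (ρ i) = (isolate G S).connectedComponentMk i :=
    fun i => Quot.out_eq _
  have hle : binomialEdgeIdeal k G ≤ RingHom.ker (rankOneMap k S ρ) := by
    refine binomialEdgeIdeal_le_ker fun i j hij => ?_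
    by_cases hi : i ∈ S
    · exact Or.inl hi
    by_cases hj : j ∈ S
    · exact Or.inr (Or.inl hj)
    have hadj : (isolate G S).Adj i j := ⟨hij, hi, hj⟩
    refine Or.inr (Or.inr ?_)
    simp only [ρ, SimpleGraph.ConnectedComponent.sound hadj.reachable]
  obtain ⟨q, hq, hqle⟩ := Ideal.exists_minimalPrimes_le hle
  have hsub : zeroColumns q ⊆ S := by
    intro i hi
    by_contra hiS
    exact rankOneMap_inl_ne_zero hiS (hqle hi.1)
  obtain ⟨hu, hv, huv⟩ := hS.prop
  refine ⟨q, hq, hsub.antisymm (hS.le_of_le ⟨fun h => hu (hsub h), fun h => hv (hsub h),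
    fun h => ?_⟩ hsub)⟩
  refine rankOneMap_minor_ne_zero hu hv (fun h' => huv ?_)
    (hqle (minor_mem_of_reachable hq.1.1 hq.1.2 h))
  rw [← SimpleGraph.ConnectedComponent.eq, ← hρ u, ← hρ v, h']

variable (k G) in
lemma exists_minimalPrime_zeroColumns_eq_empty [LinearOrder V] [Nonempty V] :
    ∃ q ∈ (binomialEdgeIdeal k G).minimalPrimes, zeroColumns q = ∅ := by
  inhabit V
  obtain ⟨q, hq, hqle⟩ := Ideal.exists_minimalPrimes_le (binomialEdgeIdeal_le_ker (k := k) (G := G)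
    (T := ∅) (ρ := fun _ => default) fun _ _ _ => Or.inr (Or.inr rfl))
  refine ⟨q, hq, Set.eq_empty_of_forall_notMem fun i hi => ?_⟩
  exact rankOneMap_inl_ne_zero (Set.notMem_empty i) (hqle hi.1)

lemma minimalPrimes_subset_associatedPrimes {S : Type*} [CommRing S] [IsNoetherianRing S]
    (I : Ideal S) : I.minimalPrimes ⊆ associatedPrimes S (S ⧸ I) := by
  have := Module.associatedPrimes.minimalPrimes_annihilator_subset_associatedPrimes S (S ⧸ I)
  rwa [Ideal.annihilator_quotient] at this

/-- If the binomial edge ideal of a connected graph has two associated primes then all minimal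
separators coincide. -/
lemma eq_of_minimal_separates [LinearOrder V] [Finite V] (hconn : G.Connected)
    (hass : (associatedPrimes (MvPolynomial (V ⊕ V) k)
      (MvPolynomial (V ⊕ V) k ⧸ binomialEdgeIdeal k G)).ncard = 2) {u v u' v' : V} {S S' : Set V}
    (hS : Minimal (Separates G u v) S) (hS' : Minimal (Separates G u' v') S') : S = S' := by
  have : Nonempty V := hconn.nonempty
  obtain ⟨q₀, hq₀, h₀⟩ := exists_minimalPrime_zeroColumns_eq_empty k G
  obtain ⟨q₁, hq₁, h₁⟩ := exists_minimalPrime_of_minimal_separates k hS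
  obtain ⟨q₂, hq₂, h₂⟩ := exists_minimalPrime_of_minimal_separates k hS'
  have hne₁ : q₁ ≠ q₀ := by
    rintro rfl
    exact (hS.prop.nonempty hconn).ne_empty (h₁.symm.trans h₀)
  have hne₂ : q₂ ≠ q₀ := by
    rintro rfl
    exact (hS'.prop.nonempty hconn).ne_empty (h₂.symm.trans h₀)
  obtain ⟨a, b, -, hab⟩ := Set.ncard_eq_two.mp hass
  have hmem : (binomialEdgeIdeal k G).minimalPrimes ⊆ {a, b} :=
    hab ▸ minimalPrimes_subset_associatedPrimes _
  have h12 : q₁ = q₂ := by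
    rcases hmem hq₀ with rfl | rfl <;> rcases hmem hq₁ with rfl | rfl <;>
      rcases hmem hq₂ with rfl | rfl <;> first | rfl | exact absurd rfl ‹_›
  rw [← h₁, ← h₂, h12]

end Separators

lemma symbolicPower_le_pow {k V : Type} [Field k] [LinearOrder V] [Finite V] {G : SimpleGraph V}
    (hconn : G.Connected) (hass : (associatedPrimes (MvPolynomial (V ⊕ V) k)
      (MvPolynomial (V ⊕ V) k ⧸ binomialEdgeIdeal k G)).ncard = 2) (t : ℕ) :
    symbolicPower (binomialEdgeIdeal k G) t ≤ binomialEdgeIdeal k G ^ t := by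
  have : Nonempty V := hconn.nonempty
  by_cases hcomplete : ∀ u v, u ≠ v → G.Adj u v
  · exact symbolicPower_le_pow_of_labels (T := ∅) (ℓ := fun _ => 0)
      (fun i j hij => by simp [hcomplete i j hij]) (Or.inr ⟨rfl, fun _ _ => rfl⟩) t
  push Not at hcomplete
  obtain ⟨u, v, huv, hnadj⟩ := hcomplete
  obtain ⟨T, hT⟩ := exists_minimal_separates huv hnadj
  have hsep : ∀ i j, i ≠ j → ¬ G.Adj i j → Separates G i j T := by
    intro i j hij h
    obtain ⟨S, hS⟩ := exists_minimal_separates hij h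
    rw [eq_of_minimal_separates hconn hass hT hS]
    exact hS.prop
  obtain ⟨c, hc⟩ := exists_injective_nat (isolate G T).ConnectedComponent
  have hlabel : ∀ i j, c ((isolate G T).connectedComponentMk i)
      = c ((isolate G T).connectedComponentMk j) ↔ (isolate G T).Reachable i j := fun i j => by
    rw [hc.eq_iff, SimpleGraph.ConnectedComponent.eq]
  refine symbolicPower_le_pow_of_labels (T := T)
    (ℓ := fun i => c ((isolate G T).connectedComponentMk i)) (fun i j hij => ?_)
    (Or.inl ⟨hT.prop.nonempty hconn, u, hT.prop.1, v, hT.prop.2.1, ?_⟩) t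
  · rw [hlabel]
    constructor
    · intro h
      by_cases hi : i ∈ T
      · exact Or.inl hi
      by_cases hj : j ∈ T
      · exact Or.inr (Or.inl hj)
      have hadj : (isolate G T).Adj i j := ⟨h, hi, hj⟩
      exact Or.inr (Or.inr hadj.reachable)
    · intro h
      by_contra hn
      obtain ⟨hi, hj, hr⟩ := hsep i j hij hn
      exact h.elim hi fun h => h.elim hj hr
  · rw [Ne, hlabel]
    exact hT.prop.2.2

end BinomialEdge

/-- If `G` is a connected graph on `{1, …, n}` whose binomial edge ideal `J_G` has exactly
two associated primes, then `J_G ^ t = J_G ^ (t)` for every `t ≥ 1`. -/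
theorem ordinary_eq_symbolic_of_two_associated_primes {n : ℕ} (k : Type) [Field k]
    (G : SimpleGraph (Fin n)) (hconn : G.Connected)
    (hass : (associatedPrimes (MvPolynomial (Fin n ⊕ Fin n) k)
      ((MvPolynomial (Fin n ⊕ Fin n) k) ⧸ binomialEdgeIdeal k G)).ncard = 2) :
    ∀ t : ℕ, 1 ≤ t →
      binomialEdgeIdeal k G ^ t = symbolicPower (binomialEdgeIdeal k G) t := by
  exact fun t _ => le_antisymm (BinomialEdge.pow_le_symbolicPower _ t)
    (BinomialEdge.symbolicPower_le_pow hconn hass t)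
end

section
/- If G is a caterpillar tree on the vertex set {1,…,n}, then J_G^t = J_G^(t) for every integer t ≥ 1. -/
open MvPolynomial

/-- A caterpillar tree: a tree `G` containing a path `P` such that every vertex of `G`
is either a vertex of `P` or adjacent to a vertex of `P`. -/
def IsCaterpillar {V : Type} (G : SimpleGraph V) : Prop :=
  G.IsTree ∧ ∃ (u v : V) (p : G.Walk u v), p.IsPath ∧
    ∀ w : V, w ∈ p.support ∨ ∃ z ∈ p.support, G.Adj w z

namespace CaterpillarPowers

/-- `c` is the last element of `C` preceding `b`. -/
def IsParent {V : Type} [LinearOrder V] (C : Set V) (c b : V) : Prop :=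
  c ∈ C ∧ c < b ∧ ∀ d ∈ C, d < b → d ≤ c

lemma IsParent.unique {V : Type} [LinearOrder V] {C : Set V} {c d b : V}
    (hc : IsParent C c b) (hd : IsParent C d b) : c = d :=
  le_antisymm (hd.2.2 c hc.1 hc.2.1) (hc.2.2 d hd.1 hd.2.1)

lemma IsParent.of_lt {V : Type} [LinearOrder V] {C : Set V} {c a b : V}
    (hc : IsParent C c b) (hca : c < a) (hab : a < b) : IsParent C c a :=
  ⟨hc.1, hca, fun d hd hda => hc.2.2 d hd (hda.trans hab)⟩

/-- The exponent vectors of the leading monomials. -/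
inductive LeadExponent {V : Type} [LinearOrder V] (C : Set V) : (V ⊕ V →₀ ℕ) → Prop
  | edge {a b : V} (h : IsParent C a b) :
      LeadExponent C (Finsupp.single (Sum.inl a) 1 + Finsupp.single (Sum.inr b) 1)
  | cherry {c a b : V} (ha : IsParent C c a) (hb : IsParent C c b) (hab : a < b) :
      LeadExponent C (Finsupp.single (Sum.inr c) 1 + Finsupp.single (Sum.inl a) 1 +
        Finsupp.single (Sum.inr b) 1)

/-- `Packs C v m`: the vector `m` is a sum of `v` exponents of leading monomials. -/
inductive Packs {V : Type} [LinearOrder V] (C : Set V) : ℕ → (V ⊕ V →₀ ℕ) → Prop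
  | zero : Packs C 0 0
  | add {v : ℕ} {m g : V ⊕ V →₀ ℕ} (hm : Packs C v m) (hg : LeadExponent C g) :
      Packs C (v + 1) (m + g)

/-- `Q` meets the support of every leading monomial whose last vertex lies in `s`. -/
def Hits {V : Type} [LinearOrder V] (C : Set V) (s : Set V) (Q : Set (V ⊕ V)) : Prop :=
  ∀ b ∈ s, ∀ c, IsParent C c b → Sum.inr b ∈ Q ∨
    (Sum.inl c ∈ Q ∧ (Sum.inr c ∈ Q ∨ ∀ a, c < a → a < b → Sum.inl a ∈ Q))

section Combinatorics

variable {V : Type} [LinearOrder V] {C : Set V}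

/-- Greedy use of the factors `y_b`. -/
lemma exists_maximal_extension {n : V ⊕ V →₀ ℕ} {c b : V} (hcb : IsParent C c b)
    {A : Finset V} (hA : ∀ a ∈ A, c < a ∧ a < b) (k : ℕ) :
    ∀ (v : ℕ) (m r : V ⊕ V →₀ ℕ), Packs C v m → m + r = n → r (Sum.inr b) = k →
    ∃ (v' : ℕ) (m' r' : V ⊕ V →₀ ℕ), Packs C v' m' ∧ m' + r' = n ∧
      (∀ i, b ≤ i → r' (Sum.inl i) = r (Sum.inl i)) ∧
      (∀ i, b < i → r' (Sum.inr i) = r (Sum.inr i)) ∧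
      v' + r' (Sum.inl c) + ∑ a ∈ A, r' (Sum.inl a) = v + r (Sum.inl c) + ∑ a ∈ A, r (Sum.inl a) ∧
      v' + r' (Sum.inl c) + r' (Sum.inr c) = v + r (Sum.inl c) + r (Sum.inr c) ∧
      v' + r' (Sum.inr b) = v + r (Sum.inr b) ∧
      (r' (Sum.inr b) = 0 ∨ (r' (Sum.inl c) = 0 ∧
        (r' (Sum.inr c) = 0 ∨ ∑ a ∈ A, r' (Sum.inl a) = 0))) := by
  have hcb' := hcb.2.1
  induction k with
  | zero =>
    intro v m r hm hn hk
    exact ⟨v, m, r, hm, hn, fun _ _ => rfl, fun _ _ => rfl, rfl, rfl, rfl, Or.inl hk⟩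
  | succ k ih =>
    intro v m r hm hn hk
    -- removing one leading monomial from `r`
    have key : ∀ g r₀ : V ⊕ V →₀ ℕ, LeadExponent C g → g + r₀ = r →
        r (Sum.inr b) = r₀ (Sum.inr b) + 1 →
        (∀ i, b ≤ i → r₀ (Sum.inl i) = r (Sum.inl i)) →
        (∀ i, b < i → r₀ (Sum.inr i) = r (Sum.inr i)) →
        r₀ (Sum.inl c) + ∑ a ∈ A, r₀ (Sum.inl a) + 1
          = r (Sum.inl c) + ∑ a ∈ A, r (Sum.inl a) →
        r₀ (Sum.inl c) + r₀ (Sum.inr c) + 1 = r (Sum.inl c) + r (Sum.inr c) →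
        ∃ (v' : ℕ) (m' r' : V ⊕ V →₀ ℕ), Packs C v' m' ∧ m' + r' = n ∧
      (∀ i, b ≤ i → r' (Sum.inl i) = r (Sum.inl i)) ∧
      (∀ i, b < i → r' (Sum.inr i) = r (Sum.inr i)) ∧
      v' + r' (Sum.inl c) + ∑ a ∈ A, r' (Sum.inl a) = v + r (Sum.inl c) + ∑ a ∈ A, r (Sum.inl a) ∧
      v' + r' (Sum.inl c) + r' (Sum.inr c) = v + r (Sum.inl c) + r (Sum.inr c) ∧
      v' + r' (Sum.inr b) = v + r (Sum.inr b) ∧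
      (r' (Sum.inr b) = 0 ∨ (r' (Sum.inl c) = 0 ∧
        (r' (Sum.inr c) = 0 ∨ ∑ a ∈ A, r' (Sum.inl a) = 0))) := by
      intro g r₀ hg hgr hb h1 h2 h3 h4
      obtain ⟨v', m', r', p1, p2, p3, p4, p5, p6, p7, p8⟩ :=
        ih (v + 1) (m + g) r₀ (hm.add hg) (by rw [add_assoc, hgr, hn]) (by omega)
      exact ⟨v', m', r', p1, p2, fun i hi => (p3 i hi).trans (h1 i hi),
        fun i hi => (p4 i hi).trans (h2 i hi), by omega, by omega, by omega, p8⟩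
    have hsub : ∀ g : V ⊕ V →₀ ℕ, g ≤ r → g + (r - g) = r := fun g hg => by
      rw [add_comm]; exact tsub_add_cancel_of_le hg
    by_cases hp : r (Sum.inl c) = 0
    · by_cases hh : r (Sum.inr c) = 0
      · exact ⟨v, m, r, hm, hn, fun _ _ => rfl, fun _ _ => rfl, rfl, rfl, rfl,
          Or.inr ⟨hp, Or.inl hh⟩⟩
      by_cases hs : ∑ a ∈ A, r (Sum.inl a) = 0
      · exact ⟨v, m, r, hm, hn, fun _ _ => rfl, fun _ _ => rfl, rfl, rfl, rfl,
          Or.inr ⟨hp, Or.inr hs⟩⟩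
      obtain ⟨a, haA, ha⟩ := Finset.exists_ne_zero_of_sum_ne_zero hs
      obtain ⟨hca, hab⟩ := hA a haA
      have hle : Finsupp.single (Sum.inr c) 1 + Finsupp.single (Sum.inl a) 1 +
          Finsupp.single (Sum.inr b) 1 ≤ r := by
        intro z
        rcases z with i | i
        · by_cases h : a = i
          · subst h; simp; omega
          · simp [h]
        · by_cases h : c = i
          · subst h; simp [hcb'.ne']; omega
          · by_cases h' : b = i
            · subst h'; simp [h]; omega
            · simp [h, h']
      refine key _ _ (.cherry (hcb.of_lt hca hab) hcb hab) (hsub _ hle) ?_ ?_ ?_ ?_ ?_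
      · simp [hcb'.ne]; omega
      · intro i hi; simp [(hab.trans_le hi).ne]
      · intro i hi; simp [hi.ne, (hcb'.trans hi).ne]
      · have : ∑ a' ∈ A, r (Sum.inl a') = ∑ a' ∈ A, (r - (Finsupp.single (Sum.inr c) 1 +
            Finsupp.single (Sum.inl a) 1 + Finsupp.single (Sum.inr b) 1) : V ⊕ V →₀ ℕ)
              (Sum.inl a') + 1 := by
          rw [← Finset.add_sum_erase _ _ haA, ← Finset.add_sum_erase _ _ haA]
          have : ∀ x ∈ A.erase a, (r - (Finsupp.single (Sum.inr c) 1 +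
            Finsupp.single (Sum.inl a) 1 + Finsupp.single (Sum.inr b) 1) : V ⊕ V →₀ ℕ) (Sum.inl x)
              = r (Sum.inl x) := by
            intro x hx
            simp [(Finset.ne_of_mem_erase hx).symm]
          rw [Finset.sum_congr rfl this]
          simp; omega
        rw [this]
        simp [hca.ne']; omega
      · simp [hca.ne', hcb'.ne']; omega
    · have hle : Finsupp.single (Sum.inl c) 1 + Finsupp.single (Sum.inr b) 1 ≤ r := by
        intro z
        rcases z with i | i
        · by_cases h : c = i
          · subst h; simp; omega
          · simp [h]
        · by_cases h' : b = i
          · subst h'; simp; omega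
          · simp [h']
      refine key _ _ (.edge hcb) (hsub _ hle) ?_ ?_ ?_ ?_ ?_
      · simp; omega
      · intro i hi; simp [(hcb'.trans_le hi).ne]
      · intro i hi; simp [hi.ne]
      · have : ∀ x ∈ A, (r - (Finsupp.single (Sum.inl c) 1 + Finsupp.single (Sum.inr b) 1) :
            V ⊕ V →₀ ℕ) (Sum.inl x) = r (Sum.inl x) := by
          intro x hx
          simp [(hA x hx).1.ne]
        rw [Finset.sum_congr rfl this]
        simp; omega
      · have hne := hcb'.ne'
        simp only [ne_eq] at hne
        simp [hne]
        omega

/-- The state of the greedy packing after the vertices in `s`, the last centre being `c`,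
together with the partial hitting sets certifying its optimality. -/
structure GreedyState (C : Set V) (n : V ⊕ V →₀ ℕ) (s : Finset V) (c : V) (v : ℕ)
    (m r : V ⊕ V →₀ ℕ) : Prop where
  packs : Packs C v m
  add_eq : m + r = n
  inl_eq : ∀ i ∉ s, r (Sum.inl i) = n (Sum.inl i)
  inr_eq : ∀ i ∉ s, r (Sum.inr i) = n (Sum.inr i)
  mem_s : c ∈ s
  mem_C : c ∈ C
  last : ∀ d ∈ C, d ∈ s → d ≤ c
  exists_hits : ∃ Q : Finset (V ⊕ V), Hits C s Q ∧ ∑ z ∈ Q, n z ≤ v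
  exists_hits_before : ∃ Q : Finset (V ⊕ V), Hits C s Q ∧ Sum.inl c ∈ Q ∧
    (Sum.inr c ∈ Q ∨ ∀ a ∈ s, c < a → Sum.inl a ∈ Q) ∧
    ∑ z ∈ Q, n z ≤ v + r (Sum.inl c) + ∑ a ∈ s with c < a, r (Sum.inl a)
  exists_hits_cut : ∃ Q : Finset (V ⊕ V), Hits C s Q ∧ Sum.inl c ∈ Q ∧ Sum.inr c ∈ Q ∧
    ∑ z ∈ Q, n z ≤ v + r (Sum.inl c) + r (Sum.inr c)

lemma sum_insert_le (n : V ⊕ V →₀ ℕ) (Q : Finset (V ⊕ V)) (z : V ⊕ V) :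
    ∑ x ∈ insert z Q, n x ≤ ∑ x ∈ Q, n x + n z := by
  by_cases h : z ∈ Q
  · simp [Finset.insert_eq_of_mem h]
  · rw [Finset.sum_insert h, add_comm]

lemma Hits.insert_of_inr {s : Set V} {Q Q' : Set (V ⊕ V)} {b : V} (h : Hits C s Q)
    (hQ : Q ⊆ Q') (hb : Sum.inr b ∈ Q') : Hits C (insert b s) Q' := by
  rintro d (rfl | hd) c hc
  · exact Or.inl hb
  · rcases h d hd c hc with h | ⟨h1, h2 | h2⟩
    · exact Or.inl (hQ h)
    · exact Or.inr ⟨hQ h1, Or.inl (hQ h2)⟩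
    · exact Or.inr ⟨hQ h1, Or.inr fun a h3 h4 => hQ (h2 a h3 h4)⟩

lemma Hits.insert_of_parent {s : Set V} {Q Q' : Set (V ⊕ V)} {b c : V} (h : Hits C s Q)
    (hQ : Q ⊆ Q') (hcb : IsParent C c b) (hc : Sum.inl c ∈ Q)
    (ha : Sum.inr c ∈ Q ∨ ∀ a, c < a → a < b → Sum.inl a ∈ Q) : Hits C (insert b s) Q' := by
  rintro d (rfl | hd) c' hc'
  · obtain rfl := hcb.unique hc'
    exact Or.inr ⟨hQ hc, ha.imp (fun h => hQ h) fun h2 a h3 h4 => hQ (h2 a h3 h4)⟩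
  · rcases h d hd c' hc' with h | ⟨h1, h2 | h2⟩
    · exact Or.inl (hQ h)
    · exact Or.inr ⟨hQ h1, Or.inl (hQ h2)⟩
    · exact Or.inr ⟨hQ h1, Or.inr fun a h3 h4 => hQ (h2 a h3 h4)⟩

lemma GreedyState.step {n : V ⊕ V →₀ ℕ} {s : Finset V} {c : V} {v : ℕ} {m r : V ⊕ V →₀ ℕ}
    (h : GreedyState C n s c v m r) {b : V} (hb : ∀ a, a < b ↔ a ∈ s) :
    ∃ c' v' m' r', GreedyState C n (insert b s) c' v' m' r' := by
  have hcb : IsParent C c b :=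
    ⟨h.mem_C, (hb c).2 h.mem_s, fun d hd hdb => h.last d hd ((hb d).1 hdb)⟩
  have hbs : b ∉ s := fun hh => lt_irrefl b ((hb b).2 hh)
  obtain ⟨v', m', r', p1, p2, p3, p4, p5, p6, p7, p8⟩ :=
    exists_maximal_extension (A := {a ∈ s | c < a}) hcb
      (fun a ha => ⟨(Finset.mem_filter.1 ha).2, (hb a).2 (Finset.mem_filter.1 ha).1⟩)
      (r (Sum.inr b)) v m r h.packs h.add_eq rfl
  obtain ⟨Q₁, q1, q1'⟩ := h.exists_hits
  obtain ⟨Q₂, q2, q2c, q2a, q2'⟩ := h.exists_hits_before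
  obtain ⟨Q₃, q3, q3c, q3d, q3'⟩ := h.exists_hits_cut
  have hrb := h.inr_eq b hbs
  have hrb' := h.inl_eq b hbs
  have hr'b := p3 b le_rfl
  have q2b : Sum.inr c ∈ (Q₂ : Set (V ⊕ V)) ∨
      ∀ a, c < a → a < b → Sum.inl a ∈ (Q₂ : Set (V ⊕ V)) :=
    q2a.imp id fun h2 a h3 h4 => h2 a ((hb a).1 h4) h3
  have hfirst : ∃ Q : Finset (V ⊕ V), Hits C (insert b s : Set V) Q ∧ ∑ z ∈ Q, n z ≤ v' := by
    rcases p8 with p8 | ⟨p8, p9 | p9⟩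
    · refine ⟨insert (Sum.inr b) Q₁, q1.insert_of_inr (by simp) (by simp), ?_⟩
      have := sum_insert_le n Q₁ (Sum.inr b)
      omega
    · exact ⟨Q₃, q3.insert_of_parent subset_rfl hcb q3c (Or.inl q3d), by omega⟩
    · exact ⟨Q₂, q2.insert_of_parent subset_rfl hcb q2c q2b, by omega⟩
  have hnot : ∀ i ∉ insert b s, b < i := by
    intro i hi
    rw [Finset.mem_insert, not_or] at hi
    exact lt_of_le_of_ne (not_lt.1 fun hh => hi.2 ((hb i).1 hh)) (Ne.symm hi.1)
  have hinl : ∀ i ∉ insert b s, r' (Sum.inl i) = n (Sum.inl i) := fun i hi =>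
    (p3 i (hnot i hi).le).trans (h.inl_eq i fun hh => hi (Finset.mem_insert_of_mem hh))
  have hinr : ∀ i ∉ insert b s, r' (Sum.inr i) = n (Sum.inr i) := fun i hi =>
    (p4 i (hnot i hi)).trans (h.inr_eq i fun hh => hi (Finset.mem_insert_of_mem hh))
  by_cases hbC : b ∈ C
  · refine ⟨b, v', m', r', p1, p2, hinl, hinr, by simp, hbC, ?_, by simpa using hfirst, ?_, ?_⟩
    · intro d _ hds
      rcases Finset.mem_insert.1 hds with rfl | hds
      · exact le_rfl
      · exact ((hb d).2 hds).le
    · obtain ⟨Q, hQ, hQ'⟩ := hfirst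
      refine ⟨insert (Sum.inl b) Q, ?_, by simp, Or.inr ?_, ?_⟩
      · rintro d hd c' hc'
        rcases hQ d (by simpa using hd) c' hc' with h | ⟨h1, h2 | h2⟩
        · exact Or.inl (by simpa using h)
        · exact Or.inr ⟨Finset.mem_insert_of_mem h1, Or.inl (Finset.mem_insert_of_mem h2)⟩
        · exact Or.inr ⟨Finset.mem_insert_of_mem h1,
            Or.inr fun a h3 h4 => Finset.mem_insert_of_mem (h2 a h3 h4)⟩
      · intro a ha hba
        rcases Finset.mem_insert.1 ha with rfl | ha
        · exact absurd hba (lt_irrefl _)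
        · exact absurd hba ((hb a).2 ha).not_gt
      · have := sum_insert_le n Q (Sum.inl b)
        omega
    · refine ⟨insert (Sum.inl b) (insert (Sum.inr b) Q₁), ?_, by simp, by simp, ?_⟩
      · rw [Finset.coe_insert b s]
        refine q1.insert_of_inr ?_ (by simp)
        intro z hz
        simp [Finset.mem_coe.1 hz]
      · have h1 := sum_insert_le n (insert (Sum.inr b) Q₁) (Sum.inl b)
        have h2 := sum_insert_le n Q₁ (Sum.inr b)
        omega
  · refine ⟨c, v', m', r', p1, p2, hinl, hinr, Finset.mem_insert_of_mem h.mem_s, h.mem_C, ?_,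
      by simpa using hfirst, ?_, ?_⟩
    · intro d hd hds
      rcases Finset.mem_insert.1 hds with rfl | hds
      · exact absurd hd hbC
      · exact h.last d hd hds
    · refine ⟨insert (Sum.inl b) Q₂, ?_, Finset.mem_insert_of_mem q2c, ?_, ?_⟩
      · rw [Finset.coe_insert b s]
        exact q2.insert_of_parent (by simp) hcb q2c q2b
      · refine q2a.imp (fun h => Finset.mem_insert_of_mem h) fun h2 a ha hca => ?_
        rcases Finset.mem_insert.1 ha with rfl | ha
        · exact Finset.mem_insert_self _ _
        · exact Finset.mem_insert_of_mem (h2 a ha hca)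
      · have h1 := sum_insert_le n Q₂ (Sum.inl b)
        rw [Finset.filter_insert, if_pos hcb.2.1,
          Finset.sum_insert fun hh => hbs (Finset.mem_filter.1 hh).1]
        omega
    · refine ⟨Q₃, ?_, q3c, q3d, by omega⟩
      rw [Finset.coe_insert b s]
      exact q3.insert_of_parent subset_rfl hcb q3c (Or.inl q3d)

lemma GreedyState.start (n : V ⊕ V →₀ ℕ) {b : V} (hb : ∀ a, b ≤ a) (hbC : b ∈ C) :
    GreedyState C n {b} b 0 0 n := by
  have hhits : ∀ Q, Hits C (({b} : Finset V) : Set V) Q := by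
    intro Q d hd c hc
    have hdb : d = b := by simpa using hd
    exact absurd hc.2.1 (hdb ▸ (hb c).not_gt)
  refine ⟨.zero, zero_add _, fun _ _ => rfl, fun _ _ => rfl, by simp, hbC,
    fun d _ hd => (Finset.mem_singleton.1 hd).le, ⟨∅, hhits _, by simp⟩,
    ⟨{Sum.inl b}, hhits _, by simp, Or.inr ?_, ?_⟩,
    ⟨{Sum.inl b, Sum.inr b}, hhits _, by simp, by simp, ?_⟩⟩
  · intro a ha hba
    exact absurd (Finset.mem_singleton.1 ha) hba.ne'
  · simp
  · rw [Finset.sum_pair (by simp)]; omega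

/-- Packing equals covering for the leading monomials of a caterpillar. -/
theorem exists_packs_of_hits [Fintype V] (hC : ∀ b, (∀ a, b ≤ a) → b ∈ C) (n : V ⊕ V →₀ ℕ) (t : ℕ)
    (ht : ∀ Q : Finset (V ⊕ V), Hits C Set.univ Q → t ≤ ∑ z ∈ Q, n z) :
    ∃ v m r, t ≤ v ∧ Packs C v m ∧ m + r = n := by
  have main : ∀ s : Finset V, (∀ b ∈ s, ∀ a < b, a ∈ s) → s.Nonempty →
      ∃ c v m r, GreedyState C n s c v m r := by
    intro s
    induction s using Finset.induction_on_max with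
    | empty => intro _ h; exact absurd h (by simp)
    | insert b s hs ih =>
      intro hlow _
      have hbs : ∀ a, a < b ↔ a ∈ s := fun a =>
        ⟨fun h => (Finset.mem_insert.1 (hlow b (Finset.mem_insert_self _ _) a h)).resolve_left h.ne,
          hs a⟩
      rcases s.eq_empty_or_nonempty with rfl | hne
      · have hmin : ∀ a, b ≤ a := fun a => not_lt.1 fun h => by simpa using (hbs a).1 h
        exact ⟨b, 0, 0, n, GreedyState.start n hmin (hC b hmin)⟩
      · obtain ⟨c, v, m, r, h⟩ := ih (fun d hd a had =>
          (hbs a).1 (had.trans (hs d hd))) hne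
        exact h.step hbs
  rcases (Finset.univ : Finset V).eq_empty_or_nonempty with h | h
  · have hV : IsEmpty V := Finset.univ_eq_empty_iff.1 h
    have := ht ∅ (fun b => hV.elim b)
    exact ⟨0, 0, n, by simpa using this, .zero, zero_add _⟩
  · obtain ⟨c, v, m, r, h⟩ := main Finset.univ (by simp) h
    obtain ⟨Q, hQ, hQ'⟩ := h.exists_hits
    exact ⟨v, m, r, (ht Q (by simpa using hQ)).trans hQ', h.packs, h.add_eq⟩

/-- A set `S` of removed vertices together with a choice, for each connected component of the
remaining graph, of a threshold vertex `th i` in the component of `i`. -/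
structure IsThreshold {V : Type} (G : SimpleGraph V) (S : Finset V) (th : V → V) : Prop where
  notMem : ∀ i ∉ S, th i ∉ S
  idem : ∀ i ∉ S, th (th i) = th i
  adj : ∀ i j, G.Adj i j → i ∉ S → j ∉ S → th i = th j
  reach : ∀ i ∉ S, Relation.ReflTransGen (fun a b => G.Adj a b ∧ a ∉ S ∧ b ∉ S) i (th i)

/-- The variables of the monomial prime attached to threshold data. -/
def thresholdVars {V : Type} [LinearOrder V] (S : Finset V) (th : V → V) : Set (V ⊕ V) :=
  Sum.elim (fun i => i ∈ S ∨ i < th i) (fun i => i ∈ S ∨ th i < i)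

@[simp] lemma inl_mem_thresholdVars {S : Finset V} {th : V → V} {i : V} :
    Sum.inl i ∈ thresholdVars S th ↔ i ∈ S ∨ i < th i := Iff.rfl

@[simp] lemma inr_mem_thresholdVars {S : Finset V} {th : V → V} {i : V} :
    Sum.inr i ∈ thresholdVars S th ↔ i ∈ S ∨ th i < i := Iff.rfl

/-- The graph in which the vertices are joined to their parents. -/
def IsParentGraph (C : Set V) (G : SimpleGraph V) : Prop :=
  ∀ a b, a < b → (G.Adj a b ↔ IsParent C a b)

lemma exists_root [Finite V] (C : Set V) (S : Finset V) :
    ∃ root : V → V, (∀ b c, IsParent C c b → c ∉ S → root b = root c) ∧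
      (∀ b, root b = b ∨ ∃ c, IsParent C c b ∧ c ∉ S ∧ root b = root c) := by
  classical
  let F : (b : V) → ((c : V) → c < b → V) → V := fun b rec =>
    if h : ∃ c, IsParent C c b ∧ c ∉ S then rec h.choose h.choose_spec.1.2.1 else b
  have hwf : WellFounded ((· < ·) : V → V → Prop) := wellFounded_lt
  refine ⟨hwf.fix F, fun b c hc hcS => ?_, fun b => ?_⟩
  · have h : ∃ c, IsParent C c b ∧ c ∉ S := ⟨c, hc, hcS⟩
    rw [hwf.fix_eq]
    simp only [F, dif_pos h]
    rw [h.choose_spec.1.unique hc]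
  · by_cases h : ∃ c, IsParent C c b ∧ c ∉ S
    · refine Or.inr ⟨h.choose, h.choose_spec.1, h.choose_spec.2, ?_⟩
      rw [hwf.fix_eq]
      simp only [F, dif_pos h]
    · left
      rw [hwf.fix_eq]
      simp only [F, dif_neg h]

/-- Every hitting set contains the variables of some threshold data. -/
lemma exists_threshold_of_hits [Fintype V] {G : SimpleGraph V} (hG : IsParentGraph C G)
    {Q : Set (V ⊕ V)} (hQ : Hits C Set.univ Q) :
    ∃ S th, IsThreshold G S th ∧ thresholdVars S th ⊆ Q := by
  classical
  let S : Finset V := {i | Sum.inl i ∈ Q ∧ Sum.inr i ∈ Q}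
  have memS : ∀ i, i ∈ S ↔ Sum.inl i ∈ Q ∧ Sum.inr i ∈ Q := fun i => by simp [S]
  obtain ⟨root, hroot, hroot'⟩ := exists_root C S
  let r : V → V → Prop := fun a b => G.Adj a b ∧ a ∉ S ∧ b ∉ S
  have hsymm : Std.Symm r := ⟨fun a b h => ⟨h.1.symm, h.2.2, h.2.1⟩⟩
  have hreach : ∀ i, i ∉ S → Relation.ReflTransGen r i (root i) := by
    intro i
    induction i using WellFoundedLT.induction with
    | ind i ih =>
      intro hi
      rcases hroot' i with h | ⟨c, hc, hcS, h⟩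
      · rw [h]
      · rw [h]
        exact .head ⟨((hG c i hc.2.1).2 hc).symm, hi, hcS⟩ (ih c hc.2.1 hcS)
  have hle : ∀ i, root i ≤ i := by
    intro i
    induction i using WellFoundedLT.induction with
    | ind i ih =>
      rcases hroot' i with h | ⟨c, hc, hcS, h⟩
      · rw [h]
      · rw [h]; exact (ih c hc.2.1).trans hc.2.1.le
  -- the threshold of the component with a given root
  have hex : ∀ ρ : V, ∃ l, (∃ i ∉ S, root i = ρ) → (l ∉ S ∧ root l = ρ ∧
      (∀ i ∉ S, root i = ρ → i < l → Sum.inl i ∈ Q) ∧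
      (Sum.inl l ∉ Q ∨ ∀ i ∉ S, root i = ρ → i ≤ l)) := by
    intro ρ
    by_cases h : ∃ i ∉ S, root i = ρ
    · by_cases h1 : ∃ i, i ∉ S ∧ root i = ρ ∧ Sum.inl i ∉ Q
      · obtain ⟨l, hl, hmin⟩ := wellFounded_lt.has_min {i | i ∉ S ∧ root i = ρ ∧ Sum.inl i ∉ Q} h1
        refine ⟨l, fun _ => ⟨hl.1, hl.2.1, fun i hi hiρ hil => ?_, Or.inl hl.2.2⟩⟩
        by_contra hc
        exact hmin i ⟨hi, hiρ, hc⟩ hil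
      · obtain ⟨l, hl, hmax⟩ := (wellFounded_gt (α := V)).has_min {i | i ∉ S ∧ root i = ρ} h
        push Not at h1
        exact ⟨l, fun _ => ⟨hl.1, hl.2, fun i hi hiρ _ => h1 i hi hiρ,
          Or.inr fun i hi hiρ => not_lt.1 (hmax i ⟨hi, hiρ⟩)⟩⟩
    · exact ⟨ρ, fun h' => absurd h' h⟩
  choose l hl using hex
  have hl' : ∀ i ∉ S, _ := fun i hi => hl (root i) ⟨i, hi, rfl⟩
  have hright : ∀ b, b ∉ S → l (root b) < b → Sum.inr b ∈ Q := by
    intro b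
    induction b using WellFoundedLT.induction with
    | ind b ih =>
      intro hb hlb
      obtain ⟨h1, h2, h3, h4⟩ := hl' b hb
      replace h4 := h4.resolve_right fun h => (h b hb rfl).not_gt hlb
      rcases hroot' b with h | ⟨c, hc, hcS, h⟩
      · have := hle (l (root b))
        rw [h2] at this
        rw [h] at this hlb
        exact absurd hlb this.not_gt
      · rcases hQ b trivial c hc with h5 | ⟨h5, h6⟩
        · exact h5
        · exfalso
          have h7 : Sum.inr c ∉ Q := fun h8 => hcS ((memS c).2 ⟨h5, h8⟩)
          rcases lt_trichotomy c (l (root b)) with hlt | heq | hgt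
          · exact h4 ((h6.resolve_left h7) _ hlt hlb)
          · exact h4 (heq ▸ h5)
          · exact h7 (ih c hc.2.1 hcS (h ▸ hgt))
  refine ⟨S, fun i => l (root i), ⟨fun i hi => (hl' i hi).1, fun i hi => ?_, ?_, fun i hi => ?_⟩, ?_⟩
  · rw [(hl' i hi).2.1]
  · intro i j hij hi hj
    rcases lt_or_gt_of_ne hij.ne with h | h
    · rw [hroot j i ((hG i j h).1 hij) hi]
    · rw [hroot i j ((hG j i h).1 hij.symm) hj]
  · refine (hreach i hi).trans ?_
    have := hreach _ (hl' i hi).1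
    rw [(hl' i hi).2.1] at this
    exact (Relation.ReflTransGen.stdSymm (r := r)).symm _ _ this
  · rintro (i | i) hz
    · rcases inl_mem_thresholdVars.1 hz with h | h
      · exact ((memS i).1 h).1
      · by_cases hi : i ∈ S
        · exact ((memS i).1 hi).1
        · exact (hl' i hi).2.2.1 i hi rfl h
    · rcases inr_mem_thresholdVars.1 hz with h | h
      · exact ((memS i).1 h).2
      · by_cases hi : i ∈ S
        · exact ((memS i).1 hi).2
        · exact hright i hi h

/-- If all remaining neighbours of a removed vertex have the same threshold, the vertex need not
be removed. -/
lemma IsThreshold.exists_smaller {G : SimpleGraph V} {S : Finset V} {th : V → V}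
    (h : IsThreshold G S th) {c : V} (hc : c ∈ S)
    (hbad : ∀ a b, G.Adj c a → G.Adj c b → a ∉ S → b ∉ S → th a = th b) :
    ∃ th', IsThreshold G (S.erase c) th' ∧
      thresholdVars (S.erase c) th' ⊆ thresholdVars S th := by
  have mem : ∀ i, i ∉ S.erase c ↔ i = c ∨ i ∉ S := fun i => by
    rw [Finset.mem_erase]; tauto
  have hmono : ∀ i j, Relation.ReflTransGen (fun a b => G.Adj a b ∧ a ∉ S ∧ b ∉ S) i j →
      Relation.ReflTransGen (fun a b => G.Adj a b ∧ a ∉ S.erase c ∧ b ∉ S.erase c) i j :=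
    fun i j => Relation.ReflTransGen.mono (fun a b hab =>
      ⟨hab.1, (mem a).2 (Or.inr hab.2.1), (mem b).2 (Or.inr hab.2.2)⟩) i j
  have hne : ∀ i, i ∉ S → i ≠ c := fun i hi hic => hi (hic ▸ hc)
  obtain ⟨l, hl1, hl2, hl3, hl4⟩ : ∃ l, l ∉ S.erase c ∧ (l = c ∨ th l = l) ∧
      (∀ a, G.Adj c a → a ∉ S → th a = l) ∧ Relation.ReflTransGen
        (fun a b => G.Adj a b ∧ a ∉ S.erase c ∧ b ∉ S.erase c) c l := by
    by_cases hn : ∃ a, G.Adj c a ∧ a ∉ S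
    · obtain ⟨a, hca, ha⟩ := hn
      exact ⟨th a, (mem _).2 (Or.inr (h.notMem a ha)), Or.inr (h.idem a ha),
        fun b hcb hb => hbad b a hcb hca hb ha,
        .head ⟨hca, (mem c).2 (Or.inl rfl), (mem a).2 (Or.inr ha)⟩ (hmono _ _ (h.reach a ha))⟩
    · exact ⟨c, (mem c).2 (Or.inl rfl), Or.inl rfl, fun a hca ha => absurd ⟨a, hca, ha⟩ hn, .refl⟩
  have upd : ∀ i, i ∉ S → Function.update th c l i = th i := fun i hi =>
    Function.update_of_ne (hne i hi) _ _
  refine ⟨Function.update th c l, ⟨?_, ?_, ?_, ?_⟩, ?_⟩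
  · intro i hi
    rcases (mem i).1 hi with rfl | hi
    · simpa using hl1
    · rw [upd i hi]; exact (mem _).2 (Or.inr (h.notMem i hi))
  · intro i hi
    rcases (mem i).1 hi with rfl | hi
    · rw [Function.update_self]
      rcases hl2 with rfl | hl2
      · simp
      · by_cases hli : l = i
        · rw [hli, Function.update_self]
        · rw [Function.update_of_ne hli, hl2]
    · rw [upd i hi, upd _ (h.notMem i hi), h.idem i hi]
  · intro i j hij hi hj
    rcases (mem i).1 hi with hi' | hi' <;> rcases (mem j).1 hj with hj' | hj'
    · rw [hi', hj']
    · rw [upd j hj', hi', Function.update_self, hl3 j (hi' ▸ hij) hj']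
    · rw [upd i hi', hj', Function.update_self, hl3 i (hj' ▸ hij.symm) hi']
    · rw [upd i hi', upd j hj', h.adj i j hij hi' hj']
  · intro i hi
    rcases (mem i).1 hi with rfl | hi
    · rw [Function.update_self]; exact hl4
    · rw [upd i hi]; exact hmono _ _ (h.reach i hi)
  · rintro (i | i) hz <;> by_cases hi : i ∈ S
    · exact Or.inl hi
    · rw [inl_mem_thresholdVars, upd i hi] at hz
      exact hz.imp_left Finset.mem_of_mem_erase
    · exact Or.inl hi
    · rw [inr_mem_thresholdVars, upd i hi] at hz
      exact hz.imp_left Finset.mem_of_mem_erase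

end Combinatorics

section Degeneration

variable {σ k K : Type} [Field k] [Field K]

/-- Evaluation at a point whose coordinates are polynomials over the rational function field. -/
noncomputable def evalAt (ι : MvPolynomial σ k →+* K) (pt : σ → Polynomial K) :
    MvPolynomial σ k →+* Polynomial K :=
  eval₂Hom ((Polynomial.C.comp ι).comp C) pt

lemma evalAt_X (ι : MvPolynomial σ k →+* K) (pt : σ → Polynomial K) (z : σ) :
    evalAt ι pt (X z) = pt z := by
  simp [evalAt]

/-- Evaluation at the point `pt`, moved by an infinitesimal multiple of the generic point in the
directions of `Q`. -/
noncomputable def deform (ι : MvPolynomial σ k →+* K) (Q : Set σ) [DecidablePred (· ∈ Q)]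
    (w : σ → ℕ) (pt : σ → Polynomial K) : MvPolynomial σ k →+* Polynomial (Polynomial K) :=
  eval₂Hom (((Polynomial.C.comp Polynomial.C).comp ι).comp C) fun z =>
    (pt z).map Polynomial.C + if z ∈ Q then
      Polynomial.C (Polynomial.C (ι (X z)) * Polynomial.X) * Polynomial.X ^ w z else 0

/-- The data of a point specialising to the generic zero of the variables in `Q` when all
coordinates are replaced by their components of weight `w`. -/
structure IsInitialPoint (ι : MvPolynomial σ k →+* K) (Q : Set σ) (w : σ → ℕ)
    (pt : σ → Polynomial K) : Prop where
  injective : Function.Injective ι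
  eq_of_notMem : ∀ z ∉ Q, pt z = Polynomial.C (ι (X z)) * Polynomial.X ^ w z
  degree_lt : ∀ z ∈ Q, (pt z).degree < w z

variable {ι : MvPolynomial σ k →+* K} {Q : Set σ} {w : σ → ℕ} {pt : σ → Polynomial K}

/-- Evaluation at an initial point is injective on polynomials in the variables outside `Q`. -/
lemma eq_zero_of_evalAt_eq_zero (h : IsInitialPoint ι Q w pt) {f : MvPolynomial σ k}
    (hf : f ∈ supported k Qᶜ) (h0 : evalAt ι pt f = 0) : f = 0 := by
  rw [supported_eq_range_rename] at hf
  obtain ⟨g, rfl⟩ := hf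
  have : ((Polynomial.evalRingHom 1).comp (evalAt ι pt)).comp (rename Subtype.val).toRingHom
      = ι.comp (rename (Subtype.val : (Qᶜ : Set σ) → σ)).toRingHom := by
    refine MvPolynomial.ringHom_ext (fun a => ?_) fun z => ?_
    · simp [evalAt]
    · simp [evalAt, h.eq_of_notMem z z.2]
  have h1 := congrArg (fun φ => φ g) this
  simp only [RingHom.comp_apply, AlgHom.toRingHom_eq_coe, RingHom.coe_coe] at h1
  erw [h0, map_zero] at h1
  exact (map_eq_zero_iff _ h.injective).1 h1.symm

lemma X_notMem_ker (h : IsInitialPoint ι Q w pt) {z : σ} (hz : z ∉ Q) :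
    X z ∉ RingHom.ker (evalAt ι pt) := fun hh =>
  X_ne_zero z (eq_zero_of_evalAt_eq_zero h (Algebra.subset_adjoin ⟨z, hz, rfl⟩) hh)

/-- A prime ideal below the kernel of evaluation at an initial point, modulo which every variable
is a quotient of polynomials in the variables outside `Q`, is the whole kernel. -/
lemma ker_evalAt_le (h : IsInitialPoint ι Q w pt) {p : Ideal (MvPolynomial σ k)} (hp : p.IsPrime)
    (hpq : p ≤ RingHom.ker (evalAt ι pt))
    (hQ : ∀ z ∈ Q, ∃ u ∈ supported k Qᶜ, ∃ b ∈ supported k Qᶜ, u ≠ 0 ∧ u * X z - b ∈ p) :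
    RingHom.ker (evalAt ι pt) ≤ p := by
  have main : ∀ g : MvPolynomial σ k, ∃ u ∈ supported k Qᶜ, ∃ b ∈ supported k Qᶜ,
      u ≠ 0 ∧ u * g - b ∈ p := by
    intro g
    induction g using MvPolynomial.induction_on with
    | C a => exact ⟨1, one_mem _, C a, Subalgebra.algebraMap_mem _ a, one_ne_zero, by simp⟩
    | add f g hf hg =>
      obtain ⟨u, hu, b, hb, hu0, hub⟩ := hf
      obtain ⟨u', hu', b', hb', hu0', hub'⟩ := hg
      refine ⟨u * u', mul_mem hu hu', u' * b + u * b', add_mem (mul_mem hu' hb) (mul_mem hu hb'),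
        mul_ne_zero hu0 hu0', ?_⟩
      have := p.add_mem (p.mul_mem_left u' hub) (p.mul_mem_left u hub')
      convert! this using 1
      ring
    | mul_X f z hf =>
      obtain ⟨u, hu, b, hb, hu0, hub⟩ := hf
      obtain ⟨u', hu', b', hb', hu0', hub'⟩ : ∃ u ∈ supported k Qᶜ, ∃ b ∈ supported k Qᶜ,
          u ≠ 0 ∧ u * X z - b ∈ p := by
        by_cases hz : z ∈ Q
        · exact hQ z hz
        · exact ⟨1, one_mem _, X z, Algebra.subset_adjoin ⟨z, hz, rfl⟩, one_ne_zero, by simp⟩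
      refine ⟨u * u', mul_mem hu hu', b * b', mul_mem hb hb', mul_ne_zero hu0 hu0', ?_⟩
      have := p.add_mem (p.mul_mem_left (u' * X z) hub) (p.mul_mem_left b hub')
      convert! this using 1
      ring
  intro g hg
  obtain ⟨u, hu, b, hb, hu0, hub⟩ := main g
  have hbq : b ∈ RingHom.ker (evalAt ι pt) := by
    have := Ideal.sub_mem _ (Ideal.mul_mem_left _ u hg) (hpq hub)
    simpa using this
  obtain rfl := eq_zero_of_evalAt_eq_zero h hb hbq
  rw [sub_zero] at hub
  exact (hp.mem_or_mem hub).resolve_left fun hup => hu0 (eq_zero_of_evalAt_eq_zero h hu (hpq hup))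

variable [DecidablePred (· ∈ Q)]

lemma map_deform (f : MvPolynomial σ k) :
    (deform ι Q w pt f).map (Polynomial.evalRingHom 0) = evalAt ι pt f := by
  have : (Polynomial.mapRingHom (Polynomial.evalRingHom 0)).comp (deform ι Q w pt) =
      evalAt ι pt := by
    refine MvPolynomial.ringHom_ext (fun a => ?_) fun z => ?_
    · simp [deform, evalAt]
    · simp only [deform, evalAt, RingHom.comp_apply, coe_eval₂Hom, eval₂_X,
        Polynomial.coe_mapRingHom, Polynomial.map_add, Polynomial.map_map]
      have h1 : (Polynomial.evalRingHom (0 : K)).comp Polynomial.C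
          = RingHom.id _ := by ext; simp
      rw [h1, Polynomial.map_id]
      split_ifs <;> simp
  exact congrArg (fun φ => φ f) this

lemma dvd_deform_iff (f : MvPolynomial σ k) :
    Polynomial.C Polynomial.X ∣ deform ι Q w pt f ↔ evalAt ι pt f = 0 := by
  rw [← map_deform (Q := Q) (w := w), Polynomial.C_dvd_iff_dvd_coeff, Polynomial.ext_iff]
  refine forall_congr' fun i => ?_
  rw [Polynomial.X_dvd_iff, Polynomial.coeff_map, Polynomial.coeff_zero_eq_eval_zero]
  simp

lemma deform_monomial (h : IsInitialPoint ι Q w pt) (n : σ →₀ ℕ) (a : k) :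
    (deform ι Q w pt (monomial n a)).natDegree ≤ Finsupp.weight w n ∧
    (deform ι Q w pt (monomial n a)).coeff (Finsupp.weight w n) =
      Polynomial.C (ι (monomial n a)) *
        Polynomial.X ^ Finsupp.weight (fun z => if z ∈ Q then 1 else 0) n := by
  have hX : ∀ z, (deform ι Q w pt (X z)).natDegree ≤ w z ∧ (deform ι Q w pt (X z)).coeff (w z) =
      Polynomial.C (ι (X z)) * Polynomial.X ^ (if z ∈ Q then 1 else 0) := by
    intro z
    simp only [deform, coe_eval₂Hom, eval₂_X]
    by_cases hz : z ∈ Q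
    · have hd := h.degree_lt z hz
      simp only [hz, if_true]
      constructor
      · refine Polynomial.natDegree_add_le_of_degree_le ?_ ?_
        · exact (Polynomial.natDegree_map_le).trans (Polynomial.natDegree_le_of_degree_le hd.le)
        · exact Polynomial.natDegree_C_mul_X_pow_le _ _
      · rw [Polynomial.coeff_add, Polynomial.coeff_map, Polynomial.coeff_eq_zero_of_degree_lt hd,
          Polynomial.coeff_C_mul_X_pow]
        simp
    · rw [h.eq_of_notMem z hz]
      simp only [hz, if_false, add_zero, Polynomial.map_mul, Polynomial.map_C, Polynomial.map_pow,
        Polynomial.map_X]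
      exact ⟨Polynomial.natDegree_C_mul_X_pow_le _ _, by simp⟩
  have hpow : ∀ (z : σ) (b : ℕ), (deform ι Q w pt (X z ^ b)).natDegree ≤ b * w z ∧
      (deform ι Q w pt (X z ^ b)).coeff (b * w z) = Polynomial.C (ι (X z ^ b)) *
        Polynomial.X ^ (b * if z ∈ Q then 1 else 0) := by
    intro z b
    rw [map_pow]
    refine ⟨Polynomial.natDegree_pow_le_of_le b (hX z).1, ?_⟩
    rw [Polynomial.coeff_pow_of_natDegree_le (hX z).1, (hX z).2, mul_pow, ← pow_mul,
      map_pow, map_pow, mul_comm b]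
  induction n using Finsupp.induction_linear generalizing a with
  | zero =>
    have : (monomial 0 a : MvPolynomial σ k) = C a := rfl
    rw [this]
    simp [deform]
  | add f g hf hg =>
    have : (monomial (f + g) a : MvPolynomial σ k) = monomial f a * monomial g 1 := by
      rw [monomial_mul, mul_one]
    rw [this, map_mul, map_add, map_add, map_mul]
    refine ⟨(Polynomial.natDegree_mul_le).trans (add_le_add (hf a).1 (hg 1).1), ?_⟩
    rw [Polynomial.coeff_mul_add_eq_of_natDegree_le (hf a).1 (hg 1).1, (hf a).2, (hg 1).2, pow_add,
      map_mul]
    ring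
  | single z b =>
    have : (monomial (Finsupp.single z b) a : MvPolynomial σ k) = C a * X z ^ b := by
      rw [C_mul_X_pow_eq_monomial]
    have hCa : deform ι Q w pt (C a) = Polynomial.C (Polynomial.C (ι (C a))) := by
      simp [deform]
    rw [this, map_mul, hCa, Finsupp.weight_single, Finsupp.weight_single, smul_eq_mul, smul_eq_mul]
    refine ⟨(Polynomial.natDegree_C_mul_le _ _).trans (hpow z b).1, ?_⟩
    rw [Polynomial.coeff_C_mul, (hpow z b).2, map_mul, Polynomial.C_mul, mul_assoc]

/-- Divisibility of a deformed polynomial bounds the `Q`-degree of its monomials of top weight. -/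
lemma le_weight_of_dvd (h : IsInitialPoint ι Q w pt) {t N : ℕ} {f : MvPolynomial σ k}
    (hf : ∀ n ∈ f.support, Finsupp.weight w n ≤ N)
    (hdvd : Polynomial.C Polynomial.X ^ t ∣ deform ι Q w pt f) {n : σ →₀ ℕ} (hn : n ∈ f.support)
    (hnN : Finsupp.weight w n = N) :
    t ≤ Finsupp.weight (fun z => if z ∈ Q then 1 else 0) n := by
  classical
  set χ := fun z => if z ∈ Q then 1 else 0
  by_contra! hlt
  rw [← Polynomial.C_pow, Polynomial.C_dvd_iff_dvd_coeff] at hdvd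
  have h1 := Polynomial.X_pow_dvd_iff.1 (hdvd N) _ hlt
  have h2 : ((deform ι Q w pt f).coeff N).coeff (Finsupp.weight χ n) =
      ι (∑ m ∈ f.support with Finsupp.weight w m = N ∧
        Finsupp.weight χ m = Finsupp.weight χ n, monomial m (f.coeff m)) := by
    conv_lhs => rw [f.as_sum]
    rw [map_sum, Polynomial.finsetSum_coeff, Polynomial.finsetSum_coeff, map_sum, Finset.sum_filter]
    refine Finset.sum_congr rfl fun m hm => ?_
    obtain ⟨hm1, hm2⟩ := deform_monomial h m (f.coeff m)
    by_cases hmN : Finsupp.weight w m = N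
    · rw [← hmN, hm2, Polynomial.coeff_C_mul_X_pow]
      simp only [true_and, eq_comm, χ]
    · rw [Polynomial.coeff_eq_zero_of_natDegree_lt
        (hm1.trans_lt (lt_of_le_of_ne (hf m hm) hmN))]
      simp [hmN]
  rw [h1, eq_comm, map_eq_zero_iff _ h.injective] at h2
  have h3 := congrArg (coeff n) h2
  rw [coeff_sum, Finset.sum_eq_single n] at h3
  · simp only [coeff_monomial, if_true, coeff_zero] at h3
    exact (mem_support_iff.1 hn) h3
  · intro m _ hmn
    rw [coeff_monomial, if_neg hmn]
  · intro hn'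
    exact absurd (Finset.mem_filter.2 ⟨hn, hnN, rfl⟩) hn'

lemma pow_dvd_of_mem_pow {R R' : Type*} [CommRing R] [CommRing R'] {φ : R →+* R'} {c : R'}
    {I : Ideal R} (hI : ∀ g ∈ I, c ∣ φ g) {t : ℕ} {g : R} (hg : g ∈ I ^ t) : c ^ t ∣ φ g := by
  have hle : I ≤ (Ideal.span {c}).comap φ := fun g hg =>
    Ideal.mem_comap.2 (Ideal.mem_span_singleton.2 (hI g hg))
  have hmem := Ideal.mem_comap.1 (Ideal.le_comap_pow _ t (Ideal.pow_right_mono hle t hg))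
  rw [Ideal.span_singleton_pow] at hmem
  exact Ideal.mem_span_singleton.1 hmem

/-- If the kernel of evaluation at an initial point is a minimal prime of `I`, then the monomials of
top weight in elements of the symbolic powers of `I` have large `Q`-degree. -/
lemma le_weight_of_mem_symbolicPower (h : IsInitialPoint ι Q w pt) {I : Ideal (MvPolynomial σ k)}
    (hI : RingHom.ker (evalAt ι pt) ∈ I.minimalPrimes) {t N : ℕ} {f : MvPolynomial σ k}
    (hfI : f ∈ symbolicPower I t) (hf : ∀ n ∈ f.support, Finsupp.weight w n ≤ N)
    {n : σ →₀ ℕ} (hn : n ∈ f.support) (hnN : Finsupp.weight w n = N) :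
    t ≤ Finsupp.weight (fun z => if z ∈ Q then 1 else 0) n := by
  have hprime : (RingHom.ker (evalAt ι pt)).IsPrime := hI.1.1
  simp only [symbolicPower, Ideal.mem_iInf] at hfI
  have h1 := hfI _ hI
  rw [Ideal.mem_comap, IsLocalization.mem_map_algebraMap_iff
    (RingHom.ker (evalAt ι pt)).primeCompl] at h1
  obtain ⟨⟨⟨a, ha⟩, ⟨s, hs⟩⟩, has⟩ := h1
  rw [← map_mul] at has
  have hinj : Function.Injective (algebraMap (MvPolynomial σ k)
      (Localization.AtPrime (RingHom.ker (evalAt ι pt)))) :=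
    IsLocalization.injective _ (Ideal.primeCompl_le_nonZeroDivisors (RingHom.ker (evalAt ι pt)))
  replace has : f * s = a := hinj has
  have hJ : ∀ g ∈ I ^ t, Polynomial.C Polynomial.X ^ t ∣ deform ι Q w pt g := by
    intro g hg
    exact pow_dvd_of_mem_pow (fun g hg => (dvd_deform_iff g).2 (hI.1.2 hg)) hg
  have hprimeX : Prime (Polynomial.C Polynomial.X :
      Polynomial (Polynomial K)) :=
    Polynomial.prime_C_iff.2 Polynomial.prime_X
  have h2 := hJ _ (has ▸ ha)
  rw [map_mul] at h2
  exact le_weight_of_dvd h hf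
    (hprimeX.pow_dvd_of_dvd_mul_right t (fun h3 => hs ((dvd_deform_iff s).1 h3)) h2) hn hnN

end Degeneration

section Threshold

variable {k K V : Type} [Field k] [Field K] [LinearOrder V]

/-- The binomial attached to the pair `i, j`. -/
noncomputable def minor (k : Type) [Field k] {V : Type} (i j : V) : MvPolynomial (V ⊕ V) k :=
  X (Sum.inl i) * X (Sum.inr j) - X (Sum.inl j) * X (Sum.inr i)

lemma minor_mem {V : Type} {G : SimpleGraph V} {i j : V} (h : G.Adj i j) :
    minor k i j ∈ binomialEdgeIdeal k G :=
  Ideal.subset_span ⟨i, j, h, rfl⟩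

/-- The number of vertices preceding `i`. -/
def position [Fintype V] (i : V) : ℕ := (Finset.univ.filter (· < i)).card

lemma position_lt [Fintype V] {i j : V} (h : i < j) : position i < position j :=
  Finset.card_lt_card <| Finset.ssubset_iff_of_subset
    (fun a ha => by
      simp only [Finset.mem_filter, Finset.mem_univ, true_and] at ha ⊢
      exact ha.trans h) |>.2 ⟨i, by simpa using h, by simp⟩

lemma position_le_card [Fintype V] (i : V) : position i ≤ Fintype.card V :=
  Finset.card_le_univ _

/-- The weight vector selecting the leading monomials. -/
def varWeight (V : Type) [LinearOrder V] [Fintype V] : V ⊕ V → ℕ :=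
  Sum.elim (fun _ => Fintype.card V) (fun i => Fintype.card V + position i)

/-- The generic point of the component of the binomial edge ideal attached to threshold data,
scaled so as to degenerate to the monomial prime generated by `thresholdVars S th`. -/
noncomputable def thresholdPoint [Fintype V] (ι : MvPolynomial (V ⊕ V) k →+* K) (S : Finset V)
    (th : V → V) : V ⊕ V → Polynomial K :=
  Sum.elim
    (fun i => if i ∈ S then 0 else if i < th i then
      Polynomial.C (ι (X (Sum.inr i)) * ι (X (Sum.inl (th i))) / ι (X (Sum.inr (th i)))) *
        Polynomial.X ^ (Fintype.card V + position i - position (th i))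
      else Polynomial.C (ι (X (Sum.inl i))) * Polynomial.X ^ Fintype.card V)
    (fun i => if i ∈ S then 0 else if th i < i then
      Polynomial.C (ι (X (Sum.inl i)) * ι (X (Sum.inr (th i))) / ι (X (Sum.inl (th i)))) *
        Polynomial.X ^ (Fintype.card V + position (th i))
      else Polynomial.C (ι (X (Sum.inr i))) * Polynomial.X ^ (Fintype.card V + position i))

variable [Fintype V] {ι : MvPolynomial (V ⊕ V) k →+* K} {S : Finset V} {th : V → V}
  {G : SimpleGraph V}

lemma isInitialPoint_thresholdPoint (hι : Function.Injective ι) (S : Finset V) (th : V → V) :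
    IsInitialPoint ι (thresholdVars S th) (varWeight V) (thresholdPoint ι S th) where
  injective := hι
  eq_of_notMem := by
    rintro (i | i) hi
    · rw [inl_mem_thresholdVars, not_or] at hi
      simp [thresholdPoint, varWeight, hi.1, hi.2]
    · rw [inr_mem_thresholdVars, not_or] at hi
      simp [thresholdPoint, varWeight, hi.1, hi.2]
  degree_lt := by
    rintro (i | i) hi
    · by_cases hS : i ∈ S
      · simp [thresholdPoint, hS]
      · have hlt := (inl_mem_thresholdVars.1 hi).resolve_left hS
        have := position_lt hlt
        have := position_le_card (th i)
        simp only [thresholdPoint, varWeight, Sum.elim_inl, if_neg hS, if_pos hlt]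
        refine (Polynomial.degree_C_mul_X_pow_le _ _).trans_lt (Nat.cast_lt.2 ?_)
        omega
    · by_cases hS : i ∈ S
      · simp [thresholdPoint, hS]
      · have hlt := (inr_mem_thresholdVars.1 hi).resolve_left hS
        have := position_lt hlt
        simp only [thresholdPoint, varWeight, Sum.elim_inr, if_neg hS, if_pos hlt]
        refine (Polynomial.degree_C_mul_X_pow_le _ _).trans_lt (Nat.cast_lt.2 ?_)
        omega

lemma thresholdPoint_mul (hι : Function.Injective ι) {i : V} (hi : i ∉ S) :
    thresholdPoint ι S th (Sum.inl i) *
        (Polynomial.C (ι (X (Sum.inr (th i)))) * Polynomial.X ^ position (th i)) =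
      thresholdPoint ι S th (Sum.inr i) * Polynomial.C (ι (X (Sum.inl (th i)))) := by
  have h0 : ∀ z, ι (X z) ≠ 0 := fun z =>
    (map_ne_zero_iff _ hι).2 (X_ne_zero z)
  simp only [thresholdPoint, Sum.elim_inl, Sum.elim_inr, if_neg hi]
  rcases lt_trichotomy i (th i) with h | h | h
  · rw [if_pos h, if_neg h.not_gt]
    have h1 : Fintype.card V + position i =
        Fintype.card V + position i - position (th i) + position (th i) := by
      have := position_le_card (th i)
      omega
    rw [h1, Nat.add_sub_cancel, pow_add, mul_mul_mul_comm, ← Polynomial.C_mul,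
      div_mul_cancel₀ _ (h0 _), Polynomial.C_mul]
    ring
  · rw [if_neg h.not_lt, if_neg h.not_gt, ← h, pow_add]
    ring
  · rw [if_pos h, if_neg h.not_gt, mul_right_comm (Polynomial.C (_ / _)) (Polynomial.X ^ _),
      ← Polynomial.C_mul, div_mul_cancel₀ _ (h0 _), Polynomial.C_mul, pow_add]
    ring

lemma minor_mem_ker (hι : Function.Injective ι) {i j : V} (hi : i ∉ S) (hj : j ∉ S)
    (hij : th i = th j) : minor k i j ∈ RingHom.ker (evalAt ι (thresholdPoint ι S th)) := by
  have h1 := thresholdPoint_mul (th := th) hι hi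
  have h2 := thresholdPoint_mul (th := th) hι hj
  rw [← hij] at h2
  have hu : Polynomial.C (ι (X (Sum.inr (th i)))) * Polynomial.X ^ position (th i) ≠ 0 :=
    mul_ne_zero (Polynomial.C_ne_zero.2 ((map_ne_zero_iff _ hι).2 (X_ne_zero _)))
      (pow_ne_zero _ Polynomial.X_ne_zero)
  rw [RingHom.mem_ker, minor, map_sub, map_mul, map_mul, evalAt_X, evalAt_X, evalAt_X, evalAt_X]
  refine (mul_eq_zero.1 ?_).resolve_right hu
  linear_combination thresholdPoint ι S th (Sum.inr j) * h1 -
    thresholdPoint ι S th (Sum.inr i) * h2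

lemma le_ker_thresholdPoint (hι : Function.Injective ι) (h : IsThreshold G S th) :
    binomialEdgeIdeal k G ≤ RingHom.ker (evalAt ι (thresholdPoint ι S th)) := by
  refine Ideal.span_le.2 ?_
  rintro f ⟨i, j, hij, rfl⟩
  by_cases hi : i ∈ S
  · simp [RingHom.mem_ker, evalAt_X, thresholdPoint, hi]
  by_cases hj : j ∈ S
  · simp [RingHom.mem_ker, evalAt_X, thresholdPoint, hj]
  exact minor_mem_ker hι hi hj (h.adj i j hij hi hj)

lemma minor_mem_trans {V : Type} {p : Ideal (MvPolynomial (V ⊕ V) k)} (hp : p.IsPrime) {i j l : V}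
    (hj : X (Sum.inl j) ∉ p ∨ X (Sum.inr j) ∉ p) (hij : minor k i j ∈ p) (hjl : minor k j l ∈ p) :
    minor k i l ∈ p := by
  rcases hj with hj | hj
  · refine (hp.mem_or_mem ?_).resolve_left hj
    have := p.add_mem (p.mul_mem_left (X (Sum.inl i)) hjl) (p.mul_mem_left (X (Sum.inl l)) hij)
    convert! this using 1
    simp only [minor]
    ring
  · refine (hp.mem_or_mem ?_).resolve_left hj
    have := p.add_mem (p.mul_mem_left (X (Sum.inr i)) hjl) (p.mul_mem_left (X (Sum.inr l)) hij)
    convert! this using 1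
    simp only [minor]
    ring

lemma X_notMem_ker_or (hι : Function.Injective ι) {j : V} (hj : j ∉ S) :
    X (Sum.inl j) ∉ RingHom.ker (evalAt ι (thresholdPoint ι S th)) ∨
      X (Sum.inr j) ∉ RingHom.ker (evalAt ι (thresholdPoint ι S th)) := by
  have hpt := isInitialPoint_thresholdPoint hι S th
  rcases le_or_gt (th j) j with h | h
  · exact Or.inl (X_notMem_ker hpt (by simp [hj, h]))
  · exact Or.inr (X_notMem_ker hpt (by simp [hj, h.le]))

/-- Primes between the binomial edge ideal and the kernel contain the binomials of all pairs in a
common component. -/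
lemma minor_threshold_mem (hι : Function.Injective ι) (h : IsThreshold G S th)
    {p : Ideal (MvPolynomial (V ⊕ V) k)} (hp : p.IsPrime) (hJp : binomialEdgeIdeal k G ≤ p)
    (hpq : p ≤ RingHom.ker (evalAt ι (thresholdPoint ι S th))) {i : V} (hi : i ∉ S) :
    minor k i (th i) ∈ p := by
  suffices key : ∀ l, Relation.ReflTransGen (fun a b => G.Adj a b ∧ a ∉ S ∧ b ∉ S) i l →
      minor k i l ∈ p from key _ (h.reach i hi)
  intro l hl
  induction hl with
  | refl => simp [minor]
  | tail _ hjl ih =>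
    exact minor_mem_trans hp ((X_notMem_ker_or hι hjl.2.1).imp (mt (@hpq _)) (mt (@hpq _))) ih
      (hJp (minor_mem hjl.1))

lemma X_threshold_mem_supported {V : Type} [LinearOrder V] {S : Finset V} {th : V → V}
    {G : SimpleGraph V} (h : IsThreshold G S th) {i : V} (hi : i ∉ S) :
    (X (Sum.inl (th i)) : MvPolynomial (V ⊕ V) k) ∈ supported k (thresholdVars S th)ᶜ ∧
    (X (Sum.inr (th i)) : MvPolynomial (V ⊕ V) k) ∈ supported k (thresholdVars S th)ᶜ :=
  ⟨Algebra.subset_adjoin ⟨_, by simp [h.notMem i hi, h.idem i hi], rfl⟩,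
    Algebra.subset_adjoin ⟨_, by simp [h.notMem i hi, h.idem i hi], rfl⟩⟩

lemma minor_ne_zero {V : Type} {i j : V} (hij : i ≠ j) : minor k i j ≠ 0 := by
  classical
  intro h
  have := congrArg (MvPolynomial.eval (Sum.elim (fun a => if a = i then (1 : k) else 0)
    (fun a => if a = j then 1 else 0))) h
  simp [minor, hij.symm] at this

lemma minor_notMem_ker (hι : Function.Injective ι) (h : IsThreshold G S th) {a b : V}
    (ha : a ∉ S) (hb : b ∉ S) (hab : th a ≠ th b) :
    minor k a b ∉ RingHom.ker (evalAt ι (thresholdPoint ι S th)) := by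
  have hpt := isInitialPoint_thresholdPoint hι S th
  intro hker
  have hq : (RingHom.ker (evalAt ι (thresholdPoint ι S th))).IsPrime := RingHom.ker_isPrime _
  have h1 := minor_mem_trans hq (X_notMem_ker_or hι ha)
    (minor_mem_ker (k := k) hι (h.notMem a ha) ha (h.idem a ha)) hker
  have h2 := minor_mem_trans hq (X_notMem_ker_or hι hb) h1 (minor_mem_ker (k := k) hι hb
    (h.notMem b hb) (h.idem b hb).symm)
  obtain ⟨hxa, hya⟩ := X_threshold_mem_supported (k := k) h ha
  obtain ⟨hxb, hyb⟩ := X_threshold_mem_supported (k := k) h hb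
  exact minor_ne_zero hab (eq_zero_of_evalAt_eq_zero hpt
    (sub_mem (mul_mem hxa hyb) (mul_mem hxb hya)) h2)

/-- The kernel is a minimal prime when every removed vertex separates two components. -/
lemma ker_mem_minimalPrimes (hι : Function.Injective ι) (h : IsThreshold G S th)
    (hgood : ∀ c ∈ S, ∃ a b, G.Adj c a ∧ G.Adj c b ∧ a ∉ S ∧ b ∉ S ∧ th a ≠ th b) :
    RingHom.ker (evalAt ι (thresholdPoint ι S th)) ∈ (binomialEdgeIdeal k G).minimalPrimes := by
  have hpt := isInitialPoint_thresholdPoint hι S th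
  refine ⟨⟨RingHom.ker_isPrime _, le_ker_thresholdPoint hι h⟩, ?_⟩
  rintro p ⟨hp, hJp⟩ hpq
  have hS : ∀ c ∈ S, X (Sum.inl c) ∈ p ∧ X (Sum.inr c) ∈ p := by
    intro c hc
    obtain ⟨a, b, hca, hcb, ha, hb, hab⟩ := hgood c hc
    have hnot : minor k a b ∉ p := fun hh => minor_notMem_ker hι h ha hb hab (hpq hh)
    have hca' : minor k c a ∈ p := hJp (minor_mem hca)
    have hcb' : minor k c b ∈ p := hJp (minor_mem hcb)
    constructor
    · refine (hp.mem_or_mem ?_).resolve_right hnot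
      have := p.sub_mem (p.mul_mem_left (X (Sum.inl a)) hcb')
        (p.mul_mem_left (X (Sum.inl b)) hca')
      convert! this using 1
      simp only [minor]
      ring
    · refine (hp.mem_or_mem ?_).resolve_right hnot
      have := p.sub_mem (p.mul_mem_left (X (Sum.inr a)) hcb')
        (p.mul_mem_left (X (Sum.inr b)) hca')
      convert! this using 1
      simp only [minor]
      ring
  refine ker_evalAt_le hpt hp hpq ?_
  rintro (i | i) hi
  · by_cases hiS : i ∈ S
    · exact ⟨1, one_mem _, 0, zero_mem _, one_ne_zero, by simpa using (hS i hiS).1⟩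
    · have hlt := (inl_mem_thresholdVars.1 hi).resolve_left hiS
      obtain ⟨h1, h2⟩ := X_threshold_mem_supported (k := k) h hiS
      refine ⟨_, h2, _, mul_mem h1 (Algebra.subset_adjoin ⟨Sum.inr i, ?_, rfl⟩), X_ne_zero _, ?_⟩
      · simp [hiS, hlt.le]
      · have := minor_threshold_mem hι h hp hJp hpq hiS
        rwa [minor, mul_comm (X (Sum.inl i))] at this
  · by_cases hiS : i ∈ S
    · exact ⟨1, one_mem _, 0, zero_mem _, one_ne_zero, by simpa using (hS i hiS).2⟩
    · have hlt := (inr_mem_thresholdVars.1 hi).resolve_left hiS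
      obtain ⟨h1, h2⟩ := X_threshold_mem_supported (k := k) h hiS
      refine ⟨_, h1, _, mul_mem (Algebra.subset_adjoin ⟨Sum.inl i, ?_, rfl⟩) h2, X_ne_zero _, ?_⟩
      · simp [hiS, hlt.le]
      · have := p.neg_mem (minor_threshold_mem hι h hp hJp hpq hiS)
        rwa [minor, neg_sub] at this

/-- The monomials of top weight in elements of the `t`-th symbolic power have degree at least `t` in
the variables of each threshold datum. -/
lemma IsThreshold.le_sum {S : Finset V} {th : V → V} (h : IsThreshold G S th)
    {Q : Finset (V ⊕ V)} (hQ : thresholdVars S th ⊆ Q) {t N : ℕ} {f : MvPolynomial (V ⊕ V) k}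
    (hfI : f ∈ symbolicPower (binomialEdgeIdeal k G) t)
    (hf : ∀ n ∈ f.support, Finsupp.weight (varWeight V) n ≤ N)
    {n : V ⊕ V →₀ ℕ} (hn : n ∈ f.support) (hnN : Finsupp.weight (varWeight V) n = N) :
    t ≤ ∑ z ∈ Q, n z := by
  classical
  induction S using Finset.strongInduction generalizing th with
  | H S ih =>
    by_cases hgood : ∀ c ∈ S, ∃ a b, G.Adj c a ∧ G.Adj c b ∧ a ∉ S ∧ b ∉ S ∧ th a ≠ th b
    · have hι : Function.Injective (algebraMap (MvPolynomial (V ⊕ V) k)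
          (FractionRing (MvPolynomial (V ⊕ V) k))) := IsFractionRing.injective _ _
      refine (le_weight_of_mem_symbolicPower (isInitialPoint_thresholdPoint hι S th)
        (ker_mem_minimalPrimes hι h hgood) hfI hf hn hnN).trans ?_
      rw [Finsupp.weight_apply, Finsupp.sum_fintype _ _ (by simp)]
      simp only [smul_eq_mul, mul_ite, mul_one, mul_zero]
      rw [← Finset.sum_filter]
      exact Finset.sum_le_sum_of_subset fun z hz => hQ (Finset.mem_filter.1 hz).2
    · push Not at hgood
      obtain ⟨c, hc, hbad⟩ := hgood
      obtain ⟨th', h', hsub⟩ := h.exists_smaller hc hbad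
      exact ih _ (Finset.erase_ssubset hc) h' (hsub.trans hQ)

end Threshold

section Lifting

variable {k V : Type} [Field k] [LinearOrder V] [Fintype V] {C : Set V} {G : SimpleGraph V}

/-- `f` is the monomial with exponent `n` plus terms of smaller weight. -/
def HasLead (f : MvPolynomial (V ⊕ V) k) (n : V ⊕ V →₀ ℕ) : Prop :=
  ∀ m ∈ (f - monomial n 1).support, Finsupp.weight (varWeight V) m < Finsupp.weight (varWeight V) n

lemma hasLead_monomial (n : V ⊕ V →₀ ℕ) : HasLead (monomial n (1 : k)) n := by
  simp [HasLead]

lemma HasLead.weight_le {f : MvPolynomial (V ⊕ V) k} {n : V ⊕ V →₀ ℕ} (hf : HasLead f n)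
    {m : V ⊕ V →₀ ℕ} (hm : m ∈ f.support) :
    Finsupp.weight (varWeight V) m ≤ Finsupp.weight (varWeight V) n := by
  classical
  by_cases h : m = n
  · rw [h]
  · refine (hf m ?_).le
    rw [mem_support_iff] at hm ⊢
    rwa [coeff_sub, coeff_monomial, if_neg (Ne.symm h), sub_zero]

lemma HasLead.mul {f g : MvPolynomial (V ⊕ V) k} {n m : V ⊕ V →₀ ℕ} (hf : HasLead f n)
    (hg : HasLead g m) : HasLead (f * g) (n + m) := by
  classical
  intro l hl
  have : f * g - monomial (n + m) 1 =
      (f - monomial n 1) * g + monomial n 1 * (g - monomial m 1) := by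
    have : (monomial (n + m) 1 : MvPolynomial (V ⊕ V) k) = monomial n 1 * monomial m 1 := by
      rw [monomial_mul, one_mul]
    rw [this]
    ring
  rw [this] at hl
  rw [map_add]
  rcases Finset.mem_union.1 (support_add hl) with h | h
  · obtain ⟨a, ha, b, hb, rfl⟩ := Finset.mem_add.1 (support_mul _ _ h)
    rw [map_add]
    exact add_lt_add_of_lt_of_le (hf a ha) (hg.weight_le hb)
  · obtain ⟨a, ha, b, hb, rfl⟩ := Finset.mem_add.1 (support_mul _ _ h)
    obtain rfl := Finset.mem_singleton.1 (support_monomial_subset ha)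
    rw [map_add]
    exact add_lt_add_of_le_of_lt le_rfl (hg b hb)

lemma hasLead_minor {a b : V} (hab : a < b) :
    HasLead (minor k a b) (Finsupp.single (Sum.inl a) 1 + Finsupp.single (Sum.inr b) 1) := by
  classical
  intro m hm
  have h : minor k a b - monomial (Finsupp.single (Sum.inl a) 1 + Finsupp.single (Sum.inr b) 1) 1 =
      - monomial (Finsupp.single (Sum.inl b) 1 + Finsupp.single (Sum.inr a) 1) 1 := by
    simp [minor, X, monomial_mul]
  rw [h, support_neg] at hm
  obtain rfl := Finset.mem_singleton.1 (support_monomial_subset hm)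
  have := position_lt hab
  simp only [map_add, Finsupp.weight_single, varWeight, Sum.elim_inl, Sum.elim_inr, smul_eq_mul]
  omega

lemma LeadExponent.exists_mem (hG : IsParentGraph C G) {g : V ⊕ V →₀ ℕ} (hg : LeadExponent C g) :
    ∃ f ∈ binomialEdgeIdeal k G, HasLead f g := by
  cases hg with
  | edge h => exact ⟨_, minor_mem ((hG _ _ h.2.1).2 h), hasLead_minor h.2.1⟩
  | @cherry c a b ha hb hab =>
    refine ⟨X (Sum.inr c) * minor k a b, ?_, ?_⟩
    · have := Ideal.sub_mem _
        (Ideal.mul_mem_left _ (X (Sum.inr a)) (minor_mem (k := k) ((hG _ _ hb.2.1).2 hb)))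
        (Ideal.mul_mem_left _ (X (Sum.inr b)) (minor_mem (k := k) ((hG _ _ ha.2.1).2 ha)))
      convert! this using 1
      simp only [minor]
      ring
    · rw [add_assoc]
      exact (hasLead_monomial _).mul (hasLead_minor hab)

lemma Packs.exists_mem (hG : IsParentGraph C G) {v : ℕ} {m : V ⊕ V →₀ ℕ} (hm : Packs C v m) :
    ∃ f ∈ binomialEdgeIdeal k G ^ v, HasLead f m := by
  induction hm with
  | zero => exact ⟨1, by simp, hasLead_monomial 0⟩
  | add _ hg ih =>
    obtain ⟨f, hf, hfm⟩ := ih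
    obtain ⟨f', hf', hfg⟩ := hg.exists_mem (k := k) hG
    exact ⟨f * f', by rw [pow_succ]; exact Ideal.mul_mem_mul hf hf', hfm.mul hfg⟩

lemma pow_le_symbolicPower {R : Type*} [CommRing R] (I : Ideal R) (t : ℕ) :
    I ^ t ≤ symbolicPower I t := by
  simp only [symbolicPower, le_iInf_iff]
  exact fun _ _ => Ideal.le_comap_map

/-- If the edges of `G` join the vertices to their parents, the ordinary and symbolic powers of its
binomial edge ideal coincide. -/
theorem pow_eq_symbolicPower (hC : ∀ b, (∀ a, b ≤ a) → b ∈ C) (hG : IsParentGraph C G) (t : ℕ) :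
    binomialEdgeIdeal k G ^ t = symbolicPower (binomialEdgeIdeal k G) t := by
  classical
  refine le_antisymm (pow_le_symbolicPower _ _) ?_
  suffices main : ∀ (N : ℕ) (f : MvPolynomial (V ⊕ V) k),
      f ∈ symbolicPower (binomialEdgeIdeal k G) t →
      (∀ n ∈ f.support, Finsupp.weight (varWeight V) n < N) → f ∈ binomialEdgeIdeal k G ^ t from
    fun f hf => main (f.support.sup (Finsupp.weight (varWeight V)) + 1) f hf
      fun n hn => Nat.lt_succ_of_le (Finset.le_sup hn)
  intro N
  induction N with
  | zero =>
    intro f _ hf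
    have : f = 0 := support_eq_empty.1 (Finset.eq_empty_of_forall_notMem fun n hn => by
      simpa using hf n hn)
    rw [this]
    exact zero_mem _
  | succ N ih =>
    intro f hfI hf
    have hf' : ∀ n ∈ f.support, Finsupp.weight (varWeight V) n ≤ N :=
      fun n hn => Nat.le_of_lt_succ (hf n hn)
    have hlift : ∀ n, n ∈ f.support → Finsupp.weight (varWeight V) n = N →
        ∃ g ∈ binomialEdgeIdeal k G ^ t, HasLead g n := by
      intro n hn hnN
      obtain ⟨v, m, r, htv, hm, rfl⟩ := exists_packs_of_hits hC n t fun Q hQ => by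
        obtain ⟨S, th, hS, hSQ⟩ := exists_threshold_of_hits hG hQ
        exact hS.le_sum hSQ hfI hf' hn hnN
      obtain ⟨g, hg, hgm⟩ := hm.exists_mem (k := k) hG
      exact ⟨g * monomial r 1, Ideal.mul_mem_right _ _ (Ideal.pow_le_pow_right htv hg),
        hgm.mul (hasLead_monomial r)⟩
    choose! g hg hlead using hlift
    set top := f.support.filter fun n => Finsupp.weight (varWeight V) n = N
    set s := ∑ n ∈ top, MvPolynomial.C (f.coeff n) * g n
    have hmem : ∀ n ∈ top, n ∈ f.support ∧ Finsupp.weight (varWeight V) n = N :=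
      fun n hn => Finset.mem_filter.1 hn
    have hs : s ∈ binomialEdgeIdeal k G ^ t := Ideal.sum_mem _ fun n hn =>
      Ideal.mul_mem_left _ _ (hg n (hmem n hn).1 (hmem n hn).2)
    have hfs : f - s ∈ binomialEdgeIdeal k G ^ t := by
      refine ih _ (Ideal.sub_mem _ hfI (pow_le_symbolicPower _ _ hs)) ?_
      have hsplit : f - s = ∑ n ∈ f.support.filter (fun n => ¬ Finsupp.weight (varWeight V) n = N),
          monomial n (f.coeff n) -
            ∑ n ∈ top, MvPolynomial.C (f.coeff n) * (g n - monomial n 1) := by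
        conv_lhs => rw [f.as_sum]
        rw [← Finset.sum_filter_add_sum_filter_not f.support
          (fun n => Finsupp.weight (varWeight V) n = N)]
        simp only [mul_sub, Finset.sum_sub_distrib, C_mul_monomial, mul_one, s]
        ring
      intro m hm
      rw [hsplit] at hm
      rcases Finset.mem_union.1 (support_sub _ _ _ hm) with hm | hm
      · obtain ⟨n, hn, hmn⟩ := Finset.mem_biUnion.1 (support_sum hm)
        obtain rfl := Finset.mem_singleton.1 (support_monomial_subset hmn)
        obtain ⟨hn1, hn2⟩ := Finset.mem_filter.1 hn
        exact lt_of_le_of_ne (hf' m hn1) hn2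
      · obtain ⟨n, hn, hmn⟩ := Finset.mem_biUnion.1 (support_sum hm)
        obtain ⟨hn1, hn2⟩ := hmem n hn
        have : m ∈ (g n - monomial n 1).support := by
          rw [mem_support_iff, coeff_C_mul] at hmn
          exact mem_support_iff.2 (right_ne_zero_of_mul hmn)
        exact (hlead n hn1 hn2 m this).trans_eq hn2
    simpa using Ideal.add_mem _ hfs hs

end Lifting

section Ordering

/-- The vertices of a caterpillar tree can be ordered so that its edges join them to their
parents. -/
theorem exists_isParentGraph {V : Type} [Fintype V] {G : SimpleGraph V} (hG : IsCaterpillar G) :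
    ∃ (_ : LinearOrder V) (C : Set V), (∀ b, (∀ a, b ≤ a) → b ∈ C) ∧ IsParentGraph C G := by
  classical
  obtain ⟨hT, u, v, p, hp, hcover⟩ := hG
  have hfoot : ∀ w, ∃ i ≤ p.length,
      (w ∈ p.support → p.getVert i = w) ∧ (w ∉ p.support → G.Adj (p.getVert i) w) := by
    intro w
    by_cases hw : w ∈ p.support
    · obtain ⟨i, hi, hil⟩ := SimpleGraph.Walk.mem_support_iff_exists_getVert.1 hw
      exact ⟨i, hil, fun _ => hi, fun h => absurd hw h⟩
    · obtain ⟨z, hz, hwz⟩ := (hcover w).resolve_left hw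
      obtain ⟨i, rfl, hil⟩ := SimpleGraph.Walk.mem_support_iff_exists_getVert.1 hz
      exact ⟨i, hil, fun h => absurd h hw, fun _ => hwz.symm⟩
  choose idx hidx hmem hnot using hfoot
  have hidx_getVert : ∀ i ≤ p.length, idx (p.getVert i) = i := fun i hi =>
    hp.getVert_injOn (hidx _) hi (hmem _ (p.getVert_mem_support i))
  let tag : V → ℕ := fun w => if w ∈ p.support then 0 else Fintype.equivFin V w + 1
  have htag : ∀ w ∈ p.support, tag w = 0 := fun w hw => if_pos hw
  have htag' : ∀ w ∉ p.support, tag w = Fintype.equivFin V w + 1 := fun w hw => if_neg hw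
  let key : V → ℕ ×ₗ ℕ := fun w => toLex (idx w, tag w)
  have hkey : Function.Injective key := by
    intro a b hab
    obtain ⟨h1, h2⟩ := Prod.mk.inj (toLex.injective hab)
    by_cases ha : a ∈ p.support <;> by_cases hb : b ∈ p.support
    · rw [← hmem a ha, ← hmem b hb, h1]
    · rw [htag a ha, htag' b hb] at h2
      omega
    · rw [htag' a ha, htag b hb] at h2
      omega
    · rw [htag' a ha, htag' b hb] at h2
      exact (Fintype.equivFin V).injective (Fin.ext (by omega))
  let _ : LinearOrder V := LinearOrder.lift' key hkey
  have hlt : ∀ a b : V, a < b ↔ idx a < idx b ∨ idx a = idx b ∧ tag a < tag b :=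
    fun a b => Prod.Lex.toLex_lt_toLex
  have hle : ∀ a b : V, a ≤ b → idx a ≤ idx b := fun a b h => by
    rcases h.lt_or_eq with h | rfl
    · rcases (hlt a b).1 h with h | h
      · exact h.le
      · exact h.1.le
    · exact le_rfl
  let C : Set V := {w | w ∈ p.support}
  have hu : ∀ b, u ≤ b := by
    intro b
    by_contra! h
    have h0 : idx u = 0 := by simpa using hidx_getVert 0 (Nat.zero_le _)
    have := (hlt b u).1 h
    rw [h0, htag u p.start_mem_support] at this
    omega
  have hparent : ∀ c b, IsParent C c b → G.Adj c b := by
    rintro c b ⟨hc, hcb, hmax⟩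
    have hc' : p.getVert (idx c) = c := hmem c hc
    by_cases hb : b ∈ p.support
    · have hlt' : idx c < idx b := by
        rcases (hlt c b).1 hcb with h | h
        · exact h
        · rw [htag c hc, htag b hb] at h
          omega
      have hbl := hidx b
      have hd : idx (p.getVert (idx b - 1)) = idx b - 1 := hidx_getVert _ (by omega)
      have := hle _ _ (hmax _ (p.getVert_mem_support (idx b - 1))
        ((hlt _ _).2 (Or.inl (by omega))))
      have hsucc : idx b = idx c + 1 := by omega
      have hadj := p.adj_getVert_succ (i := idx c) (by omega)
      rwa [← hsucc, hc', hmem b hb] at hadj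
    · have hd := hidx_getVert _ (hidx b)
      have h1 := hle _ _ (hmax _ (p.getVert_mem_support (idx b)) ((hlt _ _).2 (Or.inr ⟨hd, by
        rw [htag _ (p.getVert_mem_support _), htag' b hb]
        omega⟩)))
      have h2 : idx c = idx b := le_antisymm (hle _ _ hcb.le) (hd ▸ h1)
      rw [← hc', h2]
      exact hnot b hb
  let H : SimpleGraph V :=
    { Adj := fun a b => IsParent C a b ∨ IsParent C b a
      symm := ⟨fun a b h => h.symm⟩
      loopless := ⟨fun a h => by rcases h with h | h <;> exact lt_irrefl _ h.2.1⟩ }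
  have hHG : H ≤ G := by
    rintro a b (h | h)
    · exact hparent a b h
    · exact (hparent b a h).symm
  have hreach : ∀ b, H.Reachable u b := by
    intro b
    induction b using WellFoundedLT.induction with
    | ind b ih =>
      rcases (hu b).eq_or_lt with rfl | hub
      · exact SimpleGraph.Reachable.refl _
      · obtain ⟨c, hc, hmax⟩ := Finset.exists_max_image
          (Finset.univ.filter fun c => c ∈ C ∧ c < b) id
          ⟨u, by simpa [C] using hub⟩
        simp only [Finset.mem_filter, Finset.mem_univ, true_and, id] at hc hmax
        have hcb : H.Adj c b := Or.inl ⟨hc.1, hc.2, fun d hd hdb => hmax d ⟨hd, hdb⟩⟩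
        exact (ih c hc.2).trans hcb.reachable
  have hH : H.Connected :=
    { preconnected := fun a b => (hreach a).symm.trans (hreach b)
      nonempty := ⟨u⟩ }
  have hGH : G ≤ H := (SimpleGraph.isTree_iff_minimal_connected.1 hT).2 hH hHG
  refine ⟨inferInstance, C, fun b hb => ?_, fun a b hab => ⟨fun h => ?_, hparent a b⟩⟩
  · rw [le_antisymm (hb u) (hu b)]
    exact p.start_mem_support
  · exact (hGH h).resolve_right fun h' => hab.not_gt h'.2.1

end Ordering

end CaterpillarPowers

/-- If `G` is a caterpillar tree on `{1, …, n}`, then `J_G ^ t = J_G ^ (t)` for every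
`t ≥ 1`. -/
theorem ordinary_eq_symbolic_of_caterpillar {n : ℕ} (k : Type) [Field k]
    (G : SimpleGraph (Fin n)) (hG : IsCaterpillar G) :
    ∀ t : ℕ, 1 ≤ t →
      binomialEdgeIdeal k G ^ t = symbolicPower (binomialEdgeIdeal k G) t := by
  intro t _
  obtain ⟨o, C, hC, hP⟩ := CaterpillarPowers.exists_isParentGraph hG
  exact @CaterpillarPowers.pow_eq_symbolicPower k (Fin n) _ o _ C G hC hP t
end

section
/- For the star graph K_{1,t} (one center vertex adjacent to t ≥ 1 leaf vertices, with no other edges), the binomial edge ideal satisfies J_{K_{1,t}}^s = J_{K_{1,t}}^(s) for every integer s ≥ 1. -/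
open MvPolynomial

/-- The star graph `K_{1,t}` on `t + 1` vertices: the center `0` is adjacent to each of the
other `t` vertices, and there are no other edges. -/
def starGraph (t : ℕ) : SimpleGraph (Fin (t + 1)) :=
  SimpleGraph.fromRel fun a _ => a = 0

namespace GenericTwoByN

open Polynomial (degreeLT)

variable (k : Type) [Field k] (n : ℕ)

/-- The coordinate ring `k[x_0, …, x_n, y_0, …, y_n]` of generic `2 × (n + 1)` matrices. -/
abbrev CoordRing := MvPolynomial (Fin (n + 1) ⊕ Fin (n + 1)) k

variable {n}

/-- The `2`-minor `x_i y_j - x_j y_i`. -/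
noncomputable def minor (i j : Fin (n + 1)) : CoordRing k n :=
  X (Sum.inl i) * X (Sum.inr j) - X (Sum.inl j) * X (Sum.inr i)

variable (n)

/-- The ideal of all `2`-minors of the generic `2 × (n + 1)` matrix. -/
noncomputable def minorIdeal : Ideal (CoordRing k n) :=
  Ideal.span {f | ∃ i j, f = minor k i j}

/-- The ideal generated by the entries of the column with index `0`. -/
noncomputable def colIdeal : Ideal (CoordRing k n) :=
  Ideal.span {X (Sum.inl 0), X (Sum.inr 0)}

/-- The homomorphism multiplying the entries of the column `0` by a new variable; it records the
grading by the degree in these entries. -/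
noncomputable def scaleCol : CoordRing k n →ₐ[k] Polynomial (CoordRing k n) :=
  aeval (Sum.elim
    (fun i => (if i = 0 then Polynomial.X else 1) * Polynomial.C (X (Sum.inl i)))
    (fun i => (if i = 0 then Polynomial.X else 1) * Polynomial.C (X (Sum.inr i))))

/-- The polynomials of degree less than `d` in the entries of the column `0`. -/
noncomputable def colDegreeLT (d : ℕ) : Submodule k (CoordRing k n) :=
  ((degreeLT (CoordRing k n) d).restrictScalars k).comap (scaleCol k n).toLinearMap

variable {k n}

lemma minor_mem (i j : Fin (n + 1)) : minor k i j ∈ minorIdeal k n :=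
  Ideal.subset_span ⟨i, j, rfl⟩

lemma minor_self (i : Fin (n + 1)) : minor k i i = 0 := by
  simp [minor]

lemma minor_swap (i j : Fin (n + 1)) : minor k i j = -minor k j i := by
  simp only [minor]; ring

lemma X_inl_mem_colIdeal : (X (Sum.inl 0) : CoordRing k n) ∈ colIdeal k n :=
  Ideal.subset_span (by simp)

lemma X_inr_mem_colIdeal : (X (Sum.inr 0) : CoordRing k n) ∈ colIdeal k n :=
  Ideal.subset_span (by simp)

lemma mem_colDegreeLT {d : ℕ} {h : CoordRing k n} :
    h ∈ colDegreeLT k n d ↔ (scaleCol k n h).degree < d := by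
  simp [colDegreeLT, Polynomial.mem_degreeLT]

lemma eval_one_scaleCol (h : CoordRing k n) : (scaleCol k n h).eval 1 = h := by
  have : ((Polynomial.evalRingHom (1 : CoordRing k n)).comp (scaleCol k n).toRingHom) =
      RingHom.id _ := by
    apply MvPolynomial.ringHom_ext
    · intro r
      simp [scaleCol, algebraMap_eq, Polynomial.algebraMap_apply]
    · rintro (i | i) <;> by_cases hi : i = 0 <;> simp [scaleCol, hi]
  exact RingHom.congr_fun this h

lemma X_dvd_scaleCol_of_mem {d : ℕ} {h : CoordRing k n} (hh : h ∈ colIdeal k n ^ d) :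
    Polynomial.X ^ d ∣ scaleCol k n h := by
  have h1 : (colIdeal k n).map (scaleCol k n) ≤ Ideal.span {Polynomial.X} := by
    rw [colIdeal, Ideal.map_span, Ideal.span_le]
    rintro _ ⟨f, (rfl | rfl), rfl⟩ <;>
      simp [scaleCol, Ideal.mem_span_singleton]
  have h2 := Ideal.pow_right_mono h1 d (by
    rw [← Ideal.map_pow]; exact Ideal.mem_map_of_mem _ hh)
  rwa [Ideal.span_singleton_pow, Ideal.mem_span_singleton] at h2

lemma eq_zero_of_mem_colDegreeLT {d : ℕ} {h : CoordRing k n} (hd : h ∈ colDegreeLT k n d)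
    (hh : Polynomial.X ^ d ∣ scaleCol k n h) : h = 0 := by
  rw [← eval_one_scaleCol h]
  have : scaleCol k n h = 0 := by
    refine Polynomial.eq_zero_of_dvd_of_degree_lt hh ?_
    rw [Polynomial.degree_X_pow]; exact mem_colDegreeLT.1 hd
  simp [this]

lemma mul_mem_colDegreeLT {d e : ℕ} {q h : CoordRing k n} (hq : (scaleCol k n q).degree ≤ e)
    (hh : h ∈ colDegreeLT k n d) : q * h ∈ colDegreeLT k n (d + e) := by
  rw [mem_colDegreeLT] at *
  rw [map_mul, Polynomial.degree_mul]
  by_cases h0 : scaleCol k n h = 0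
  · simp [h0]
  · by_cases q0 : scaleCol k n q = 0
    · simp [q0]
    rw [Polynomial.degree_eq_natDegree h0] at *
    rw [Polynomial.degree_eq_natDegree q0] at *
    norm_cast at *
    omega

lemma degree_scaleCol_X_zero : (scaleCol k n (X (Sum.inl 0))).degree ≤ (1 : ℕ) ∧
    (scaleCol k n (X (Sum.inr 0))).degree ≤ (1 : ℕ) := by
  simp [scaleCol, Polynomial.degree_C (X_ne_zero _)]

lemma degree_scaleCol_X {i : Fin (n + 1)} (hi : i ≠ 0) :
    (scaleCol k n (X (Sum.inl i))).degree ≤ (0 : ℕ) ∧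
    (scaleCol k n (X (Sum.inr i))).degree ≤ (0 : ℕ) := by
  simp [scaleCol, hi, Polynomial.degree_C (X_ne_zero _)]

lemma scaleCol_minor {i j : Fin (n + 1)} (hi : i ≠ 0) (hj : j ≠ 0) :
    scaleCol k n (minor k i j) = Polynomial.C (minor k i j) := by
  simp [scaleCol, minor, hi, hj]

lemma scaleCol_minor_zero {j : Fin (n + 1)} (hj : j ≠ 0) :
    scaleCol k n (minor k 0 j) = Polynomial.C (minor k 0 j) * Polynomial.X := by
  simp only [scaleCol, minor, hj, map_sub, map_mul, aeval_X, Sum.elim_inl, Sum.elim_inr, if_true,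
    if_false]
  ring

section Decomposition

variable {W W' : ℕ → Submodule k (CoordRing k n)} {q p : CoordRing k n}

lemma mul_mem_sup_of_degree_zero (hq : (scaleCol k n q).degree ≤ (0 : ℕ))
    (hW : ∀ d, ∀ w ∈ W d, q * w ∈ W' d) (hp : ∀ d, p ∈ W d ⊔ colDegreeLT k n d) (d : ℕ) :
    q * p ∈ W' d ⊔ colDegreeLT k n d := by
  obtain ⟨w, hw, l, hl, rfl⟩ := Submodule.mem_sup.1 (hp d)
  have hl' : q * l ∈ colDegreeLT k n d := mul_mem_colDegreeLT (d := d) (e := 0) hq hl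
  rw [mul_add]
  exact Submodule.add_mem_sup (hW d w hw) hl'

lemma mul_mem_sup_of_degree_one (hq : (scaleCol k n q).degree ≤ (1 : ℕ))
    (hW : ∀ d, ∀ w ∈ W d, q * w ∈ W' (d + 1)) (h0 : q * p ∈ W' 0)
    (hp : ∀ d, p ∈ W d ⊔ colDegreeLT k n d) (d : ℕ) :
    q * p ∈ W' d ⊔ colDegreeLT k n d := by
  cases d with
  | zero => exact Submodule.mem_sup_left h0
  | succ d =>
    obtain ⟨w, hw, l, hl, rfl⟩ := Submodule.mem_sup.1 (hp d)
    have hl' : q * l ∈ colDegreeLT k n (d + 1) := mul_mem_colDegreeLT hq hl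
    rw [mul_add]
    exact Submodule.add_mem_sup (hW d w hw) hl'

end Decomposition

/-- A family `W s d` that contains `minorIdeal ^ s` for `d = 0` and is compatible with
multiplication by variables and minors contains every element of `minorIdeal ^ s` up to terms of
degree less than `d` in the entries of the column `0`. -/
theorem minorIdeal_pow_le_sup (W : ℕ → ℕ → Submodule k (CoordRing k n))
    (hzero : ∀ s, ∀ p ∈ minorIdeal k n ^ s, p ∈ W s 0)
    (hXl : ∀ i ≠ 0, ∀ d, ∀ w ∈ W 0 d, X (Sum.inl i) * w ∈ W 0 d)
    (hXr : ∀ i ≠ 0, ∀ d, ∀ w ∈ W 0 d, X (Sum.inr i) * w ∈ W 0 d)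
    (hXl0 : ∀ d, ∀ w ∈ W 0 d, X (Sum.inl 0) * w ∈ W 0 (d + 1))
    (hXr0 : ∀ d, ∀ w ∈ W 0 d, X (Sum.inr 0) * w ∈ W 0 (d + 1))
    (hM : ∀ i ≠ 0, ∀ j ≠ 0, ∀ s d, ∀ w ∈ W s d, minor k i j * w ∈ W (s + 1) d)
    (hM0 : ∀ j ≠ 0, ∀ s d, ∀ w ∈ W s d, minor k 0 j * w ∈ W (s + 1) (d + 1))
    (s : ℕ) : ∀ p ∈ minorIdeal k n ^ s, ∀ d, p ∈ W s d ⊔ colDegreeLT k n d := by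
  induction s with
  | zero =>
    intro p _
    induction p using MvPolynomial.induction_on with
    | C a =>
      intro d
      cases d with
      | zero => exact Submodule.mem_sup_left (hzero 0 _ (by simp))
      | succ d =>
        refine Submodule.mem_sup_right (mem_colDegreeLT.2 ?_)
        have : scaleCol k n (C a) = Polynomial.C (C a) := by
          rw [← algebraMap_eq, AlgHom.commutes, Polynomial.algebraMap_apply]
        rw [this]
        exact Polynomial.degree_C_le.trans_lt (by exact_mod_cast Nat.succ_pos d)
    | add p q hp hq => exact fun d => add_mem (hp (by simp) d) (hq (by simp) d)
    | mul_X p i hp =>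
      have hp' := hp (by simp)
      rw [mul_comm]
      obtain i | i := i <;> by_cases hi : i = 0
      · subst hi
        exact mul_mem_sup_of_degree_one degree_scaleCol_X_zero.1 hXl0 (hzero 0 _ (by simp)) hp'
      · exact mul_mem_sup_of_degree_zero (degree_scaleCol_X hi).1 (hXl i hi) hp'
      · subst hi
        exact mul_mem_sup_of_degree_one degree_scaleCol_X_zero.2 hXr0 (hzero 0 _ (by simp)) hp'
      · exact mul_mem_sup_of_degree_zero (degree_scaleCol_X hi).2 (hXr i hi) hp'
  | succ s ih =>
    have key0 : ∀ j ≠ 0, ∀ p ∈ minorIdeal k n ^ s, ∀ d,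
        minor k 0 j * p ∈ W (s + 1) d ⊔ colDegreeLT k n d := by
      intro j hj p hp
      refine mul_mem_sup_of_degree_one ?_ (hM0 j hj s) (hzero _ _ ?_) (ih p hp)
      · rw [scaleCol_minor_zero hj]
        exact Polynomial.degree_C_mul_X_le _
      · rw [pow_succ']
        exact Ideal.mul_mem_mul (minor_mem _ _) hp
    have key : ∀ i j, ∀ p ∈ minorIdeal k n ^ s, ∀ d,
        minor k i j * p ∈ W (s + 1) d ⊔ colDegreeLT k n d := by
      intro i j p hp d
      by_cases hi : i = 0 <;> by_cases hj : j = 0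
      · simp [hi, hj, minor_self]
      · exact hi ▸ key0 j hj p hp d
      · rw [minor_swap, neg_mul, neg_mem_iff]
        exact hj ▸ key0 i hi p hp d
      · refine mul_mem_sup_of_degree_zero ?_ (hM i hi j hj s) (ih p hp) d
        rw [scaleCol_minor hi hj]
        exact Polynomial.degree_C_le
    intro p hp d
    rw [pow_succ'] at hp
    induction hp using Submodule.mul_induction_on' with
    | add x _ y _ hx hy => exact add_mem hx hy
    | mem_mul_mem a ha b hb =>
      induction ha using Submodule.span_induction generalizing b with
      | mem x hx =>
        obtain ⟨i, j, rfl⟩ := hx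
        exact key i j b hb d
      | zero => simp
      | add x y _ _ hx hy => rw [add_mul]; exact add_mem (hx b hb) (hy b hb)
      | smul r x _ hx =>
        rw [smul_eq_mul, mul_comm r, mul_assoc]
        exact hx _ (Ideal.mul_mem_left _ r hb)

section DuplicateColumn

variable (k n)

/-- The homomorphism that keeps the columns `1, …, n + 1` (as the columns `0, …, n`) and replaces
the column `0` by a multiple, with indeterminate factor, of its neighbour. -/
noncomputable def duplicateCol : CoordRing k (n + 1) →ₐ[k] Polynomial (CoordRing k n) :=
  aeval (Sum.elim
    (Fin.cases (Polynomial.X * Polynomial.C (X (Sum.inl 0)))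
      (fun i => Polynomial.C (X (Sum.inl i))))
    (Fin.cases (Polynomial.X * Polynomial.C (X (Sum.inr 0)))
      (fun i => Polynomial.C (X (Sum.inr i)))))

/-- The inclusion as the polynomials in the columns `1, …, n + 1`. -/
noncomputable def succCol : CoordRing k n →ₐ[k] CoordRing k (n + 1) :=
  rename (Sum.map Fin.succ Fin.succ)

variable {k n}

lemma duplicateCol_succCol (h : CoordRing k n) :
    duplicateCol k n (succCol k n h) = Polynomial.C h := by
  have : (duplicateCol k n).comp (succCol k n) = Polynomial.CAlgHom := by
    apply MvPolynomial.algHom_ext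
    rintro (i | i) <;> simp [duplicateCol, succCol]
  exact DFunLike.congr_fun this h

lemma duplicateCol_minor_succ (i j : Fin (n + 1)) :
    duplicateCol k n (minor k i.succ j.succ) = Polynomial.C (minor k i j) := by
  simp [duplicateCol, minor]

lemma duplicateCol_minor_zero_succ (j : Fin (n + 1)) :
    duplicateCol k n (minor k 0 j.succ) = Polynomial.C (minor k 0 j) * Polynomial.X := by
  simp [duplicateCol, minor]
  ring

lemma coeff_duplicateCol_mem (q : CoordRing k (n + 1)) (d : ℕ) :
    (duplicateCol k n q).coeff d ∈ colIdeal k n ^ d := by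
  suffices duplicateCol k n q ∈ reesAlgebra (colIdeal k n) from this d
  have hX : ∀ x ∈ colIdeal k n, Polynomial.X * Polynomial.C x ∈ reesAlgebra (colIdeal k n) := by
    intro x hx
    rw [Polynomial.X_mul_C, Polynomial.C_mul_X_eq_monomial, reesAlgebra.monomial_mem, pow_one]
    exact hx
  have hC : ∀ x, Polynomial.C x ∈ reesAlgebra (colIdeal k n) :=
    fun x => Subalgebra.algebraMap_mem _ x
  induction q using MvPolynomial.induction_on with
  | C a =>
    rw [← algebraMap_eq, AlgHom.commutes, Polynomial.algebraMap_apply]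
    exact hC _
  | add p q hp hq => rw [map_add]; exact add_mem hp hq
  | mul_X p i hp =>
    rw [map_mul]
    refine mul_mem hp ?_
    rcases i with i | i <;> refine Fin.cases ?_ (fun i => ?_) i <;>
      simp only [duplicateCol, aeval_X, Sum.elim_inl, Sum.elim_inr, Fin.cases_zero, Fin.cases_succ]
    exacts [hX _ X_inl_mem_colIdeal, hC _, hX _ X_inr_mem_colIdeal, hC _]

lemma X_mul_mem_span_minor {g : CoordRing k (n + 1)}
    (hg : X (Sum.inl 1) * g ∈ Ideal.span {minor k (0 : Fin (n + 2)) 1}) :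
    g ∈ Ideal.span {minor k (0 : Fin (n + 2)) 1} := by
  rw [Ideal.mem_span_singleton] at *
  obtain ⟨h, hh⟩ := hg
  have hp : Prime (X (Sum.inl 1) : CoordRing k (n + 1)) := X_prime
  have hnd : ¬ (X (Sum.inl 1) : CoordRing k (n + 1)) ∣ minor k 0 1 := by
    rintro ⟨r, hr⟩
    have := congrArg (aeval (R := k) (Function.update (fun _ => (1 : k)) (Sum.inl 1) 0)) hr
    simp [minor, Function.update] at this
  obtain ⟨h', rfl⟩ := (hp.dvd_or_dvd ⟨g, hh.symm⟩).resolve_left hnd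
  refine ⟨h', mul_left_cancel₀ hp.ne_zero ?_⟩
  rw [hh]; ring

/-- The kernel of `duplicateCol` is generated by the minor of the first two columns. -/
lemma mem_span_minor_of_duplicateCol_eq_zero {g : CoordRing k (n + 1)}
    (hg : duplicateCol k n g = 0) : g ∈ Ideal.span {minor k (0 : Fin (n + 2)) 1} := by
  set I := Ideal.span {minor k (0 : Fin (n + 2)) 1}
  let ι : Polynomial (CoordRing k n) →+* CoordRing k (n + 1) :=
    Polynomial.eval₂RingHom (succCol k n).toRingHom (X (Sum.inl 0))
  have hιC : ∀ h, ι (Polynomial.C h) = succCol k n h := fun h => by simp [ι]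
  have hιX : ι Polynomial.X = X (Sum.inl 0) := by simp [ι]
  have hex : ∀ g : CoordRing k (n + 1), ∃ N G, X (Sum.inl 1) ^ N * g - ι G ∈ I := by
    intro g
    induction g using MvPolynomial.induction_on with
    | C a =>
      refine ⟨0, Polynomial.C (C a), ?_⟩
      rw [hιC]
      simp [succCol]
    | add p q hp hq =>
      obtain ⟨N, G, h1⟩ := hp
      obtain ⟨M, H, h2⟩ := hq
      refine ⟨N + M,
        Polynomial.C (X (Sum.inl 0)) ^ M * G + Polynomial.C (X (Sum.inl 0)) ^ N * H, ?_⟩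
      have hx : ι (Polynomial.C (X (Sum.inl 0))) = X (Sum.inl 1) := by
        rw [hιC]; simp [succCol]
      rw [map_add, map_mul, map_mul, map_pow, map_pow, hx]
      convert! add_mem (I.mul_mem_left (X (Sum.inl 1) ^ M) h1)
        (I.mul_mem_left (X (Sum.inl 1) ^ N) h2) using 1
      ring
    | mul_X p i hp =>
      obtain ⟨N, G, h1⟩ := hp
      have hvar : ∀ (v : CoordRing k (n + 1)) (H), ι H = v →
          ∃ N G, X (Sum.inl 1) ^ N * (p * v) - ι G ∈ I := by
        rintro _ H rfl
        refine ⟨N, G * H, ?_⟩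
        rw [map_mul]
        convert! I.mul_mem_left (ι H) h1 using 1
        ring
      rcases i with i | i <;> rcases Fin.eq_zero_or_eq_succ i with rfl | ⟨i, rfl⟩
      · exact hvar _ _ hιX
      · exact hvar _ (Polynomial.C (X (Sum.inl i))) (by rw [hιC]; simp [succCol])
      · refine ⟨N + 1, G * (Polynomial.X * Polynomial.C (X (Sum.inr 0))), ?_⟩
        have hy : ι (Polynomial.C (X (Sum.inr 0))) = X (Sum.inr 1) := by
          rw [hιC]; simp [succCol]
        rw [map_mul, map_mul, hιX, hy]
        convert! sub_mem (I.mul_mem_left (X (Sum.inl 0) * X (Sum.inr 1)) h1)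
          (I.mul_mem_left (X (Sum.inl 1) ^ N * p) (Ideal.mem_span_singleton_self _)) using 1
        simp only [minor]
        ring
      · exact hvar _ (Polynomial.C (X (Sum.inr i))) (by rw [hιC]; simp [succCol])
  obtain ⟨N, G, hG⟩ := hex g
  have hker : ∀ q ∈ I, duplicateCol k n q = 0 := by
    intro q hq
    obtain ⟨r, rfl⟩ := Ideal.mem_span_singleton.1 hq
    have h01 := duplicateCol_minor_zero_succ (k := k) (0 : Fin (n + 1))
    rw [minor_self, Fin.succ_zero_eq_one] at h01
    rw [map_mul, h01]; simp
  have hcomp : ∀ G, duplicateCol k n (ι G) =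
      G.comp (Polynomial.C (X (Sum.inl 0)) * Polynomial.X) := by
    intro G
    induction G using Polynomial.induction_on' with
    | add p q hp hq => simp [hp, hq]
    | monomial d a =>
      rw [← Polynomial.C_mul_X_pow_eq_monomial, map_mul, map_pow, map_mul, map_pow, hιX, hιC,
        duplicateCol_succCol]
      simp [duplicateCol]
  have hG0 : G = 0 := by
    have h := hker _ hG
    rw [map_sub, map_mul, hg, mul_zero, zero_sub, neg_eq_zero, hcomp] at h
    ext1 d
    have h' := congrArg (fun p => Polynomial.coeff p d) h
    simpa [X_ne_zero] using h'
  rw [hG0, map_zero, sub_zero] at hG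
  clear hg
  induction N with
  | zero => simpa using hG
  | succ N ih =>
    refine ih (X_mul_mem_span_minor ?_)
    rwa [← mul_assoc, ← pow_succ']

/-- An element of `minorIdeal ^ s` divisible to order `d` by the column `0` lifts along
`duplicateCol`, after multiplication with the `d`-th power of the variable. -/
lemma exists_duplicateCol_eq {s d : ℕ} {h : CoordRing k n} (hs : h ∈ minorIdeal k n ^ s)
    (hd : h ∈ colIdeal k n ^ d) :
    ∃ q ∈ minorIdeal k (n + 1) ^ s, duplicateCol k n q = Polynomial.monomial d h := by
  let W : ℕ → ℕ → Submodule k (CoordRing k n) := fun s d =>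
    (((minorIdeal k (n + 1) ^ s).restrictScalars k).map (duplicateCol k n).toLinearMap).comap
      ((Polynomial.monomial d).restrictScalars k)
  have hW : ∀ {s d h}, h ∈ W s d ↔
      ∃ q ∈ minorIdeal k (n + 1) ^ s, duplicateCol k n q = Polynomial.monomial d h := by
    intro s d h
    simp [W]
  have hsucc : (minorIdeal k n).map (succCol k n) ≤ minorIdeal k (n + 1) := by
    rw [minorIdeal, Ideal.map_span, Ideal.span_le]
    rintro _ ⟨_, ⟨i, j, rfl⟩, rfl⟩
    convert! minor_mem (k := k) i.succ j.succ using 1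
    simp [succCol, minor]
  have hmul0 : ∀ {s s' d w} (q' r), (∀ q ∈ minorIdeal k (n + 1) ^ s,
      q' * q ∈ minorIdeal k (n + 1) ^ s') → duplicateCol k n q' = Polynomial.C r →
      w ∈ W s d → r * w ∈ W s' d := by
    intro s s' d w q' r h1 h2 hw
    obtain ⟨q, hq, e⟩ := hW.1 hw
    refine hW.2 ⟨q' * q, h1 q hq, ?_⟩
    rw [map_mul, h2, e, Polynomial.C_mul_monomial]
  have hmul1 : ∀ {s s' d w} (q' r), (∀ q ∈ minorIdeal k (n + 1) ^ s,
      q' * q ∈ minorIdeal k (n + 1) ^ s') →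
      duplicateCol k n q' = Polynomial.C r * Polynomial.X →
      w ∈ W s d → r * w ∈ W s' (d + 1) := by
    intro s s' d w q' r h1 h2 hw
    obtain ⟨q, hq, e⟩ := hW.1 hw
    refine hW.2 ⟨q' * q, h1 q hq, ?_⟩
    rw [map_mul, h2, e, mul_assoc, Polynomial.X_mul_monomial, Polynomial.C_mul_monomial]
  have hminor : ∀ i j s, ∀ q ∈ minorIdeal k (n + 1) ^ s,
      minor k i j * q ∈ minorIdeal k (n + 1) ^ (s + 1) := by
    intro i j s q hq
    rw [pow_succ']
    exact Ideal.mul_mem_mul (minor_mem i j) hq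
  have hdec := minorIdeal_pow_le_sup W
    (fun s p hp => hW.2 ⟨succCol k n p,
      Ideal.pow_right_mono hsucc s (by rw [← Ideal.map_pow]; exact Ideal.mem_map_of_mem _ hp),
      duplicateCol_succCol p⟩)
    (fun i _ d w hw => hmul0 (X (Sum.inl i.succ)) _ (by simp) (by simp [duplicateCol]) hw)
    (fun i _ d w hw => hmul0 (X (Sum.inr i.succ)) _ (by simp) (by simp [duplicateCol]) hw)
    (fun d w hw => hmul1 (X (Sum.inl 0)) _ (by simp) (by simp [duplicateCol]) hw)
    (fun d w hw => hmul1 (X (Sum.inr 0)) _ (by simp) (by simp [duplicateCol]) hw)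
    (fun i _ j _ s d w hw => hmul0 _ _ (hminor i.succ j.succ s) (duplicateCol_minor_succ i j) hw)
    (fun j _ s d w hw => hmul1 _ _ (hminor 0 j.succ s) (duplicateCol_minor_zero_succ j) hw)
    s h hs d
  obtain ⟨w, hw, l, hl, rfl⟩ := Submodule.mem_sup.1 hdec
  have hwd : w ∈ colIdeal k n ^ d := by
    obtain ⟨q, -, e⟩ := hW.1 hw
    have := coeff_duplicateCol_mem q d
    rwa [e, Polynomial.coeff_monomial_same] at this
  have hl0 : l = 0 := eq_zero_of_mem_colDegreeLT hl
    (X_dvd_scaleCol_of_mem ((Ideal.add_mem_iff_right _ hwd).1 hd))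
  rw [hl0, add_zero]
  exact hW.1 hw

end DuplicateColumn

section Perturbation

variable (k n)

/-- The ring of parameters `a_i`, `z_i`, `u`, `v` for perturbations of matrices of rank one. -/
abbrev ParamRing := MvPolynomial (Fin (n + 1) ⊕ Fin (n + 1) ⊕ Bool) k

/-- The evaluation at the generic first order perturbation `x_i = a_i u`, `y_i = a_i (v + ε z_i)`
of a rank one matrix, where `ε` is the polynomial variable. -/
noncomputable def perturb : CoordRing k n →ₐ[k] Polynomial (ParamRing k n) :=
  aeval (Sum.elim
    (fun i => Polynomial.C (X (Sum.inl i) * X (Sum.inr (Sum.inr false))))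
    (fun i => Polynomial.C (X (Sum.inl i)) *
      (Polynomial.C (X (Sum.inr (Sum.inr true))) +
        Polynomial.X * Polynomial.C (X (Sum.inr (Sum.inl i))))))

variable {k n}

lemma perturb_minor (i j : Fin (n + 1)) :
    perturb k n (minor k i j) = Polynomial.C (X (Sum.inl i) * X (Sum.inl j) *
      X (Sum.inr (Sum.inr false)) * (X (Sum.inr (Sum.inl j)) - X (Sum.inr (Sum.inl i)))) *
      Polynomial.X := by
  simp only [perturb, minor, map_sub, map_mul, aeval_X, Sum.elim_inl, Sum.elim_inr]
  ring

lemma X_pow_dvd_perturb_of_mem {s : ℕ} {g : CoordRing k n} (hg : g ∈ minorIdeal k n ^ s) :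
    Polynomial.X ^ s ∣ perturb k n g := by
  have h1 : (minorIdeal k n).map (perturb k n) ≤ Ideal.span {Polynomial.X} := by
    rw [minorIdeal, Ideal.map_span, Ideal.span_le]
    rintro _ ⟨_, ⟨i, j, rfl⟩, rfl⟩
    rw [perturb_minor]
    exact Ideal.mul_mem_left _ _ (Ideal.mem_span_singleton_self _)
  have h2 := Ideal.pow_right_mono h1 s (by
    rw [← Ideal.map_pow]; exact Ideal.mem_map_of_mem _ hg)
  rwa [Ideal.span_singleton_pow, Ideal.mem_span_singleton] at h2

lemma eq_zero_of_X_dvd_perturb {g : CoordRing k 0} (hg : Polynomial.X ∣ perturb k 0 g) :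
    g = 0 := by
  let φ : ParamRing k 0 →ₐ[k] CoordRing k 0 :=
    aeval (Sum.elim (fun _ => 1) (Sum.elim (fun _ => 0)
      (fun b => if b then X (Sum.inr 0) else X (Sum.inl 0))))
  have hinv : (Polynomial.eval₂RingHom φ.toRingHom 0).comp (perturb k 0).toRingHom =
      RingHom.id _ := by
    apply MvPolynomial.ringHom_ext
    · intro r
      simp [perturb, algebraMap_eq, Polynomial.algebraMap_apply, φ]
    · rintro (i | i) <;> simp [perturb, φ, Fin.fin_one_eq_zero i]
  obtain ⟨r, hr⟩ := hg
  have h := RingHom.congr_fun hinv g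
  simpa [hr] using h.symm

lemma X_pow_dvd_perturb_coeff {s : ℕ} {g : CoordRing k (n + 1)}
    (hg : Polynomial.X ^ s ∣ perturb k (n + 1) g) (d : ℕ) :
    Polynomial.X ^ s ∣ perturb k n ((duplicateCol k n g).coeff d) := by
  let ι : ParamRing k n →+* Polynomial (Polynomial (ParamRing k n)) :=
    Polynomial.C.comp Polynomial.C
  let φ : ParamRing k (n + 1) →ₐ[k] Polynomial (Polynomial (ParamRing k n)) :=
    aeval (Sum.elim
      (Fin.cases (Polynomial.X * ι (X (Sum.inl 0))) (fun i => ι (X (Sum.inl i))))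
      (Sum.elim
        (Fin.cases (ι (X (Sum.inr (Sum.inl 0)))) (fun i => ι (X (Sum.inr (Sum.inl i)))))
        (fun b => ι (X (Sum.inr (Sum.inr b))))))
  let E : Polynomial (ParamRing k (n + 1)) →+* Polynomial (Polynomial (ParamRing k n)) :=
    Polynomial.eval₂RingHom (φ : ParamRing k (n + 1) →+* Polynomial (Polynomial (ParamRing k n)))
      (Polynomial.C (Polynomial.X : Polynomial (ParamRing k n)))
  have hEX : E Polynomial.X = Polynomial.C Polynomial.X := by simp [E]
  have hEC : ∀ r, E (Polynomial.C r) = φ r := fun r => by simp [E]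
  clear_value E
  have hcomm : E.comp (perturb k (n + 1)).toRingHom =
      (Polynomial.mapRingHom (perturb k n).toRingHom).comp (duplicateCol k n).toRingHom := by
    apply MvPolynomial.ringHom_ext
    · intro r
      simp [perturb, duplicateCol, algebraMap_eq, Polynomial.algebraMap_apply, hEC, φ]
    · rintro (i | i) <;> rcases Fin.eq_zero_or_eq_succ i with rfl | ⟨i, rfl⟩ <;>
        simp [perturb, duplicateCol, hEC, hEX, φ, ι, -Polynomial.X_mul_C] <;> ring
  have h := RingHom.congr_fun hcomm g
  obtain ⟨r, hr⟩ := hg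
  have hdvd : Polynomial.C (Polynomial.X ^ s) ∣
      (duplicateCol k n g).map (perturb k n).toRingHom := by
    refine ⟨E r, ?_⟩
    simpa [hr, hEX] using h.symm
  simpa using (Polynomial.C_dvd_iff_dvd_coeff _ _).1 hdvd d

/-- The powers of the ideal of maximal minors of the generic matrix with two rows are given by the
order of vanishing along the rank one matrices. -/
theorem mem_minorIdeal_pow_iff {s : ℕ} {g : CoordRing k n} :
    g ∈ minorIdeal k n ^ s ↔ Polynomial.X ^ s ∣ perturb k n g := by
  refine ⟨X_pow_dvd_perturb_of_mem, ?_⟩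
  induction n generalizing s with
  | zero =>
    intro h
    cases s with
    | zero => simp
    | succ s =>
      rw [eq_zero_of_X_dvd_perturb ((dvd_pow_self _ s.succ_ne_zero).trans h)]
      exact zero_mem _
  | succ n ihn =>
    induction s generalizing g with
    | zero => simp
    | succ s ihs =>
      intro hg
      choose q hq hqe using fun d => exists_duplicateCol_eq (ihn (X_pow_dvd_perturb_coeff hg d))
        (coeff_duplicateCol_mem g d)
      have hsum : ∑ d ∈ (duplicateCol k n g).support, q d ∈ minorIdeal k (n + 1) ^ (s + 1) :=
        sum_mem fun d _ => hq d
      have hker : duplicateCol k n (g - ∑ d ∈ (duplicateCol k n g).support, q d) = 0 := by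
        rw [map_sub, map_sum, sub_eq_zero]
        simp only [hqe]
        exact Polynomial.as_sum_support _
      obtain ⟨r, hr⟩ := Ideal.mem_span_singleton.1 (mem_span_minor_of_duplicateCol_eq_zero hker)
      have hdvd := dvd_sub hg (X_pow_dvd_perturb_of_mem hsum)
      rw [← map_sub, hr, map_mul, perturb_minor, mul_comm (Polynomial.C _), mul_assoc,
        pow_succ', mul_dvd_mul_iff_left Polynomial.X_ne_zero] at hdvd
      have hr' : r ∈ minorIdeal k (n + 1) ^ s := by
        refine ihs (Polynomial.prime_X.pow_dvd_of_dvd_mul_left s ?_ hdvd)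
        rw [Polynomial.X_dvd_iff, Polynomial.coeff_C_zero]
        refine mul_ne_zero (mul_ne_zero (mul_ne_zero (X_ne_zero _) (X_ne_zero _)) (X_ne_zero _)) ?_
        rw [sub_ne_zero]
        intro h
        simpa using X_injective h
      rw [← sub_add_cancel g (∑ d ∈ (duplicateCol k n g).support, q d), hr, pow_succ']
      exact add_mem (Ideal.mul_mem_mul (minor_mem _ _) hr') (by rwa [← pow_succ'])

lemma minorIdeal_eq_comap : minorIdeal k n =
    (Ideal.span {Polynomial.X}).comap (perturb k n) := by
  ext g
  simpa [Ideal.mem_span_singleton] using mem_minorIdeal_pow_iff (s := 1) (g := g)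

instance minorIdeal_isPrime : (minorIdeal k n).IsPrime := by
  rw [minorIdeal_eq_comap]
  have : (Ideal.span {(Polynomial.X : Polynomial (ParamRing k n))}).IsPrime :=
    (Ideal.span_singleton_prime Polynomial.X_ne_zero).2 Polynomial.prime_X
  exact Ideal.comap_isPrime _ _

/-- The powers of `minorIdeal` are primary. -/
lemma mem_minorIdeal_pow_of_mul_mem {s : ℕ} {c g : CoordRing k n} (hc : c ∉ minorIdeal k n)
    (h : c * g ∈ minorIdeal k n ^ s) : g ∈ minorIdeal k n ^ s := by
  rw [mem_minorIdeal_pow_iff] at *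
  rw [map_mul] at h
  refine Polynomial.prime_X.pow_dvd_of_dvd_mul_left s ?_ h
  rwa [← pow_one Polynomial.X, ← mem_minorIdeal_pow_iff, pow_one]

end Perturbation

section ColIdeal

lemma mem_colIdeal_iff {c : CoordRing k n} :
    c ∈ colIdeal k n ↔ Polynomial.X ∣ scaleCol k n c := by
  refine ⟨fun h => by simpa using X_dvd_scaleCol_of_mem (d := 1) (by simpa using h), fun h => ?_⟩
  have hmk : ((Ideal.Quotient.mk (colIdeal k n)).comp (Polynomial.evalRingHom 0)).comp
      (scaleCol k n).toRingHom = Ideal.Quotient.mk (colIdeal k n) := by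
    apply MvPolynomial.ringHom_ext
    · intro r
      simp [scaleCol, algebraMap_eq, Polynomial.algebraMap_apply]
    · rintro (i | i) <;> by_cases hi : i = 0
      · simpa [scaleCol, hi] using
          (Ideal.Quotient.eq_zero_iff_mem.2 X_inl_mem_colIdeal).symm
      · simp [scaleCol, hi]
      · simpa [scaleCol, hi] using
          (Ideal.Quotient.eq_zero_iff_mem.2 X_inr_mem_colIdeal).symm
      · simp [scaleCol, hi]
  rw [← Ideal.Quotient.eq_zero_iff_mem, ← hmk]
  obtain ⟨r, hr⟩ := h
  simp [hr]

instance colIdeal_isPrime : (colIdeal k n).IsPrime := by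
  have h : colIdeal k n = (Ideal.span {Polynomial.X}).comap (scaleCol k n) := by
    ext g
    rw [mem_colIdeal_iff, Ideal.mem_comap, Ideal.mem_span_singleton]
  rw [h]
  have : (Ideal.span {(Polynomial.X : Polynomial (CoordRing k n))}).IsPrime :=
    (Ideal.span_singleton_prime Polynomial.X_ne_zero).2 Polynomial.prime_X
  exact Ideal.comap_isPrime _ _

end ColIdeal

end GenericTwoByN

open GenericTwoByN

section Star

variable {k : Type} [Field k] {t : ℕ}

lemma minor_zero_mem_binomialEdgeIdeal (j : Fin (t + 1)) :
    minor k 0 j ∈ binomialEdgeIdeal k (starGraph t) := by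
  by_cases hj : j = 0
  · rw [hj, minor_self]; exact zero_mem _
  · exact Ideal.subset_span ⟨0, j, by simp [starGraph, Ne.symm hj], rfl⟩

lemma binomialEdgeIdeal_star_le {I : Ideal (CoordRing k t)} (h : ∀ j, minor k 0 j ∈ I) :
    binomialEdgeIdeal k (starGraph t) ≤ I := by
  rw [binomialEdgeIdeal, Ideal.span_le]
  rintro _ ⟨i, j, hij, rfl⟩
  change minor k i j ∈ I
  simp only [starGraph, SimpleGraph.fromRel_adj] at hij
  obtain ⟨-, rfl | rfl⟩ := hij
  · exact h j
  · rw [minor_swap]; exact neg_mem (h i)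

lemma binomialEdgeIdeal_star_le_minorIdeal :
    binomialEdgeIdeal k (starGraph t) ≤ minorIdeal k t :=
  binomialEdgeIdeal_star_le (minor_mem 0)

lemma binomialEdgeIdeal_star_le_colIdeal :
    binomialEdgeIdeal k (starGraph t) ≤ colIdeal k t :=
  binomialEdgeIdeal_star_le fun _ =>
    sub_mem (Ideal.mul_mem_right _ _ X_inl_mem_colIdeal)
      (Ideal.mul_mem_left _ _ X_inr_mem_colIdeal)

lemma X_inl_mul_minor_mem (i j : Fin (t + 1)) :
    X (Sum.inl 0) * minor k i j ∈ binomialEdgeIdeal k (starGraph t) := by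
  have h : X (Sum.inl 0) * minor k i j =
      X (Sum.inl i) * minor k 0 j - X (Sum.inl j) * minor k 0 i := by
    simp only [minor]; ring
  rw [h]
  exact sub_mem (Ideal.mul_mem_left _ _ (minor_zero_mem_binomialEdgeIdeal j))
    (Ideal.mul_mem_left _ _ (minor_zero_mem_binomialEdgeIdeal i))

lemma X_inr_mul_minor_mem (i j : Fin (t + 1)) :
    X (Sum.inr 0) * minor k i j ∈ binomialEdgeIdeal k (starGraph t) := by
  have h : X (Sum.inr 0) * minor k i j =
      X (Sum.inr i) * minor k 0 j - X (Sum.inr j) * minor k 0 i := by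
    simp only [minor]; ring
  rw [h]
  exact sub_mem (Ideal.mul_mem_left _ _ (minor_zero_mem_binomialEdgeIdeal j))
    (Ideal.mul_mem_left _ _ (minor_zero_mem_binomialEdgeIdeal i))

lemma colIdeal_mul_minorIdeal_le :
    colIdeal k t * minorIdeal k t ≤ binomialEdgeIdeal k (starGraph t) := by
  rw [colIdeal, minorIdeal, Ideal.span_mul_span', Ideal.span_le]
  rintro _ ⟨_, (rfl | rfl), _, ⟨i, j, rfl⟩, rfl⟩
  · exact X_inl_mul_minor_mem i j
  · exact X_inr_mul_minor_mem i j

/-- An element of `minorIdeal ^ s` all of whose terms have degree at least `s` in `x_0, y_0` lies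
in the `s`-th power of the binomial edge ideal of the star with center `0`. -/
lemma mem_binomialEdgeIdeal_star_pow {s : ℕ} {p : CoordRing k t} (hp : p ∈ minorIdeal k t ^ s)
    (hpc : Polynomial.X ^ s ∣ scaleCol k t p) : p ∈ binomialEdgeIdeal k (starGraph t) ^ s := by
  set J := binomialEdgeIdeal k (starGraph t)
  let I : ℕ → ℕ → Ideal (CoordRing k t) := fun s d =>
    colIdeal k t ^ (d - s) * J ^ min d s * minorIdeal k t ^ (s - d)
  have hstep : ∀ s d, minorIdeal k t * I s d ≤ I (s + 1) d := by
    intro s d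
    simp only [I]
    rcases le_or_gt d s with h | h
    · rw [Nat.sub_eq_zero_of_le h, Nat.sub_eq_zero_of_le (h.trans s.le_succ), min_eq_left h,
        min_eq_left (h.trans s.le_succ), Nat.succ_sub h, pow_succ']
      exact le_of_eq (by ring)
    · obtain ⟨e, rfl⟩ := Nat.exists_eq_add_of_lt h
      rw [show s + e + 1 - s = e + 1 by omega, show s + e + 1 - (s + 1) = e by omega,
        show s - (s + e + 1) = 0 by omega, show s + 1 - (s + e + 1) = 0 by omega,
        min_eq_right (by omega), min_eq_right (by omega), pow_zero, mul_one, mul_one]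
      calc minorIdeal k t * (colIdeal k t ^ (e + 1) * J ^ s)
          = colIdeal k t ^ e * ((colIdeal k t * minorIdeal k t) * J ^ s) := by ring
        _ ≤ colIdeal k t ^ e * (J * J ^ s) :=
          Ideal.mul_mono_right (Ideal.mul_mono_left colIdeal_mul_minorIdeal_le)
        _ = colIdeal k t ^ e * J ^ (s + 1) := by ring
  have hstep0 : ∀ s d, J * I s d ≤ I (s + 1) (d + 1) := by
    intro s d
    simp only [I, Nat.add_sub_add_right]
    rw [show min (d + 1) (s + 1) = min d s + 1 by omega]
    exact le_of_eq (by ring)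
  have hcol : ∀ d, colIdeal k t * I 0 d ≤ I 0 (d + 1) := by
    intro d
    simp only [I]
    exact le_of_eq (by simp [pow_succ'])
  have hdec := minorIdeal_pow_le_sup (fun s d => (I s d).restrictScalars k)
    (fun s p hp => by simpa [I] using hp)
    (fun i _ d w hw => Ideal.mul_mem_left _ _ hw)
    (fun i _ d w hw => Ideal.mul_mem_left _ _ hw)
    (fun d w hw => hcol d (Ideal.mul_mem_mul X_inl_mem_colIdeal hw))
    (fun d w hw => hcol d (Ideal.mul_mem_mul X_inr_mem_colIdeal hw))
    (fun i _ j _ s d w hw => hstep s d (Ideal.mul_mem_mul (minor_mem i j) hw))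
    (fun j _ s d w hw => hstep0 s d (Ideal.mul_mem_mul (minor_zero_mem_binomialEdgeIdeal j) hw))
    s p hp s
  obtain ⟨w, hw, l, hl, rfl⟩ := Submodule.mem_sup.1 hdec
  have hwJ : w ∈ J ^ s := by simpa [I] using hw
  have hwc := Ideal.pow_right_mono binomialEdgeIdeal_star_le_colIdeal s hwJ
  rw [map_add] at hpc
  rw [eq_zero_of_mem_colDegreeLT hl ((dvd_add_right (X_dvd_scaleCol_of_mem hwc)).1 hpc), add_zero]
  exact hwJ

lemma minorIdeal_mem_minimalPrimes :
    minorIdeal k t ∈ (binomialEdgeIdeal k (starGraph t)).minimalPrimes := by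
  obtain ⟨p, hp, hle⟩ := Ideal.exists_minimalPrimes_le
    (binomialEdgeIdeal_star_le_minorIdeal (k := k) (t := t))
  have := hp.1.1
  have hx : (X (Sum.inl 0) : CoordRing k t) ∉ p := by
    intro hx
    have h := X_pow_dvd_perturb_of_mem (s := 1) (by simpa using hle hx)
    rw [pow_one, perturb, aeval_X, Sum.elim_inl, Polynomial.X_dvd_iff, Polynomial.coeff_C_zero] at h
    exact mul_ne_zero (X_ne_zero _) (X_ne_zero _) h
  have hge : minorIdeal k t ≤ p := by
    rw [minorIdeal, Ideal.span_le]
    rintro _ ⟨i, j, rfl⟩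
    exact (this.mem_or_mem (hp.1.2 (X_inl_mul_minor_mem i j))).resolve_left hx
  rwa [← le_antisymm hle hge]

lemma colIdeal_mem_minimalPrimes (ht : 2 ≤ t) :
    colIdeal k t ∈ (binomialEdgeIdeal k (starGraph t)).minimalPrimes := by
  obtain ⟨p, hp, hle⟩ := Ideal.exists_minimalPrimes_le
    (binomialEdgeIdeal_star_le_colIdeal (k := k) (t := t))
  have := hp.1.1
  let i : Fin (t + 1) := ⟨1, by omega⟩
  let j : Fin (t + 1) := ⟨2, by omega⟩
  have hi : i ≠ 0 := by simp [i, Fin.ext_iff]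
  have hj : j ≠ 0 := by simp [j, Fin.ext_iff]
  have hij : j ≠ i := by simp [i, j, Fin.ext_iff]
  have hm : minor k i j ∉ p := by
    intro hm
    have h := mem_colIdeal_iff.1 (hle hm)
    rw [scaleCol_minor hi hj, Polynomial.X_dvd_iff, Polynomial.coeff_C_zero] at h
    have h' := congrArg (aeval (R := k) (Sum.elim (Pi.single i (1 : k)) (Pi.single j 1))) h
    simp [minor, hij] at h'
  have hge : colIdeal k t ≤ p := by
    rw [colIdeal, Ideal.span_le]
    rintro _ (rfl | rfl)
    · exact (this.mem_or_mem (hp.1.2 (X_inl_mul_minor_mem i j))).resolve_right hm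
    · exact (this.mem_or_mem (hp.1.2 (X_inr_mul_minor_mem i j))).resolve_right hm
  rwa [← le_antisymm hle hge]

end Star

lemma pow_le_symbolicPower {S : Type*} [CommRing S] (I : Ideal S) (s : ℕ) :
    I ^ s ≤ symbolicPower I s :=
  le_iInf₂ fun _ _ => Ideal.le_comap_map

lemma exists_mul_mem_of_mem_symbolicPower {S : Type*} [CommRing S] {I p : Ideal S} {s : ℕ} {g : S}
    (hg : g ∈ symbolicPower I s) (hp : p ∈ I.minimalPrimes) : ∃ c ∉ p, c * g ∈ I ^ s := by
  have := hp.1.1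
  have h := (Submodule.mem_iInf _).1 ((Submodule.mem_iInf _).1 hg p) hp
  rw [Ideal.mem_comap, IsLocalization.algebraMap_mem_map_algebraMap_iff p.primeCompl] at h
  exact h

/-- For the star graph `K_{1,t}` with `t ≥ 1`, the binomial edge ideal satisfies
`J_{K_{1,t}} ^ s = J_{K_{1,t}} ^ (s)` for every `s ≥ 1`. -/
theorem ordinary_eq_symbolic_of_star (k : Type) [Field k] (t : ℕ) (ht : 1 ≤ t) :
    ∀ s : ℕ, 1 ≤ s →
      binomialEdgeIdeal k (starGraph t) ^ s =
        symbolicPower (binomialEdgeIdeal k (starGraph t)) s := by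
  intro s _
  refine le_antisymm (pow_le_symbolicPower _ s) fun g hg => ?_
  obtain ⟨c, hc, hcg⟩ := exists_mul_mem_of_mem_symbolicPower hg minorIdeal_mem_minimalPrimes
  have hgm : g ∈ minorIdeal k t ^ s := mem_minorIdeal_pow_of_mul_mem hc
    (Ideal.pow_right_mono binomialEdgeIdeal_star_le_minorIdeal s hcg)
  obtain rfl | ht2 := ht.eq_or_lt
  · refine Ideal.pow_right_mono ?_ s hgm
    rw [minorIdeal, Ideal.span_le]
    rintro _ ⟨i, j, rfl⟩
    obtain rfl | rfl | rfl : i = 0 ∨ j = 0 ∨ i = j := by omega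
    · exact minor_zero_mem_binomialEdgeIdeal j
    · rw [minor_swap]
      exact neg_mem (minor_zero_mem_binomialEdgeIdeal i)
    · rw [minor_self]
      exact zero_mem _
  · obtain ⟨b, hb, hbg⟩ := exists_mul_mem_of_mem_symbolicPower hg (colIdeal_mem_minimalPrimes ht2)
    have hbg' := X_dvd_scaleCol_of_mem
      (Ideal.pow_right_mono binomialEdgeIdeal_star_le_colIdeal s hbg)
    rw [map_mul] at hbg'
    refine mem_binomialEdgeIdeal_star_pow hgm
      (Polynomial.prime_X.pow_dvd_of_dvd_mul_left s ?_ hbg')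
    rwa [← mem_colIdeal_iff]
end
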